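/- Let ∂G be piecewise analytic, with the smallest exterior angle λπ, 0 < λ < 2, at the junction points of its analytic arcs. If F ⊂ G is compact, then there is a constant C₁(G,F) > 0, depending only on G and F, such that for every ζ ∈ F and every n ∈ ℕ: (Σ_{k=n+1}^∞ |p_k(ζ)|²)^{1/2} ≤ C₁(G,F) · n^{−λ/(4−2λ)}. -/

import Mathlib

open Complex MeasureTheory Set Filter Metric

noncomputable section

/-- A bounded Jordan domain `G ⊆ ℂ` whose boundary is a rectifiable Jordan curve
of length `l`, given together with a unit-speed (arclength) parametrization `γ`
of the boundary curve `L = frontier G`. -/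
structure JordanDomain where
  /-- the domain -/
  G : Set ℂ
  isOpen : IsOpen G
  nonempty : G.Nonempty
  bounded : Bornology.IsBounded G
  connected : IsConnected G
  simplyConnected : SimplyConnectedSpace ↥G
  /-- the length of the boundary curve -/
  l : ℝ
  l_pos : 0 < l
  /-- arclength parametrization of the boundary curve -/
  γ : ℝ → ℂ
  γ_cont : Continuous γ
  γ_periodic : Function.Periodic γ l
  γ_injOn : InjOn γ (Ico 0 l)
  γ_boundary : γ '' Ico 0 l = frontier G
  /-- `γ` is a unit-speed (arclength) parametrization; in particular the boundary
  is rectifiable with length `l`. -/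
  γ_unitSpeed : ∀ s t : ℝ, s ≤ t → t ≤ s + l →
    eVariationOn γ (Icc s t) = ENNReal.ofReal (t - s)

/-- The `E₂(G)`-norm of (the boundary trace of) a function, computed through the
arclength parametrization of the boundary: `‖g‖₂ = ((1/l) ∫₀^l ‖g(s)‖² ds)^{1/2}`. -/
def JordanDomain.bnorm (D : JordanDomain) (g : ℝ → ℂ) : ℝ :=
  Real.sqrt ((1 / D.l) * ∫ s in (0:ℝ)..D.l, ‖g s‖ ^ 2)

/-- `p` is the sequence of orthonormal polynomials of `E₂(G)` obtained by Gram–Schmidt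
orthonormalization of the monomials `1, z, z², …`: `deg p k = k`, the leading
coefficients are positive reals, and the polynomials are orthonormal with respect to
the arclength inner product `(f,g) = (1/l) ∫_L f conj(g) |dz|`. -/
def JordanDomain.IsONPolys (D : JordanDomain) (p : ℕ → Polynomial ℂ) : Prop :=
  (∀ k, (p k).natDegree = k) ∧
  (∀ k, ∃ c : ℝ, 0 < c ∧ (p k).leadingCoeff = (c : ℂ)) ∧
  (∀ j k, (1 / (D.l : ℂ)) * (∫ s in (0:ℝ)..D.l,
      (p j).eval (D.γ s) * (starRingEnd ℂ) ((p k).eval (D.γ s))) =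
    if j = k then 1 else 0)

/-- The `n`-th partial sum `Σ_{k=0}^n conj(p_k(ζ))·p_k(z)` of the Szegő kernel expansion. -/
def partialSum (p : ℕ → Polynomial ℂ) (ζ : ℂ) (n : ℕ) : ℂ → ℂ := fun z =>
  ∑ k ∈ Finset.range (n + 1), (starRingEnd ℂ) ((p k).eval ζ) * (p k).eval z

/-- The Szegő kernel `K(z,ζ) = Σ_{k=0}^∞ conj(p_k(ζ))·p_k(z)`. -/
def szegoKernel (p : ℕ → Polynomial ℂ) (ζ z : ℂ) : ℂ :=
  ∑' k : ℕ, (starRingEnd ℂ) ((p k).eval ζ) * (p k).eval z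

/-- The approximating polynomials
`J_{2n+1}(z) = (2π/l)·(∫_ζ^z (Σ_{k=0}^n conj(p_k(ζ))p_k(t))² dt) / (Σ_{k=0}^n |p_k(ζ)|²)`;
the (path-independent) integral of the polynomial integrand is written out explicitly,
using `∫_ζ^z t^i dt = (z^{i+1} - ζ^{i+1})/(i+1)`. -/
def Jfun (D : JordanDomain) (p : ℕ → Polynomial ℂ) (ζ : ℂ) (n : ℕ) : ℂ → ℂ := fun z =>
  let S : Polynomial ℂ :=
    (∑ k ∈ Finset.range (n + 1), Polynomial.C ((starRingEnd ℂ) ((p k).eval ζ)) * p k) ^ 2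
  (((2 * Real.pi / D.l : ℝ) : ℂ) / (∑ k ∈ Finset.range (n + 1), ((‖(p k).eval ζ‖ : ℂ)) ^ 2)) *
    ∑ i ∈ Finset.range (S.natDegree + 1),
      S.coeff i * ((z ^ (i + 1) - ζ ^ (i + 1)) / ((i : ℂ) + 1))

/-- `Q_n(z) = ((l/2π)·Σ_{k=0}^n |p_k(ζ)|²)^{-1/2} · Σ_{k=0}^n conj(p_k(ζ))·p_k(z)`,
so that `J'_{2n+1} = Q_n²`. -/
def Qfun (D : JordanDomain) (p : ℕ → Polynomial ℂ) (ζ : ℂ) (n : ℕ) : ℂ → ℂ := fun z =>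
  ((Real.sqrt ((D.l / (2 * Real.pi)) *
      ∑ k ∈ Finset.range (n + 1), ‖(p k).eval ζ‖ ^ 2) : ℝ) : ℂ)⁻¹ * partialSum p ζ n z

/-- The sup norm `⨆_{z ∈ K} ‖f(z)‖` on a set `K ⊆ ℂ`. -/
def supNormOn (K : Set ℂ) (f : ℂ → ℂ) : ℝ := ⨆ z : K, ‖f (z : ℂ)‖

/-- `g` has nontangential limit `v` at the boundary point `w` of `G`:
`g(z) → v` as `z → w` inside every cone `{z ∈ G : ‖z - w‖ ≤ M·dist(z, ∂G)}`. -/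
def NTLim (G : Set ℂ) (g : ℂ → ℂ) (w v : ℂ) : Prop :=
  ∀ M : ℝ, 1 < M →
    Tendsto g (nhdsWithin w {z | z ∈ G ∧ ‖z - w‖ ≤ M * infDist z (frontier G)}) (nhds v)

/-- `φ` is the conformal map of `G` onto the unit disk `D` normalized by
`φ(ζ) = 0` and `φ'(ζ) > 0`. -/
structure ConformalOnto (G : Set ℂ) (φ : ℂ → ℂ) (ζ : ℂ) : Prop where
  differentiable : ∀ z ∈ G, DifferentiableAt ℂ φ z
  bijOn : BijOn φ G (ball (0 : ℂ) 1)
  map_center : φ ζ = 0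
  deriv_center_pos : ∃ c : ℝ, 0 < c ∧ deriv φ ζ = (c : ℂ)

/-- `G` is a Smirnov domain: for any conformal map `ψ` of the unit disk onto `G`,
`log|ψ'|` is represented by the Poisson integral of its (radial) boundary values.
(By the Keldysh–Lavrentiev theorem this is equivalent to polynomials being dense
in the Smirnov classes `E_p(G)`.) -/
def IsSmirnovDomain (G : Set ℂ) : Prop :=
  ∀ ψ : ℂ → ℂ,
    (∀ w ∈ ball (0 : ℂ) 1, DifferentiableAt ℂ ψ w) →
    BijOn ψ (ball (0 : ℂ) 1) G →
    ∃ h : ℝ → ℝ,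
      IntervalIntegrable h volume 0 (2 * Real.pi) ∧
      (∀ᵐ (θ : ℝ) ∂(volume.restrict (Ioc (0 : ℝ) (2 * Real.pi))),
        Tendsto (fun r : ℝ => Real.log ‖deriv ψ ((r : ℂ) * Complex.exp ((θ : ℂ) * Complex.I))‖)
          (nhdsWithin 1 (Iio 1)) (nhds (h θ))) ∧
      (∀ w ∈ ball (0 : ℂ) 1,
        Real.log ‖deriv ψ w‖ =
          (1 / (2 * Real.pi)) * ∫ θ in (0 : ℝ)..(2 * Real.pi),
            ((1 - ‖w‖ ^ 2) / ‖Complex.exp ((θ : ℂ) * Complex.I) - w‖ ^ 2) * h θ)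

/-- The (interior) opening angle of `G` at the boundary point `z₀` equals `a`:
the angular measure of the set of directions in which `G` is seen from `z₀`
at distance `r` tends to `a` as `r → 0⁺`. -/
def HasCornerAngle (G : Set ℂ) (z₀ : ℂ) (a : ℝ) : Prop :=
  Tendsto (fun r : ℝ =>
      (volume {θ : ℝ | θ ∈ Ico 0 (2 * Real.pi) ∧
        z₀ + (r : ℂ) * Complex.exp ((θ : ℂ) * Complex.I) ∈ G}).toReal)
    (nhdsWithin 0 (Ioi 0)) (nhds a)

/-- The boundary of the Jordan domain `D` is piecewise analytic: it is a union of
finitely many analytic arcs `τ i '' [0,1]` (each `τ i` is conformal, i.e. injective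
and holomorphic, on an open neighborhood `U i` of the segment `[0,1]`), consecutive
arcs are joined at the junction points `τ i 1 = τ (i+1) 0`, and at the junction
point `τ i 1` the exterior angle of `G` is `extAngle i · π` (so the interior
opening angle there is `(2 - extAngle i) · π`). -/
structure PiecewiseAnalyticBoundary (D : JordanDomain) where
  /-- number of analytic arcs -/
  m : ℕ
  m_pos : 0 < m
  /-- conformal parametrizations of the arcs -/
  τ : Fin m → ℂ → ℂ
  /-- neighborhoods of the segment `[0,1]` on which the `τ i` are conformal -/
  U : Fin m → Set ℂ
  U_open : ∀ i, IsOpen (U i)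
  seg_sub : ∀ i, (Complex.ofReal '' Icc (0 : ℝ) 1) ⊆ U i
  analytic : ∀ i, DifferentiableOn ℂ (τ i) (U i)
  inj : ∀ i, InjOn (τ i) (U i)
  cover : (⋃ i, τ i '' (Complex.ofReal '' Icc (0 : ℝ) 1)) = frontier D.G
  junction : ∀ i : Fin m,
    τ i 1 = τ (Fin.mk ((i.val + 1) % m) (Nat.mod_lt _ m_pos)) 0
  /-- `extAngle i · π` is the exterior angle at the junction point `τ i 1` -/
  extAngle : Fin m → ℝ
  extAngle_mem : ∀ i, extAngle i ∈ Ioo (0 : ℝ) 2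
  extAngle_spec : ∀ i, HasCornerAngle D.G (τ i 1) ((2 - extAngle i) * Real.pi)

end

noncomputable section
local notation "conj" => starRingEnd ℂ
local notation "UI" => Icc (0:ℝ) 1
local notation "UO" => Ioo (0:ℝ) 1
local notation "N0" => nhdsWithin (0:ℝ) (Ioi 0)
local notation "rO" => (0:ℝ)
local notation "rI" => (1:ℝ)
local notation "π" => Real.pi
local notation "rsq" => Real.sqrt
local notation "rexp" => Real.exp
local notation "rsin" => Real.sin
local notation "rcos" => Real.cos
local notation "PC" => Polynomial ℂ
open Finset (sum_congr mul_sum sum_sub_distrib sum_nonneg mem_univ sum_le_sum single_le_sum sum_mul sum_le_card_nsmul univ_nonempty sum_eq_single sum_add_distrib)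
def PA (K : Set ℂ) (f : ℂ → ℂ) : Prop :=
  ∀ ε > 0, ∃ P : PC, ∀ z ∈ K, ‖f z - P.eval z‖ ≤ ε
namespace PA
variable {K : Set ℂ} {f g : ℂ → ℂ}
theorem poly (P : PC) : PA K (fun z => P.eval z) := fun ε hε => ⟨P, fun z _ => by simp [hε.le]⟩
theorem const (c : ℂ) : PA K (fun _ => c) := fun ε hε => ⟨Polynomial.C c, fun z _ => by simp [hε.le]⟩
theorem ident : PA K (fun z => z) := fun ε hε => ⟨Polynomial.X, fun z _ => by simp [hε.le]⟩
theorem congr (hf : PA K f) (h : EqOn f g K) : PA K g := fun ε hε => by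
  obtain ⟨P, hP⟩ := hf ε hε
  exact ⟨P, fun z hz => by rw [← h hz]; exact hP z hz⟩
theorem lim (h : ∀ ε > 0, ∃ g, PA K g ∧ ∀ z ∈ K, ‖f z - g z‖ ≤ ε) : PA K f := fun ε hε => by
  obtain ⟨g, hg, h1⟩ := h (ε / 2) (by positivity)
  obtain ⟨P, hP⟩ := hg (ε / 2) (by positivity)
  refine ⟨P, fun z hz => ?_⟩
  have := norm_sub_le_norm_sub_add_norm_sub (f z) (g z) (P.eval z)
  linarith [h1 z hz, hP z hz]
theorem add (hf : PA K f) (hg : PA K g) : PA K (fun z => f z + g z) := fun ε hε => by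
  obtain ⟨P, hP⟩ := hf (ε / 2) (by positivity)
  obtain ⟨Q, hQ⟩ := hg (ε / 2) (by positivity)
  refine ⟨P + Q, fun z hz => ?_⟩
  have : f z + g z - (P + Q).eval z = (f z - P.eval z) + (g z - Q.eval z) := by
    simp; ring
  rw [this]
  linarith [norm_add_le (f z - P.eval z) (g z - Q.eval z), hP z hz, hQ z hz]
theorem poly_bdd (hK : IsCompact K) (P : PC) : ∃ C > 0, ∀ z ∈ K, ‖P.eval z‖ ≤ C := by
  obtain ⟨C, hC⟩ := hK.exists_bound_of_continuousOn (P.continuous.continuousOn)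
  exact ⟨max C 1, by positivity, fun z hz => (hC z hz).trans (le_max_left _ _)⟩
theorem bdd (hK : IsCompact K) (hf : PA K f) : ∃ C > 0, ∀ z ∈ K, ‖f z‖ ≤ C := by
  obtain ⟨P, hP⟩ := hf 1 one_pos
  obtain ⟨C, hC, h⟩ := poly_bdd hK P
  refine ⟨C + 1, by positivity, fun z hz => ?_⟩
  have := norm_sub_norm_le (f z) (P.eval z)
  grind
theorem mul (hK : IsCompact K) (hf : PA K f) (hg : PA K g) : PA K (fun z => f z * g z) := fun ε hε => by
  obtain ⟨C, hC, hfC⟩ := hf.bdd hK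
  obtain ⟨Q, hQ⟩ := hg (ε / 2 / C) (by positivity)
  obtain ⟨D, hD, hQD⟩ := poly_bdd hK Q
  obtain ⟨P, hP⟩ := hf (ε / 2 / D) (by positivity)
  refine ⟨P * Q, fun z hz => ?_⟩
  have : f z * g z - (P * Q).eval z = f z * (g z - Q.eval z) + (f z - P.eval z) * Q.eval z := by
    simp; ring
  rw [this]
  refine (norm_add_le _ _).trans ?_
  rw [norm_mul, norm_mul]
  have h1 : ‖f z‖ * ‖g z - Q.eval z‖ ≤ C * (ε / 2 / C) :=
    mul_le_mul (hfC z hz) (hQ z hz) (norm_nonneg _) hC.le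
  have h2 : ‖f z - P.eval z‖ * ‖Q.eval z‖ ≤ (ε / 2 / D) * D :=
    mul_le_mul (hP z hz) (hQD z hz) (norm_nonneg _) (by positivity)
  have e1 : C * (ε / 2 / C) = ε / 2 := by field_simp
  have e2 : (ε / 2 / D) * D = ε / 2 := by field_simp
  linarith
theorem cmul (hf : PA K f) (c : ℂ) : PA K (fun z => c * f z) := fun ε hε => by
  obtain ⟨P, hP⟩ := hf (ε / (‖c‖ + 1)) (by positivity)
  refine ⟨Polynomial.C c * P, fun z hz => ?_⟩
  have : c * f z - (Polynomial.C c * P).eval z = c * (f z - P.eval z) := by simp; ring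
  rw [this, norm_mul]
  calc ‖c‖ * ‖f z - P.eval z‖ ≤ (‖c‖ + 1) * (ε / (‖c‖ + 1)) :=
        mul_le_mul (by linarith) (hP z hz) (norm_nonneg _) (by positivity)
    _ = ε := by field_simp
theorem pow (hK : IsCompact K) (hf : PA K f) (n : ℕ) : PA K (fun z => f z ^ n) := by
  induction n with
  | zero => simpa using const 1
  | succ n ih => simpa only [pow_succ] using ih.mul hK hf
theorem sum {ι : Type*} (s : Finset ι) {F : ι → ℂ → ℂ} (h : ∀ i ∈ s, PA K (F i)) :
    PA K (fun z => ∑ i ∈ s, F i z) := by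
  classical
  induction s using Finset.induction_on with
  | empty => simpa using const 0
  | insert a s ha ih =>
    simp only [Finset.sum_insert ha]
    exact (h a (by simp)).add (ih fun i hi => h i (by simp [hi]))
theorem cont (hf : PA K f) : ContinuousOn f K := by
  refine continuousOn_of_uniform_approx_of_continuousOn fun u hu => ?_
  obtain ⟨ε, hε, h⟩ := mem_uniformity_dist.1 hu
  obtain ⟨P, hP⟩ := hf (ε / 2) (by positivity)
  exact ⟨fun z => P.eval z, P.continuous.continuousOn, fun z hz => h (by
    rw [dist_eq_norm]; linarith [hP z hz])⟩
theorem neumann (hK : IsCompact K) (hg : PA K g) (h : ∀ z ∈ K, ‖g z‖ ≤ 1 / 2) :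
    PA K (fun z => (1 - g z)⁻¹) := by
  refine lim fun ε hε => ?_
  obtain ⟨n, hn⟩ := exists_pow_lt_of_lt_one (y := (1 / 2 : ℝ)) (half_pos hε) (by norm_num)
  refine ⟨_, PA.sum (Finset.range n) fun i _ => hg.pow hK i, fun z hz => ?_⟩
  have hz' := h z hz
  have h1 : 1 / 2 ≤ ‖1 - g z‖ := by
    have := norm_sub_norm_le 1 (g z); simp at this; linarith
  have h0 : 1 - g z ≠ 0 := by intro h0; rw [h0] at h1; norm_num at h1
  have : (1 - g z)⁻¹ - ∑ i ∈ Finset.range n, g z ^ i = (1 - g z)⁻¹ * g z ^ n := by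
    have := mul_neg_geom_sum (g z) n
    grind
  rw [this, norm_mul, norm_inv, norm_pow]
  have h3 : ‖1 - g z‖⁻¹ ≤ 2 := by
    rw [inv_le_comm₀ (by linarith) (by norm_num)]; linarith
  calc ‖1 - g z‖⁻¹ * ‖g z‖ ^ n ≤ 2 * (1 / 2) ^ n := by gcongr
    _ ≤ ε := by linarith
theorem inv (hK : IsCompact K) (hf : PA K f) {c : ℝ} (hc : 0 < c)
    (h : ∀ t : ℝ, 0 ≤ t → ∀ z ∈ K, c ≤ ‖f z + t‖) : PA K (fun z => (f z)⁻¹) := by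
  obtain ⟨C, hC, hfC⟩ := hf.bdd hK
  have step0 : ∀ t : ℝ, 2 * C ≤ t → PA K (fun z => (f z + t)⁻¹) := by
    intro t ht
    have htp : 0 < t := by linarith
    have ht0 : (t : ℂ) ≠ 0 := by exact_mod_cast htp.ne'
    have := (neumann hK (hf.cmul (-(1 / t))) fun z hz => by
      rw [norm_mul, norm_neg, norm_div, norm_one, norm_real, Real.norm_of_nonneg htp.le,
        one_div, inv_mul_le_iff₀ htp]
      linarith [hfC z hz]).cmul (1 / t)
    grind
  have step1 : ∀ t : ℝ, 0 ≤ t → PA K (fun z => (f z + (t + c / 2 : ℝ))⁻¹) →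
      PA K (fun z => (f z + t)⁻¹) := by
    intro t ht hp
    have hb : ∀ z ∈ K, ‖((c / 2 : ℝ) : ℂ) * (f z + (t + c / 2 : ℝ))⁻¹‖ ≤ 1 / 2 := by
      intro z hz
      have := h (t + c / 2) (by positivity) z hz
      rw [norm_mul, norm_inv, norm_real, Real.norm_of_nonneg (by positivity),
        ← div_eq_mul_inv, div_le_iff₀ (by linarith)]
      linarith
    refine (hp.mul hK (neumann hK (hp.cmul (c / 2 : ℝ)) hb)).congr fun z hz => ?_
    have h1 : f z + (t + c / 2 : ℝ) ≠ 0 := norm_pos_iff.1 (hc.trans_le (h _ (by positivity) z hz))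
    have h3 : 1 - ((c / 2 : ℝ) : ℂ) * (f z + (t + c / 2 : ℝ))⁻¹ = (f z + t) / (f z + (t + c / 2 : ℝ)) := by
      rw [eq_div_iff h1, sub_mul, mul_assoc, inv_mul_cancel₀ h1]; push_cast; ring
    grind
  have step2 : ∀ n : ℕ, ∀ t : ℝ, 0 ≤ t → 2 * C ≤ t + n * (c / 2) → PA K (fun z => (f z + t)⁻¹) := by
    intro n
    induction n with
    | zero => intro t _ ht; exact step0 t (by simpa using ht)
    | succ n ih =>
      grind
  obtain ⟨n, hn⟩ := exists_nat_gt (2 * C / (c / 2))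
  rw [div_lt_iff₀ (by positivity)] at hn
  simpa using step2 n 0 le_rfl (by linarith)
theorem exp (hK : IsCompact K) (hf : PA K f) : PA K (fun z => Complex.exp (f z)) := by
  obtain ⟨C, hC, hfC⟩ := hf.bdd hK
  refine lim fun ε hε => ?_
  obtain ⟨n, hn⟩ := (tendstoUniformlyOn_iff.1 ((NormedSpace.hasFPowerSeriesOnBall_exp_of_radius_pos (𝕂 := ℂ) (𝔸 := ℂ) (by rw [NormedSpace.expSeries_radius_eq_top]; simp)).tendstoUniformlyOn (r' := (C + 1).toNNReal) (by rw [NormedSpace.expSeries_radius_eq_top]; exact ENNReal.coe_lt_top)) ε hε).exists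
  refine ⟨_, PA.sum (Finset.range n) fun i _ => (hf.pow hK i).cmul (i.factorial⁻¹), fun z hz => ?_⟩
  have := hn (f z) (by
    rw [mem_ball_zero_iff, Real.coe_toNNReal _ (by positivity)]; exact (hfC z hz).trans_lt (lt_add_one C))
  rw [dist_eq_norm] at this
  simp only [zero_add, FormalMultilinearSeries.partialSum, NormedSpace.expSeries_apply_eq, smul_eq_mul,
    ← exp_eq_exp_ℂ] at this
  grind
theorem integral {g : ℝ → ℂ → ℂ} (hg : ∀ t ∈ UI, PA K (g t)) {C : ℝ} (hC : 0 ≤ C)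
    (hL : ∀ z ∈ K, ∀ t ∈ UI, ∀ s ∈ UI, ‖g t z - g s z‖ ≤ C * |t - s|) :
    PA K (fun z => ∫ t in rO..1, g t z) := by
  refine lim fun ε hε => ?_
  obtain ⟨n, hn⟩ := exists_nat_gt (C / ε)
  have hn0 := lt_of_le_of_lt (by positivity) hn
  refine ⟨_, PA.sum (Finset.range n) fun i hi => (hg (i / n) ?_).cmul ((1 / n : ℝ)), fun z hz => ?_⟩
  · have : (i:ℝ) ≤ n := by exact_mod_cast (Finset.mem_range.1 hi).le
    exact ⟨by positivity, (div_le_one hn0).2 this⟩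
  have hcont : ContinuousOn (fun t => g t z) (Icc 0 1) := by
    refine (LipschitzOnWith.of_dist_le_mul (K := ⟨C, hC⟩) fun t ht s hs => ?_).continuousOn
    rw [dist_eq_norm, Real.dist_eq]; exact hL z hz t ht s hs
  have hii : ∀ i < n, ((i:ℝ)/n ∈ UI ∧ (((i+1:ℕ):ℝ)/n) ∈ UI) := by
    intro i hi
    have h1 : (i:ℝ) ≤ n := by exact_mod_cast hi.le
    have h2 : ((i+1:ℕ):ℝ) ≤ n := by exact_mod_cast hi
    exact ⟨⟨by positivity, (div_le_one hn0).2 h1⟩, ⟨by positivity, (div_le_one hn0).2 h2⟩⟩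
  have hI : ∀ i < n, IntervalIntegrable (fun t => g t z) volume (i/n) (((i+1:ℕ):ℝ)/n) := by
    intro i hi
    refine (hcont.mono ?_).intervalIntegrable
    exact (convex_Icc rO 1).ordConnected.uIcc_subset (hii i hi).1 (hii i hi).2
  have hsum := intervalIntegral.sum_integral_adjacent_intervals (μ := volume)
    (n := n) hI
  simp only [Nat.cast_zero, zero_div, div_self hn0.ne'] at hsum
  rw [← hsum, ← sum_sub_distrib]
  have hterm : ∀ i ∈ Finset.range n,
      ‖(∫ t in (i/n)..(((i+1:ℕ):ℝ)/n), g t z) - ((1 / n : ℝ):ℂ) * g (i/n) z‖ ≤ ε * (1 / n) := by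
    intro i hi
    have hi' := Finset.mem_range.1 hi
    have hlen : ((i+1:ℕ):ℝ)/n - i/n = 1 / n := by push_cast; ring
    have hle : (i:ℝ)/n ≤ ((i+1:ℕ):ℝ)/n := by have : 0 < 1 / (n:ℝ) := by positivity
                                             linarith
    have e : ((1 / n : ℝ):ℂ) * g (i/n) z = ∫ t in (i/n)..(((i+1:ℕ):ℝ)/n), g (i/n) z := by
      rw [intervalIntegral.integral_const, hlen, real_smul]
    rw [e, ← intervalIntegral.integral_sub (hI i hi') intervalIntegrable_const]
    refine (intervalIntegral.norm_integral_le_of_norm_le_const (C := ε) fun t ht => ?_).trans ?_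
    · rw [uIoc_of_le hle] at ht
      have ht' : t ∈ UI := ⟨(hii i hi').1.1.trans ht.1.le, ht.2.trans (hii i hi').2.2⟩
      refine (hL z hz t ht' _ (hii i hi').1).trans ?_
      have : |t - i/n| ≤ 1 / n := by grind
      calc C * |t - i/n| ≤ C * (1 / n) := by gcongr
        _ ≤ ε := by rw [mul_one_div, div_le_iff₀ hn0]; rw [div_lt_iff₀ hε] at hn; linarith
    · grind
  refine (norm_sum_le_of_le _ hterm).trans ?_
  simp
  field_simp; rfl
end PA
theorem deriv_ne_zero_of_inj {f : ℂ → ℂ} {U : Set ℂ} (hU : IsOpen U) (hf : DifferentiableOn ℂ f U)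
    (hi : InjOn f U) {x₀ : ℂ} (hx : x₀ ∈ U) : deriv f x₀ ≠ 0 := by
  intro hd
  have hUn : U ∈ nhds x₀ := hU.mem_nhds hx
  have han : AnalyticAt ℂ f x₀ := hf.analyticAt hUn
  have han' : AnalyticAt ℂ (fun z => f z - f x₀) x₀ := han.sub analyticAt_const
  have hne : ¬ ∀ᶠ z in nhds x₀, f z - f x₀ = 0 := by
    intro h
    have h2 : ∀ᶠ z in nhds x₀, z = x₀ := by
      filter_upwards [h, hUn] with z hz hzU
      exact hi hzU hx (sub_eq_zero.1 hz)
    obtain ⟨z, hz1, hz2⟩ := ((h2.filter_mono nhdsWithin_le_nhds).and (self_mem_nhdsWithin (s := {x₀}ᶜ))).exists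
    grind
  obtain ⟨n, g, hg, hg0, heq⟩ := (AnalyticAt.exists_eventuallyEq_pow_smul_nonzero_iff han').2 hne
  simp only [smul_eq_mul] at heq
  have hn0 : n ≠ 0 := by
    rintro rfl
    have := heq.self_of_nhds
    grind
  have hn1 : n ≠ 1 := by
    rintro rfl
    have h1 : HasDerivAt (fun z => f z - f x₀) 0 x₀ := by
      have := (han.differentiableAt.hasDerivAt).sub_const (f x₀); rwa [hd] at this
    have h2 : HasDerivAt (fun z => (z - x₀) ^ 1 * g z) (g x₀) x₀ := by
      have := (((hasDerivAt_id x₀).sub_const x₀).mul hg.differentiableAt.hasDerivAt)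
      simp only [id, one_mul, sub_self, zero_mul, add_zero] at this
      simp only [pow_one]; exact this
    exact hg0 ((h2.congr_of_eventuallyEq heq).unique h1)
  set φ : ℂ → ℂ := fun z => (z - x₀) * (g z / g x₀) ^ ((1 : ℂ) / n) with hφ
  have hφa : AnalyticAt ℂ φ x₀ := by
    refine (analyticAt_id.sub analyticAt_const).mul ((hg.div analyticAt_const hg0).cpow analyticAt_const ?_)
    change g x₀ / g x₀ ∈ _; rw [div_self hg0]; exact one_mem_slitPlane
  have hφd : HasStrictDerivAt φ 1 x₀ := by
    have h1 : deriv φ x₀ = 1 := by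
      have hc : DifferentiableAt ℂ (fun z => (g z / g x₀) ^ ((1 : ℂ) / n)) x₀ :=
        ((hg.div analyticAt_const hg0).cpow analyticAt_const
          (by change g x₀ / g x₀ ∈ _; rw [div_self hg0]; exact one_mem_slitPlane)).differentiableAt
      have := (((hasDerivAt_id x₀).sub_const x₀).mul hc.hasDerivAt).deriv
      simp only [id, sub_self, zero_mul, add_zero, one_mul, div_self hg0, one_cpow] at this
      exact this
    rw [← h1]; exact hφa.hasStrictDerivAt
  have hmap := hφd.map_nhds_eq one_ne_zero
  have hφ0 : φ x₀ = 0 := by simp [hφ]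
  rw [hφ0] at hmap
  obtain ⟨r, hr, hball⟩ := Metric.mem_nhds_iff.1 (hmap ▸ image_mem_map (hUn |> fun h => inter_mem h heq))
  have hω := isPrimitiveRoot_exp n hn0
  set ω := exp (2 * π * I / n)
  obtain ⟨z1, ⟨hz1U, hz1⟩, e1⟩ := hball (show ((r / 2 : ℝ) : ℂ) ∈ ball 0 r by
    simp only [mem_ball_zero_iff, norm_real, Real.norm_of_nonneg (by positivity : 0 ≤ r / 2)]; linarith)
  obtain ⟨z2, ⟨hz2U, hz2⟩, e2⟩ := hball (show ((r / 2 : ℝ) : ℂ) * ω ∈ ball 0 r by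
    simp only [mem_ball_zero_iff, norm_mul, hω.norm'_eq_one hn0, Complex.norm_real, Real.norm_of_nonneg (by positivity : 0 ≤ r / 2)]; linarith)
  have hpow : ∀ z, (φ z) ^ n * g x₀ = (z - x₀) ^ n * g z := by
    intro z
    simp only [hφ, mul_pow, one_div]
    rw [cpow_nat_inv_pow _ hn0]; field_simp
  have : f z1 = f z2 := by
    have h1 := hpow z1
    have h2 := hpow z2
    rw [e2, mul_pow, hω.pow_eq_one, mul_one] at h2
    grind
  have hzz := hi hz1U hz2U this
  have hr2 : ((r / 2 : ℝ) : ℂ) ≠ 0 := by exact_mod_cast (by grind)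
  exact hω.ne_one (by omega) (mul_left_cancel₀ hr2 (by grind))
theorem bilip {f : ℂ → ℂ} {U S : Set ℂ} (hU : IsOpen U) (hf : DifferentiableOn ℂ f U)
    (hi : InjOn f U) (hS : IsCompact S) (hSU : S ⊆ U) :
    ∃ c > 0, ∀ x ∈ S, ∀ y ∈ S, c * ‖x - y‖ ≤ ‖f x - f y‖ := by
  have hp := (hS.prod hS).induction_on (p := fun s => ∃ c > rO, ∀ q ∈ s, c * ‖q.1 - q.2‖ ≤ ‖f q.1 - f q.2‖)
    ⟨1, one_pos, by simp⟩ (fun s t hst ⟨c, hc, h⟩ => ⟨c, hc, fun q hq => h q (hst hq)⟩)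
    (fun s t ⟨c, hc, h⟩ ⟨d, hd, h'⟩ => ⟨min c d, lt_min hc hd, fun q hq => by
      rcases hq with hq | hq
      · exact (mul_le_mul_of_nonneg_right (min_le_left _ _) (norm_nonneg _)).trans (h q hq)
      · exact (mul_le_mul_of_nonneg_right (min_le_right _ _) (norm_nonneg _)).trans (h' q hq)⟩) ?_
  · obtain ⟨c, hc, h⟩ := hp
    exact ⟨c, hc, fun x hx y hy => h (x, y) ⟨hx, hy⟩⟩
  rintro ⟨x, y⟩ ⟨hx, hy⟩
  by_cases hxy : x = y
  · subst hxy
    have hd := deriv_ne_zero_of_inj hU hf hi (hSU hx)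
    refine ⟨_, mem_nhdsWithin_of_mem_nhds (((hf.analyticAt (hU.mem_nhds (hSU hx))).hasStrictDerivAt).hasStrictFDerivAt.isLittleO.def (c := ‖deriv f x‖ / 2) (by positivity)), ‖deriv f x‖ / 2, by positivity, fun q hq => ?_⟩
    have h3 := norm_sub_norm_le (deriv f x * (q.1 - q.2)) (f q.1 - f q.2)
    rw [norm_mul] at h3
    have h2 : ‖f q.1 - f q.2 - deriv f x * (q.1 - q.2)‖ ≤ ‖deriv f x‖ / 2 * ‖q.1 - q.2‖ := by
      simpa [mul_comm] using hq
    rw [norm_sub_rev] at h2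
    linarith
  · have hne : 0 < ‖f x - f y‖ := by
      rw [norm_pos_iff, sub_ne_zero]; exact fun h => hxy (hi (hSU hx) (hSU hy) h)
    have hcx := (hf.differentiableAt (hU.mem_nhds (hSU hx))).continuousAt
    have hc : ContinuousAt (fun q : ℂ × ℂ => ‖f q.1 - f q.2‖ - ‖f x - f y‖ / (2 * (‖x - y‖ + 1)) * ‖q.1 - q.2‖) (x, y) := by
      refine ContinuousAt.sub (ContinuousAt.norm (ContinuousAt.sub ?_ ?_)) (by fun_prop)
      · exact ContinuousAt.comp hcx continuousAt_fst
      · exact ContinuousAt.comp ((hf.differentiableAt (hU.mem_nhds (hSU hy))).continuousAt) continuousAt_snd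
    have hpos : 0 < ‖f x - f y‖ - ‖f x - f y‖ / (2 * (‖x - y‖ + 1)) * ‖x - y‖ := by
      have : ‖f x - f y‖ / (2 * (‖x - y‖ + 1)) * ‖x - y‖ ≤ ‖f x - f y‖ / 2 := by
        rw [div_mul_eq_mul_div, div_le_div_iff₀ (by positivity) (by norm_num)]
        grind
      linarith
    refine ⟨_, mem_nhdsWithin_of_mem_nhds (hc.eventually (lt_mem_nhds hpos)),
      ‖f x - f y‖ / (2 * (‖x - y‖ + 1)), by positivity, fun q hq => ?_⟩
    grind
theorem cs {α : Type*} [MeasurableSpace α] {μ : Measure α} {f g : α → ℂ} (hf : MemLp f 2 μ) (hg : MemLp g 2 μ) :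
    ∫ a, ‖f a‖ * ‖g a‖ ∂μ ≤ rsq (∫ a, ‖f a‖ ^ 2 ∂μ) * rsq (∫ a, ‖g a‖ ^ 2 ∂μ) := by
  simpa [Real.sqrt_eq_rpow] using integral_mul_norm_le_Lp_mul_Lq (f := f) (p := 2) (q := 2) (Real.holderConjugate_iff.2 ⟨by norm_num, by norm_num⟩) (by simpa using hf) (by simpa using hg)
theorem kernel_bound {f : ℝ → ℂ} (hf : ContinuousOn f (Icc 0 1)) {c : ℝ} (hc : 0 < c)
    (h : ∀ x ∈ UI, ∀ y ∈ UI, c * |x - y| ≤ ‖f x - f y‖) :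
    ∃ C > 0, ∀ (w : ℂ) (d : ℝ), 0 < d → (∀ u ∈ UI, d ≤ ‖f u - w‖) →
      ∫ u in UO, ‖(f u - w)⁻¹‖ ^ 2 ≤ C / d := by
  refine ⟨2 * π * (2 / c), by positivity, fun w d hd hw => ?_⟩
  obtain ⟨u0, hu0, hmin⟩ := isCompact_Icc.exists_isMinOn (nonempty_Icc.2 zero_le_one)
    ((hf.sub continuousOn_const).norm : ContinuousOn (fun u => ‖f u - w‖) (Icc 0 1))
  set k := c / 2 / d
  have hk : 0 < k := by positivity
  have hint : Integrable (fun u => (2 / d ^ 2) * (1 + (k * (u - u0)) ^ 2)⁻¹) := by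
    refine Integrable.const_mul ?_ _
    exact (integrable_inv_one_add_sq.comp_mul_left' hk.ne').comp_sub_right u0
  have hle : ∀ u ∈ UI, ‖(f u - w)⁻¹‖ ^ 2 ≤ (2 / d ^ 2) * (1 + (k * (u - u0)) ^ 2)⁻¹ := by
    intro u hu
    have h1 : ‖f u0 - w‖ ≤ ‖f u - w‖ := hmin hu
    have h2 := h u hu u0 hu0
    have h3 : ‖f u - f u0‖ ≤ ‖f u - w‖ + ‖f u0 - w‖ := by
      have := norm_sub_le (f u - w) (f u0 - w); simpa using this
    have h4 : c / 2 * |u - u0| ≤ ‖f u - w‖ := by linarith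
    have h5 := hw u hu
    have h6 : (c / 2 * |u - u0|) ^ 2 ≤ ‖f u - w‖ ^ 2 := by gcongr
    have h7 : d ^ 2 ≤ ‖f u - w‖ ^ 2 := by gcongr
    rw [norm_inv, inv_pow, ← div_eq_mul_inv, div_div, le_div_iff₀ (by positivity), inv_mul_le_iff₀ (lt_of_lt_of_le (by positivity) h7)]
    have : d ^ 2 * (1 + (k * (u - u0)) ^ 2) = d ^ 2 + (c / 2 * |u - u0|) ^ 2 := by grind
    grind
  calc ∫ u in UO, ‖(f u - w)⁻¹‖ ^ 2 ≤ ∫ u in UO, (2 / d ^ 2) * (1 + (k * (u - u0)) ^ 2)⁻¹ := by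
        refine integral_mono_of_nonneg (ae_of_all _ fun _ => by positivity) hint.integrableOn ?_
        filter_upwards [ae_restrict_mem measurableSet_Ioo] with u hu using hle u (Ioo_subset_Icc_self hu)
    _ ≤ ∫ u, (2 / d ^ 2) * (1 + (k * (u - u0)) ^ 2)⁻¹ :=
        setIntegral_le_integral hint (ae_of_all _ fun _ => by positivity)
    _ = 2 * π * (2 / c) / d := by
        rw [integral_const_mul, integral_sub_right_eq_self (fun u => (1 + (k * u) ^ 2)⁻¹) u0,
          Measure.integral_comp_mul_left (fun u => (1 + u ^ 2)⁻¹), integral_univ_inv_one_add_sq, smul_eq_mul,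
          abs_of_pos (by positivity)]
        grind
theorem cauchy_holo {α : Type*} [MeasurableSpace α] {μ : Measure α} {φ t : α → ℂ} {S : Set ℂ}
    (hφ : Integrable φ μ) (ht : AEStronglyMeasurable t μ) (hS : IsClosed S) (htS : ∀ᵐ a ∂μ, t a ∈ S)
    {w : ℂ} (hw : w ∉ S) :
    HasDerivAt (fun w => ∫ a, φ a / (t a - w) ∂μ) (∫ a, φ a / (t a - w) ^ 2 ∂μ) w := by
  obtain ⟨r, hr, hball⟩ := isOpen_iff.1 hS.isOpen_compl w hw
  have hd : ∀ s ∈ S, ∀ x ∈ ball w (r / 2), r / 2 ≤ ‖s - x‖ := by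
    intro s hs x hx
    by_contra hcon
    refine hball (?_ : s ∈ ball w r) hs
    rw [mem_ball, dist_eq_norm] at hx ⊢
    have := norm_sub_le_norm_sub_add_norm_sub s x w
    linarith
  have hm : ∀ x, AEStronglyMeasurable (fun a => (t a - x)) μ := fun x => ht.sub aestronglyMeasurable_const
  have hdivm : ∀ (x : ℂ) (n : ℕ), AEStronglyMeasurable (fun a => φ a / (t a - x) ^ n) μ := by
    intro x n
    exact hφ.1.mul ((((hm x).aemeasurable.pow_const n).inv).aestronglyMeasurable)
  have hne : ∀ s ∈ S, ∀ x ∈ ball w (r / 2), s - x ≠ 0 := fun s hs x hx => by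
    rw [← norm_pos_iff]; have := hd s hs x hx; linarith
  refine (hasDerivAt_integral_of_dominated_loc_of_deriv_le (s := ball w (r / 2))
    (bound := fun a => ‖φ a‖ * (r / 2)⁻¹ ^ 2) (F' := fun x a => φ a / (t a - x) ^ 2)
    (ball_mem_nhds w (by positivity)) (Eventually.of_forall fun x => by simpa using hdivm x 1) ?_ (hdivm w 2) ?_ ?_ ?_).2
  · refine Integrable.mono' (hφ.norm.mul_const ((r / 2)⁻¹)) (by simpa using hdivm w 1) ?_
    filter_upwards [htS] with a ha
    rw [norm_div, div_eq_mul_inv]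
    gcongr
    exact hd _ ha w (mem_ball_self (by positivity))
  · filter_upwards [htS] with a ha x hx
    rw [norm_div, div_eq_mul_inv, norm_pow, ← inv_pow]
    gcongr
    grind
  · exact hφ.norm.mul_const _
  · filter_upwards [htS] with a ha x hx
    have h := (((hasDerivAt_id' x).const_sub (t a)).fun_inv (hne _ ha x hx)).const_mul (φ a)
    grind
def pth (a v : ℝ) : ℂ := v + (a * (v * (1 - v)) : ℝ) * I
def pthd (a v : ℝ) : ℂ := 1 + (a * (1 - 2 * v) : ℝ) * I
def Th (a : ℝ) : Set ℂ := {x | 0 ≤ x.re ∧ x.re ≤ 1 ∧ |x.im| ≤ |a| * (x.re * (1 - x.re))}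
abbrev m01 : Measure ℝ := volume.restrict UO
@[simp] theorem pth_re (a v : ℝ) : (pth a v).re = v := by simp [pth]
@[simp] theorem pth_im (a v : ℝ) : (pth a v).im = a * (v * (1 - v)) := by simp [pth]
theorem pth_mem (a : ℝ) {v : ℝ} (hv : v ∈ UI) : pth a v ∈ Th a := by
  refine ⟨by simpa using hv.1, by simpa using hv.2, ?_⟩
  simp [abs_of_nonneg hv.1, abs_of_nonneg (sub_nonneg.2 hv.2)]
theorem Th_neg (a : ℝ) : Th (-a) = Th a := by simp [Th]
theorem real_mem_Th (a : ℝ) {v : ℝ} (hv : v ∈ UI) : (v : ℂ) ∈ Th a := by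
  refine ⟨by simpa using hv.1, by simpa using hv.2, ?_⟩
  have : 0 ≤ v * (1 - v) := mul_nonneg hv.1 (by grind)
  simp; positivity
theorem Th_conj {a : ℝ} {x : ℂ} (hx : x ∈ Th a) : (starRingEnd ℂ) x ∈ Th a := by
  simpa [Th] using hx
theorem pth_conj (a v : ℝ) : (starRingEnd ℂ) (pth a v) = pth (-a) v := by
  apply Complex.ext <;> simp
theorem Th_convex (a : ℝ) : Convex ℝ (Th a) := by
  intro x hx y hy s t hs ht hst
  obtain ⟨h1, h2, h3⟩ := hx
  obtain ⟨k1, k2, k3⟩ := hy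
  have hre : (s • x + t • y).re = s * x.re + t * y.re := by simp
  have him : (s • x + t • y).im = s * x.im + t * y.im := by simp
  refine ⟨by rw [hre]; positivity, by rw [hre]; nlinarith, ?_⟩
  rw [hre, him]
  have e : t = 1 - s := by linarith
  calc |s * x.im + t * y.im| ≤ s * |x.im| + t * |y.im| := by
        refine (abs_add_le _ _).trans ?_
        grind
    _ ≤ s * (|a| * (x.re * (1 - x.re))) + t * (|a| * (y.re * (1 - y.re))) := by gcongr
    _ = |a| * (s * (x.re * (1 - x.re)) + t * (y.re * (1 - y.re))) := by ring
    _ ≤ _ := by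
        refine mul_le_mul_of_nonneg_left ?_ (abs_nonneg a)
        have : 0 ≤ s * t * (x.re - y.re) ^ 2 := by positivity
        subst e; nlinarith
theorem Th_compact (a : ℝ) : IsCompact (Th a) := by
  refine isCompact_of_isClosed_isBounded ?_ ?_
  · refine (isClosed_le continuous_const continuous_re).inter ((isClosed_le continuous_re continuous_const).inter
      (isClosed_le (continuous_im.abs) (by fun_prop)))
  · refine (isBounded_closedBall (x := 0) (r := 1 + |a|)).subset fun x hx => ?_
    obtain ⟨h1, h2, h3⟩ := hx
    rw [mem_closedBall_zero_iff]
    refine (norm_le_abs_re_add_abs_im x).trans ?_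
    rw [abs_of_nonneg h1]
    have : x.re * (1 - x.re) ≤ 1 := by nlinarith
    have := mul_le_mul_of_nonneg_left this (abs_nonneg a)
    linarith
theorem pth_hasDerivAt (a v : ℝ) : HasDerivAt (pth a) (pthd a v) v := by
  have h1 : HasDerivAt (fun v => a * (v * (1 - v))) (a * (1 - 2 * v)) v := by
    have := ((hasDerivAt_id' v).fun_mul ((hasDerivAt_id' v).const_sub 1)).const_mul a
    grind
  exact (hasDerivAt_id v).ofReal_comp.add (h1.ofReal_comp.mul_const I)
theorem pth_continuous (a : ℝ) : Continuous (pth a) := by unfold pth; fun_prop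
theorem pthd_continuous (a : ℝ) : Continuous (pthd a) := by unfold pthd; fun_prop
@[simp] theorem pth_zero (a : ℝ) : pth a 0 = 0 := by simp [pth]
@[simp] theorem pth_one (a : ℝ) : pth a 1 = 1 := by simp [pth]
theorem ftc_path (a : ℝ) {f P : ℂ → ℂ} (hP : ∀ v ∈ UI, HasDerivAt P (f (pth a v)) (pth a v))
    (hf : ContinuousOn f (pth a '' Icc 0 1)) :
    ∫ v in UO, f (pth a v) * pthd a v = P 1 - P 0 := by
  rw [← integral_Ioc_eq_integral_Ioo, ← intervalIntegral.integral_of_le zero_le_one,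
    intervalIntegral.integral_eq_sub_of_hasDerivAt (f := fun v => P (pth a v))]
  · simp
  · intro v hv
    rw [uIcc_of_le zero_le_one] at hv
    exact (hP v hv).comp_of_eq v (pth_hasDerivAt a v) rfl
  · apply ContinuousOn.intervalIntegrable
    rw [uIcc_of_le zero_le_one]
    exact (hf.comp (pth_continuous a).continuousOn (mapsTo_image _ _)).mul (pthd_continuous a).continuousOn
theorem cauchy_Th {a : ℝ} {W : Set ℂ} (hW : IsOpen W) (hTW : Th a ⊆ W) {f : ℂ → ℂ}
    (hf : DifferentiableOn ℂ f W) :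
    ∫ v in UO, f (pth a v) * pthd a v = ∫ v in UO, f (pth (-a) v) * pthd (-a) v := by
  obtain ⟨δ, hδ, hsub⟩ := (Th_compact a).exists_thickening_subset_open hW hTW
  obtain ⟨P, hP⟩ := ((Th_convex a).thickening δ).exists_forall_hasDerivWithinAt (hf.mono hsub)
  have hmem : Th a ⊆ thickening δ (Th a) := self_subset_thickening hδ _
  have hP' := fun x hx =>
    (hP x (hmem hx)).hasDerivAt (isOpen_thickening.mem_nhds (hmem hx))
  have hc := hf.continuousOn.mono hTW
  have hm : ∀ v ∈ UI, pth (-a) v ∈ Th a := fun v hv => Th_neg a ▸ pth_mem (-a) hv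
  rw [ftc_path a (fun v hv => hP' _ (pth_mem a hv)) (hc.mono (by rintro _ ⟨v, hv, rfl⟩; exact pth_mem a hv)),
    ftc_path (-a) (fun v hv => hP' _ (hm v hv)) (hc.mono (by grind))]
theorem log_path {a : ℝ} (ha : 0 < a) (s : ℝ) (hs : s = 1 ∨ s = -1) {u : ℝ} (hu : u ∈ UO) :
    ∫ v in UO, (pth (s * a) v - u)⁻¹ * pthd (s * a) v
      = Real.log (1 - u) - Real.log u - s * π * I := by
  have hsI : -s * I ≠ 0 := by rcases hs with rfl | rfl <;> simp
  have hsl : ∀ v ∈ UI, -s * I * (pth (s * a) v - u) ∈ slitPlane := by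
    intro v hv
    rw [mem_slitPlane_iff]
    by_cases hvu : v = u
    · subst hvu
      have : 0 < a * (v * (1 - v)) := mul_pos ha (mul_pos hu.1 (by grind))
      rcases hs with rfl | rfl <;> simp <;> linarith
    · rcases hs with rfl | rfl <;> simp [sub_eq_zero, hvu]
      grind
  have hne : ∀ v ∈ UI, pth (s * a) v - u ≠ 0 := fun v hv h => by
    have := hsl v hv
    rw [h] at this; simp at this
  have := ftc_path (s * a) (f := fun x => (x - u)⁻¹) (P := fun x => log (-s * I * (x - u))) ?_ ?_
  · have e : ∀ (r : ℝ), 0 < r → log (-I * r) = Real.log r - π / 2 * I ∧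
        log (I * r) = Real.log r + π / 2 * I := by
      intro r hr
      constructor
      · rw [mul_comm, log_ofReal_mul hr (by simp), log_neg_I]; ring
      · rw [mul_comm, log_ofReal_mul hr (by simp), log_I]
    have h1 := e (1 - u) (by grind)
    have h2 := e u hu.1
    push_cast at h1 h2 ⊢
    rcases hs with rfl | rfl
    · have a1 : -rI * I * (1 - u) = -I * (1 - u) := by push_cast; ring
      have a2 : -rI * I * (0 - u) = I * u := by push_cast; ring
      grind
    · have a1 : -((-1:ℝ):ℂ) * I * (1 - u) = I * (1 - u) := by push_cast; ring
      have a2 : -((-1:ℝ):ℂ) * I * (0 - u) = -I * u := by push_cast; ring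
      grind
  · intro v hv
    have h1 : HasDerivAt (fun x => -s * I * (x - u)) (-s * I) (pth (s * a) v) := by
      simpa using ((hasDerivAt_id (pth (s * a) v)).sub_const (u:ℂ)).const_mul (-s * I)
    exact (h1.clog (hsl v hv)).congr_deriv (by grind)
  · refine ContinuousOn.inv₀ (by fun_prop) ?_
    grind
theorem residue_Th {a : ℝ} (ha : a ≠ 0) {W : Set ℂ} (hW : IsOpen W) (hTW : Th a ⊆ W) {f ψ : ℂ → ℂ}
    (hf : DifferentiableOn ℂ f W) (hi : InjOn f W) (hψ : DifferentiableOn ℂ ψ W) {u : ℝ} (hu : u ∈ UO) :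
    (∫ v in UO, ψ (pth a v) / (f u - f (pth a v)) * pthd a v) -
      (∫ v in UO, ψ (pth (-a) v) / (f u - f (pth (-a) v)) * pthd (-a) v) =
      SignType.sign a * (2 * π * I) * (ψ u / deriv f u) := by
  have huW := hTW (real_mem_Th a (Ioo_subset_Icc_self hu))
  have hWn := hW.mem_nhds huW
  have hds : DifferentiableOn ℂ (dslope f u) W := (Complex.differentiableOn_dslope hWn).2 hf
  have hds0 : ∀ x ∈ W, dslope f u x ≠ 0 := by
    intro x hx
    by_cases hxu : x = u
    · rw [hxu, dslope_same]; exact deriv_ne_zero_of_inj hW hf hi huW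
    · rw [dslope_of_ne _ hxu, slope_def_field]
      exact div_ne_zero (sub_ne_zero.2 fun h => hxu (hi hx huW h)) (sub_ne_zero.2 hxu)
  set φ : ℂ → ℂ := fun x => ψ x / dslope f u x with hφ
  have hφd : DifferentiableOn ℂ φ W := hψ.div hds hds0
  have hdφ := (Complex.differentiableOn_dslope hWn).2 hφd
  have hpt : ∀ b : ℝ, b ≠ 0 → (∀ v ∈ UI, pth b v ∈ W) → ∫ v in UO, ψ (pth b v) / (f u - f (pth b v)) * pthd b v =
      -(φ u * ∫ v in UO, (pth b v - u)⁻¹ * pthd b v) - ∫ v in UO, dslope φ u (pth b v) * pthd b v := by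
    intro b hb hbW
    have hne : ∀ v ∈ UI, pth b v - u ≠ 0 := by
      intro v hv h
      have hre := congrArg re h
      have him := congrArg im h
      simp at hre him
      grind
    rw [← integral_const_mul, ← integral_neg, ← integral_sub]
    · refine setIntegral_congr_fun measurableSet_Ioo fun v hv => ?_
      have hv' := Ioo_subset_Icc_self hv
      have h0 := hne v hv'
      have hx := sub_ne_zero.1 h0
      have e1 : φ (pth b v) = ψ (pth b v) * (pth b v - u) / (f (pth b v) - f u) := by
        simp only [hφ, dslope_of_ne _ hx, slope_def_field]; field_simp
      have e2 : φ (pth b v) = φ u + (pth b v - u) * dslope φ u (pth b v) := by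
        rw [dslope_of_ne _ hx, slope_def_field]; field_simp; ring
      grind
    · have hcc : ContinuousOn (fun v => (pth b v - u)⁻¹ * pthd b v) (Icc 0 1) :=
        (ContinuousOn.inv₀ ((pth_continuous b).continuousOn.sub continuousOn_const) hne).mul (pthd_continuous b).continuousOn
      exact ((hcc.integrableOn_Icc.mono_set Ioo_subset_Icc_self).const_mul _).neg
    · have hcc : ContinuousOn (fun v => dslope φ u (pth b v) * pthd b v) (Icc 0 1) :=
        (hdφ.continuousOn.comp (pth_continuous b).continuousOn hbW).mul (pthd_continuous b).continuousOn
      exact hcc.integrableOn_Icc.mono_set Ioo_subset_Icc_self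
  have hW' : ∀ v ∈ UI, pth (-a) v ∈ W := fun v hv => hTW (Th_neg a ▸ pth_mem (-a) hv)
  rw [hpt a ha fun v hv => hTW (pth_mem a hv), hpt (-a) (by simpa using ha) hW', cauchy_Th hW hTW hdφ]
  have hφu : φ u = ψ u / deriv f u := by simp [hφ]
  rw [← hφu]
  rcases lt_or_gt_of_ne ha with h | h
  · have l1 := log_path (a := -a) (by linarith) (-1) (Or.inr rfl) hu
    have l2 := log_path (a := -a) (by linarith) 1 (Or.inl rfl) hu
    simp only [neg_mul, one_mul, neg_neg] at l1 l2
    rw [l1, l2, sign_neg h]; push_cast; simp; ring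
  · have l1 := log_path h 1 (Or.inl rfl) hu
    have l2 := log_path h (-1) (Or.inr rfl) hu
    simp only [neg_mul, one_mul] at l1 l2
    rw [l1, l2, sign_pos h]; push_cast; simp; ring
structure Edges where
  M : ℕ
  τ : Fin M → ℂ → ℂ
  V : Set ℂ
  V_open : IsOpen V
  V_convex : Convex ℝ V
  V_conj : ∀ x ∈ V, (starRingEnd ℂ) x ∈ V
  a : Fin M → ℝ
  a_ne : ∀ j, a j ≠ 0
  Th_sub : ∀ j, Th (a j) ⊆ V
  diff : ∀ j, DifferentiableOn ℂ (τ j) V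
  inj : ∀ j, InjOn (τ j) V
  cd : ℝ
  cd_pos : 0 < cd
  dist : ∀ i j, ∀ u ∈ UI, ∀ v ∈ UO, ∀ b : ℝ, (b = a j ∨ b = -a j) →
    cd * (v * (1 - v)) ≤ ‖τ i u - τ j (pth b v)‖
  sep : ∀ i j, ∀ u ∈ UO, ∀ x ∈ Th (a j), τ i u = τ j x → i = j ∧ x = u
theorem int_inv_sqrt : Integrable (fun v : ℝ => (rsq (v * (1 - v)))⁻¹) m01 := by
  have h1 : IntervalIntegrable (fun v => v ^ (-(1/2) : ℝ)) volume 0 1 :=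
    intervalIntegral.intervalIntegrable_rpow' (by norm_num)
  have h2 : IntervalIntegrable (fun v => (1 - v) ^ (-(1/2) : ℝ)) volume 0 1 := by
    simpa using (h1.comp_sub_left 1).symm
  have h3 : Integrable (fun v => v ^ (-(1/2) : ℝ) + (1 - v) ^ (-(1/2) : ℝ)) m01 := by
    exact (intervalIntegrable_iff_integrableOn_Ioo_of_le zero_le_one).1 (h1.add h2)
  refine h3.mono' (by fun_prop) ?_
  filter_upwards [ae_restrict_mem measurableSet_Ioo] with v hv
  have hv0 := hv.1
  have hv1 : 0 < 1 - v := by grind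
  rw [Real.norm_of_nonneg (by positivity), Real.rpow_neg hv0.le, Real.rpow_neg hv1.le, ← Real.sqrt_eq_rpow, ← Real.sqrt_eq_rpow,
    Real.sqrt_mul hv0.le]
  set p := rsq v
  set q := rsq (1 - v)
  have hp : 0 < p := Real.sqrt_pos.2 hv0
  have hq : 0 < q := Real.sqrt_pos.2 hv1
  have hpq : p ^ 2 + q ^ 2 = 1 := by grind
  rw [← sub_nonneg]
  have : p⁻¹ + q⁻¹ - (p * q)⁻¹ = (p + q - 1) / (p * q) := by field_simp; ring
  rw [this]
  apply div_nonneg _ (by positivity)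
  nlinarith
namespace Edges
variable (E : Edges)
theorem seg_mem (j : Fin E.M) {u : ℝ} (hu : u ∈ UI) : (u:ℂ) ∈ E.V := E.Th_sub j (real_mem_Th _ hu)
theorem cont_seg (j : Fin E.M) : ContinuousOn (fun u : ℝ => E.τ j u) (Icc 0 1) :=
  (E.diff j).continuousOn.comp continuous_ofReal.continuousOn fun _ hu => E.seg_mem j hu
theorem deriv_ne (j : Fin E.M) {x : ℂ} (hx : x ∈ E.V) : deriv (E.τ j) x ≠ 0 :=
  deriv_ne_zero_of_inj E.V_open (E.diff j) (E.inj j) hx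
theorem diff_deriv (j : Fin E.M) : DifferentiableOn ℂ (deriv (E.τ j)) E.V := (E.diff j).deriv E.V_open
theorem kernel : ∃ C > 0, ∀ i (w : ℂ) (d : ℝ), 0 < d → (∀ u ∈ UI, d ≤ ‖E.τ i u - w‖) →
      ∫ u, ‖(E.τ i u - w)⁻¹‖ ^ 2 ∂m01 ≤ C / d := by
  have : ∀ i, ∃ C > 0, ∀ w d, 0 < d → (∀ u ∈ UI, d ≤ ‖E.τ i u - w‖) →
      ∫ u, ‖(E.τ i u - w)⁻¹‖ ^ 2 ∂m01 ≤ C / d := by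
    intro i
    obtain ⟨c, hc, h⟩ := bilip E.V_open (E.diff i) (E.inj i) (isCompact_Icc.image continuous_ofReal)
      (by rintro _ ⟨u, hu, rfl⟩; exact E.seg_mem i hu)
    refine kernel_bound (E.cont_seg i) hc fun x hx y hy => ?_
    have := h x ⟨x, hx, rfl⟩ y ⟨y, hy, rfl⟩
    rwa [← ofReal_sub, norm_real, Real.norm_eq_abs] at this
  choose C hC h using this
  refine ⟨∑ i, C i + 1, add_pos_of_nonneg_of_pos (sum_nonneg fun i _ => (hC i).le) one_pos, fun i w d hd hw => (h i w d hd hw).trans ?_⟩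
  gcongr
  have := single_le_sum (fun i _ => (hC i).le) (mem_univ i)
  linarith
theorem inv_memLp (i : Fin E.M) {w : ℂ} (hw : ∀ u ∈ UI, E.τ i u ≠ w) :
    MemLp (fun u : ℝ => (E.τ i u - w)⁻¹) 2 m01 := by
  have hc : ContinuousOn (fun u : ℝ => (E.τ i u - w)⁻¹) (Icc 0 1) :=
    ((E.cont_seg i).sub continuousOn_const).inv₀ fun u hu => sub_ne_zero.2 (hw u hu)
  obtain ⟨C, hC⟩ := isCompact_Icc.exists_bound_of_continuousOn hc
  refine MemLp.of_bound ((hc.mono Ioo_subset_Icc_self).aestronglyMeasurable measurableSet_Ioo) C ?_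
  filter_upwards [ae_restrict_mem measurableSet_Ioo] with u hu using hC u (Ioo_subset_Icc_self hu)
def ker : ℝ := E.kernel.choose
theorem ker_pos : 0 < E.ker := E.kernel.choose_spec.1
theorem cs_kernel {g : ℝ → ℂ} (hg : MemLp g 2 m01) (i : Fin E.M) {w : ℂ} {d : ℝ} (hd : 0 < d)
    (hw : ∀ u ∈ UI, d ≤ ‖E.τ i u - w‖) :
    Integrable (fun u => g u / (E.τ i u - w)) m01 ∧
    ∫ u, ‖g u / (E.τ i u - w)‖ ∂m01 ≤ rsq (∫ u, ‖g u‖ ^ 2 ∂m01) * rsq (E.ker / d) := by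
  have hne : ∀ u ∈ UI, E.τ i u ≠ w := fun u hu h => by
    have := hw u hu; rw [h, sub_self, norm_zero] at this; linarith
  have hm := E.inv_memLp i hne
  refine ⟨by have := hg.integrable_mul hm; exact this, ?_⟩
  simp only [div_eq_mul_inv, norm_mul]
  refine (cs hg hm).trans ?_
  gcongr
  exact E.kernel.choose_spec.2 i w d hd hw
def Phi (g : Fin E.M → ℝ → ℂ) (w : ℂ) : ℂ := ∑ i, ∫ u, g i u / (E.τ i u - w) ∂m01
theorem fubini_int {g : ℝ → ℂ} (hg : MemLp g 2 m01) (i j : Fin E.M) {b : ℝ} (hb : b = E.a j ∨ b = -E.a j)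
    {ψ : ℂ → ℂ} (hψ : ContinuousOn ψ (Th (E.a j))) :
    Integrable (fun q : ℝ × ℝ => ψ (pth b q.1) * pthd b q.1 * (g q.2 / (E.τ i q.2 - E.τ j (pth b q.1))))
      (m01.prod m01) := by
  have hTb : ∀ v ∈ UI, pth b v ∈ Th (E.a j) := by
    rcases hb with rfl | rfl
    · exact fun v hv => pth_mem _ hv
    · exact fun v hv => Th_neg (E.a j) ▸ pth_mem _ hv
  have hψc : ContinuousOn (fun v => ψ (pth b v) * pthd b v) (Icc 0 1) :=
    (hψ.comp (pth_continuous b).continuousOn hTb).mul (pthd_continuous b).continuousOn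
  obtain ⟨B, hB⟩ := isCompact_Icc.exists_bound_of_continuousOn hψc
  have hd : ∀ v ∈ UO, 0 < E.cd * (v * (1 - v)) := fun v hv =>
    mul_pos E.cd_pos (mul_pos hv.1 (by grind))
  have hne : ∀ v ∈ UO, ∀ u ∈ UO, E.τ i u - E.τ j (pth b v) ≠ 0 := fun v hv u hu => by
    rw [← norm_pos_iff]
    exact (hd v hv).trans_le (E.dist i j u (Ioo_subset_Icc_self hu) v hv b hb)
  have hmeas : AEStronglyMeasurable (fun q : ℝ × ℝ => ψ (pth b q.1) * pthd b q.1 * (g q.2 / (E.τ i q.2 - E.τ j (pth b q.1))))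
      (m01.prod m01) := by
    have h1 : AEStronglyMeasurable (fun q : ℝ × ℝ => (ψ (pth b q.1) * pthd b q.1) * (E.τ i q.2 - E.τ j (pth b q.1))⁻¹) (m01.prod m01) := by
      rw [Measure.prod_restrict]
      refine ContinuousOn.aestronglyMeasurable ?_ (measurableSet_Ioo.prod measurableSet_Ioo)
      refine ContinuousOn.mul (hψc.comp continuousOn_fst fun q hq => Ioo_subset_Icc_self hq.1) (ContinuousOn.inv₀ (ContinuousOn.sub ?_ ?_) fun q hq => hne _ hq.1 _ hq.2)
      · exact (E.cont_seg i).comp continuousOn_snd fun q hq => Ioo_subset_Icc_self hq.2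
      · refine (E.diff j).continuousOn.comp ((pth_continuous b).continuousOn.comp continuousOn_fst (mapsTo_univ _ _)) fun q hq => ?_
        exact E.Th_sub j (hTb _ (Ioo_subset_Icc_self hq.1))
    have h2 : AEStronglyMeasurable (fun q : ℝ × ℝ => g q.2) (m01.prod m01) := hg.1.comp_snd
    refine (h1.mul h2).congr (ae_of_all _ fun q => ?_)
    simp only [Pi.mul_apply]; ring
  rw [integrable_prod_iff hmeas]
  have hker := fun v hv => E.cs_kernel hg i (hd v hv) fun u hu => E.dist i j u hu v hv b hb
  constructor
  · filter_upwards [ae_restrict_mem measurableSet_Ioo] with v hv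
    exact (hker v hv).1.const_mul _
  · refine Integrable.mono' (int_inv_sqrt.const_mul (B * (rsq (∫ u, ‖g u‖ ^ 2 ∂m01) * rsq (E.ker / E.cd)))) hmeas.norm.integral_prod_right' ?_
    filter_upwards [ae_restrict_mem measurableSet_Ioo] with v hv
    rw [Real.norm_of_nonneg (integral_nonneg fun _ => norm_nonneg _)]
    simp only [norm_mul _ (g _ / _)]
    rw [integral_const_mul]
    have h1 := (hker v hv).2
    have h2 := hB v (Ioo_subset_Icc_self hv)
    have h3 : rsq (E.ker / (E.cd * (v * (1 - v)))) = rsq (E.ker / E.cd) * (rsq (v * (1 - v)))⁻¹ := by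
      rw [← div_div, Real.sqrt_div (by have := E.ker_pos; have := E.cd_pos; positivity), div_eq_mul_inv]
    rw [h3] at h1
    calc _ ≤ B * (rsq (∫ u, ‖g u‖ ^ 2 ∂m01) * (rsq (E.ker / E.cd) * (rsq (v * (1 - v)))⁻¹)) :=
          mul_le_mul h2 h1 (integral_nonneg fun _ => norm_nonneg _) ((norm_nonneg _).trans h2)
      _ = _ := by ring
theorem Phi_path {g : Fin E.M → ℝ → ℂ} (hg : ∀ i, MemLp (g i) 2 m01) (j : Fin E.M) {b : ℝ} (hb : b = E.a j ∨ b = -E.a j)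
    {ψ : ℂ → ℂ} (hψ : ContinuousOn ψ (Th (E.a j))) :
    Integrable (fun v => ψ (pth b v) * E.Phi g (E.τ j (pth b v)) * pthd b v) m01 ∧
    (∫ v, ψ (pth b v) * E.Phi g (E.τ j (pth b v)) * pthd b v ∂m01 =
      ∑ i, ∫ u, g i u * ∫ v, ψ (pth b v) / (E.τ i u - E.τ j (pth b v)) * pthd b v ∂m01 ∂m01) ∧
    ∀ i, Integrable (fun u => g i u * ∫ v, ψ (pth b v) / (E.τ i u - E.τ j (pth b v)) * pthd b v ∂m01) m01 := by
  have hF := fun i => E.fubini_int (hg i) i j hb hψ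
  have e : (fun v => ψ (pth b v) * E.Phi g (E.τ j (pth b v)) * pthd b v) =
      fun v => ∑ i, ∫ u, ψ (pth b v) * pthd b v * (g i u / (E.τ i u - E.τ j (pth b v))) ∂m01 := by
    funext v
    simp only [integral_const_mul, ← mul_sum, Phi]; ring
  have hE : ∀ i u, (∫ v, ψ (pth b v) * pthd b v * (g i u / (E.τ i u - E.τ j (pth b v))) ∂m01) =
      g i u * ∫ v, ψ (pth b v) / (E.τ i u - E.τ j (pth b v)) * pthd b v ∂m01 := by
    intro i u
    rw [← integral_const_mul]; congr 1; funext v; ring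
  refine ⟨?_, ?_, fun i => ?_⟩
  · rw [e]; exact integrable_finsetSum _ fun i _ => (hF i).integral_prod_left
  · rw [e, integral_finsetSum _ fun i _ => (hF i).integral_prod_left]
    refine sum_congr rfl fun i _ => ?_
    rw [integral_integral_swap (hF i)]
    grind
  · have := (hF i).integral_prod_right
    grind
theorem trick {g : Fin E.M → ℝ → ℂ} (hg : ∀ i, MemLp (g i) 2 m01) (j : Fin E.M) {W : Set ℂ} (hW : IsOpen W)
    (hTW : Th (E.a j) ⊆ W) {ψ : ℂ → ℂ} (hψ : DifferentiableOn ℂ ψ W) :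
    (∫ v, ψ (pth (E.a j) v) * E.Phi g (E.τ j (pth (E.a j) v)) * pthd (E.a j) v ∂m01) -
      (∫ v, ψ (pth (-E.a j) v) * E.Phi g (E.τ j (pth (-E.a j) v)) * pthd (-E.a j) v ∂m01) =
      SignType.sign (E.a j) * (2 * π * I) * ∫ u : ℝ, g j u * (ψ u / deriv (E.τ j) u) ∂m01 := by
  have hc := hψ.continuousOn.mono hTW
  obtain ⟨-, e1, i1⟩ := E.Phi_path hg j (Or.inl rfl) hc
  obtain ⟨-, e2, i2⟩ := E.Phi_path hg j (Or.inr rfl) hc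
  rw [e1, e2, ← sum_sub_distrib, sum_eq_single j]
  · rw [← integral_sub (i1 j) (i2 j), ← integral_const_mul]
    refine setIntegral_congr_fun measurableSet_Ioo fun u hu => ?_
    have := residue_Th (E.a_ne j) (hW.inter E.V_open) (subset_inter hTW (E.Th_sub j)) ((E.diff j).mono inter_subset_right)
      ((E.inj j).mono inter_subset_right) (hψ.mono inter_subset_left) hu
    grind
  · intro i _ hij
    rw [← integral_sub (i1 i) (i2 i)]
    refine setIntegral_eq_zero_of_forall_eq_zero fun u hu => ?_
    have hT : Th (E.a j) ⊆ (W ∩ E.V) ∩ {x | E.τ j x ≠ E.τ i u} := fun x hx =>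
      ⟨⟨hTW hx, E.Th_sub j hx⟩, fun h => hij (E.sep i j u hu x hx h.symm).1⟩
    have hopen : IsOpen ((W ∩ E.V) ∩ {x | E.τ j x ≠ E.τ i u}) :=
      ((E.diff j).continuousOn.mono inter_subset_right).isOpen_inter_preimage (hW.inter E.V_open) isOpen_compl_singleton
    have := cauchy_Th hopen hT (f := fun x => ψ x / (E.τ i u - E.τ j x)) ?_
    · grind
    · refine (hψ.mono fun x hx => hx.1.1).div ((differentiableOn_const _).sub ((E.diff j).mono fun x hx => hx.1.2)) fun x hx h => ?_
      grind
  · simp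
end Edges
def Yset (G : Set ℂ) : Set ℂ := {w | w ∉ closure G ∧ PA (closure G) (fun z => (w - z)⁻¹)}
structure Geo (G F : Set ℂ) extends Edges where
  M_pos : 0 < M
  G_open : IsOpen G
  G_bdd : Bornology.IsBounded G
  G_conn : IsPreconnected G
  F_comp : IsCompact F
  F_sub : F ⊆ G
  hL : frontier G = ⋃ j, (fun u : ℝ => τ j u) '' Icc 0 1
  tele : ∀ f : ℂ → ℂ, ∑ j, (f (τ j 1) - f (τ j 0)) = 0
  avoid : ∀ j, ∀ x ∈ Th (a j), τ j x ∉ F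
  halfG : ∀ j, ∀ x ∈ Th (a j), 0 < a j * x.im → τ j x ∈ G
  halfY : ∀ j, ∀ x ∈ Th (a j), a j * x.im < 0 → τ j x ∈ Yset G
theorem Polynomial.exists_antideriv (P : PC) : ∃ Q : PC, Polynomial.derivative Q = P := by
  induction P using Polynomial.induction_on' with
  | add p q hp hq =>
    obtain ⟨a, rfl⟩ := hp
    obtain ⟨b, rfl⟩ := hq
    exact ⟨a + b, by simp⟩
  | monomial n c =>
    refine ⟨Polynomial.monomial (n + 1) (c / (n + 1)), ?_⟩
    rw [Polynomial.derivative_monomial]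
    have : (n : ℂ) + 1 ≠ 0 := by exact_mod_cast Nat.succ_ne_zero n
    grind
theorem ContinuousOn.memLp01 {f : ℝ → ℂ} (hf : ContinuousOn f (Icc 0 1)) : MemLp f 2 m01 := by
  obtain ⟨C, hC⟩ := isCompact_Icc.exists_bound_of_continuousOn hf
  refine MemLp.of_bound ((hf.mono Ioo_subset_Icc_self).aestronglyMeasurable measurableSet_Ioo) C ?_
  filter_upwards [ae_restrict_mem measurableSet_Ioo] with u hu using hC u (Ioo_subset_Icc_self hu)
theorem MemLp.int01 {f : ℝ → ℂ} (hf : MemLp f 2 m01) : Integrable f m01 := hf.integrable (by norm_num)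
theorem ContinuousOn.int01 {f : ℝ → ℂ} (hf : ContinuousOn f (Icc 0 1)) : Integrable f m01 := MemLp.int01 hf.memLp01
theorem int_mul01 {f g : ℝ → ℂ} (hf : Integrable f m01) (hg : ContinuousOn g (Icc 0 1)) :
    Integrable (fun u => f u * g u) m01 := by
  obtain ⟨C, hC⟩ := isCompact_Icc.exists_bound_of_continuousOn hg
  refine hf.mul_bdd (c := C) ((hg.mono Ioo_subset_Icc_self).aestronglyMeasurable measurableSet_Ioo) ?_
  filter_upwards [ae_restrict_mem measurableSet_Ioo] with u hu using hC u (Ioo_subset_Icc_self hu)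
theorem memLp_mul01 {f g : ℝ → ℂ} (hf : MemLp f 2 m01) (hg : ContinuousOn g (Icc 0 1)) :
    MemLp (fun u => f u * g u) 2 m01 := by
  obtain ⟨C, hC⟩ := isCompact_Icc.exists_bound_of_continuousOn hg
  refine MemLp.of_le_mul (c := C) hf (hf.1.mul ((hg.mono Ioo_subset_Icc_self).aestronglyMeasurable (μ := volume) measurableSet_Ioo)) ?_
  filter_upwards [ae_restrict_mem measurableSet_Ioo] with u hu
  rw [norm_mul, mul_comm]
  gcongr
  grind
namespace Edges
variable (E : Edges)
theorem cont_deriv (j : Fin E.M) : ContinuousOn (fun u : ℝ => deriv (E.τ j) u) (Icc 0 1) :=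
  (E.diff_deriv j).continuousOn.comp continuous_ofReal.continuousOn fun _ hu => E.seg_mem j hu
theorem ftc_seg (j : Fin E.M) {f P : ℂ → ℂ} (hP : ∀ u ∈ UI, HasDerivAt P (f (E.τ j u)) (E.τ j u))
    (hf : ContinuousOn (fun u : ℝ => f (E.τ j u)) (Icc 0 1)) :
    ∫ u : ℝ, deriv (E.τ j) u * f (E.τ j u) ∂m01 = P (E.τ j 1) - P (E.τ j 0) := by
  rw [← integral_Ioc_eq_integral_Ioo, ← intervalIntegral.integral_of_le zero_le_one,
    intervalIntegral.integral_eq_sub_of_hasDerivAt (f := fun u => P (E.τ j u))]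
  · simp
  · intro v hv
    rw [uIcc_of_le zero_le_one] at hv
    rw [mul_comm]; exact ((hP v hv).comp (v:ℂ) (((E.diff j).differentiableAt (E.V_open.mem_nhds (E.seg_mem j hv))).hasDerivAt)).comp_ofReal
  · apply ContinuousOn.intervalIntegrable
    rw [uIcc_of_le zero_le_one]
    exact (E.cont_deriv j).mul hf
end Edges
namespace Geo
variable {G F : Set ℂ} (E : Geo G F)
theorem inG (j : Fin E.M) (v : ℝ) (hv : v ∈ UO) : E.τ j (pth (E.a j) v) ∈ G := by
  refine E.halfG j _ (pth_mem _ (Ioo_subset_Icc_self hv)) ?_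
  have h2 : 0 < 1 - v := by grind
  rw [pth_im]
  nlinarith [mul_pos (mul_self_pos.2 (E.a_ne j)) (mul_pos hv.1 h2)]
theorem inY (j : Fin E.M) (v : ℝ) (hv : v ∈ UO) : E.τ j (pth (-E.a j) v) ∈ Yset G := by
  refine E.halfY j _ (Th_neg (E.a j) ▸ pth_mem _ (Ioo_subset_Icc_self hv)) ?_
  have h2 : 0 < 1 - v := by grind
  rw [pth_im]
  nlinarith [mul_pos (mul_self_pos.2 (E.a_ne j)) (mul_pos hv.1 h2)]
theorem K_compact {G F : Set ℂ} (E : Geo G F) : IsCompact (closure G) := isCompact_of_isClosed_isBounded isClosed_closure (isBounded_closure_of_isBounded E.G_bdd)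
theorem seg_front (j : Fin E.M) {u : ℝ} (hu : u ∈ UI) : E.τ j u ∈ frontier G := by
  rw [E.hL]; exact mem_iUnion.2 ⟨j, u, hu, rfl⟩
theorem seg_K (j : Fin E.M) {u : ℝ} (hu : u ∈ UI) : E.τ j u ∈ closure G := frontier_subset_closure (E.seg_front j hu)
theorem seg_notG (j : Fin E.M) {u : ℝ} (hu : u ∈ UI) : E.τ j u ∉ G := fun h => by
  have := E.seg_front j hu
  rw [E.G_open.frontier_eq] at this; exact this.2 h
theorem poly_cont (P : PC) (j : Fin E.M) : ContinuousOn (fun u : ℝ => P.eval (E.τ j u)) (Icc 0 1) :=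
  P.continuous.comp_continuousOn (E.cont_seg j)
theorem PA_cont {f : ℂ → ℂ} (hf : PA (closure G) f) (j : Fin E.M) : ContinuousOn (fun u : ℝ => f (E.τ j u)) (Icc 0 1) :=
  hf.cont.comp (E.cont_seg j) fun _ hu => E.seg_K j hu
theorem polyfun {H : Fin E.M → ℝ → ℂ} (hH : ∀ j, Integrable (H j) m01) {ζ : ℂ} (hζ : ζ ∈ closure G) {c : ℂ}
    (h : ∀ P : PC, ∑ j, ∫ u, H j u * P.eval (E.τ j u) ∂m01 = c * P.eval ζ) {f : ℂ → ℂ} (hf : PA (closure G) f) :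
    ∑ j, ∫ u, H j u * f (E.τ j u) ∂m01 = c * f ζ := by
  set B : ℝ := ∑ j, ∫ u, ‖H j u‖ ∂m01 + ‖c‖ with hB
  refine eq_of_sub_eq_zero (norm_eq_zero.1 (le_antisymm (le_of_forall_pos_le_add fun ε hε => ?_) (norm_nonneg _)))
  obtain ⟨P, hP⟩ := hf (ε / (B + 1)) (by positivity)
  have e : (∑ j, ∫ u, H j u * f (E.τ j u) ∂m01) - c * f ζ =
      (∑ j, ∫ u, H j u * (f (E.τ j u) - P.eval (E.τ j u)) ∂m01) - c * (f ζ - P.eval ζ) := by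
    have : ∀ j, ∫ u, H j u * (f (E.τ j u) - P.eval (E.τ j u)) ∂m01 =
      (∫ u, H j u * f (E.τ j u) ∂m01) - ∫ u, H j u * P.eval (E.τ j u) ∂m01 := fun j => by
      simp only [mul_sub]
      exact integral_sub (int_mul01 (hH j) (E.PA_cont hf j)) (int_mul01 (hH j) (E.poly_cont P j))
    simp only [this, sum_sub_distrib, h P]; ring
  rw [e, zero_add]
  have h1 : ∀ j, ‖∫ u, H j u * (f (E.τ j u) - P.eval (E.τ j u)) ∂m01‖ ≤ (∫ u, ‖H j u‖ ∂m01) * (ε / (B + 1)) := fun j => by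
    rw [← integral_mul_const]
    refine norm_integral_le_of_norm_le ((hH j).norm.mul_const _) ?_
    filter_upwards [ae_restrict_mem measurableSet_Ioo] with u hu
    rw [norm_mul]
    gcongr
    exact hP _ (E.seg_K j (Ioo_subset_Icc_self hu))
  calc _ ≤ ‖∑ j, ∫ u, H j u * (f (E.τ j u) - P.eval (E.τ j u)) ∂m01‖ + ‖c * (f ζ - P.eval ζ)‖ := norm_sub_le _ _
    _ ≤ ∑ j, (∫ u, ‖H j u‖ ∂m01) * (ε / (B + 1)) + ‖c‖ * (ε / (B + 1)) := by
      rw [norm_mul]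
      gcongr
      · exact (norm_sum_le _ _).trans (sum_le_sum fun j _ => h1 j)
      · grind
    _ = B * (ε / (B + 1)) := by rw [hB, add_mul, sum_mul]
    _ ≤ ε := by
      rw [mul_div_assoc', div_le_iff₀ (by positivity)]; nlinarith
theorem Phi_hasDeriv {g : Fin E.M → ℝ → ℂ} (hg : ∀ i, Integrable (g i) m01) {w : ℂ} (hw : w ∉ frontier G) :
    HasDerivAt (E.Phi g) (∑ i, ∫ u, g i u / (E.τ i u - w) ^ 2 ∂m01) w := by
  exact HasDerivAt.fun_sum (u := Finset.univ) fun i _ => cauchy_holo (hg i) (((E.cont_seg i).mono Ioo_subset_Icc_self).aestronglyMeasurable measurableSet_Ioo) (isClosed_frontier) (by filter_upwards [ae_restrict_mem measurableSet_Ioo] with u hu using E.seg_front i (Ioo_subset_Icc_self hu)) hw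
theorem tele_poly (P : PC) : ∑ j, ∫ u : ℝ, deriv (E.τ j) u * P.eval (E.τ j u) ∂m01 = 0 := by
  obtain ⟨Q, rfl⟩ := P.exists_antideriv
  rw [← E.tele fun z => Q.eval z]
  exact sum_congr rfl fun j _ => E.ftc_seg j (f := fun z => (Polynomial.derivative Q).eval z) (fun u _ => Q.hasDerivAt _) (E.poly_cont _ j)
theorem tele_PA {f : ℂ → ℂ} (hf : PA (closure G) f) : ∑ j, ∫ u : ℝ, deriv (E.τ j) u * f (E.τ j u) ∂m01 = 0 := by
  by_cases h : (closure G).Nonempty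
  · obtain ⟨ζ, hζ⟩ := h
    simpa using E.polyfun (fun j => (E.cont_deriv j).int01) hζ (c := 0) (fun P => by simpa using E.tele_poly P) hf
  · refine Finset.sum_eq_zero fun j _ => (h ⟨_, E.seg_K j (u := 0) (by simp)⟩).elim
def one1 (j : Fin E.M) (u : ℝ) : ℂ := deriv (E.τ j) u
theorem one1_memLp (j : Fin E.M) : MemLp (E.one1 j) 2 m01 := (E.cont_deriv j).memLp01
theorem PAsub {w : ℂ} (hw : w ∈ Yset G) : PA (closure G) (fun z => (z - w)⁻¹) :=
  (hw.2.cmul (-1)).congr fun z _ => by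
    show -1 * (w - z)⁻¹ = (z - w)⁻¹
    rw [← neg_sub z w, inv_neg]; ring
theorem Phi_one_Y {w : ℂ} (hw : w ∈ Yset G) : E.Phi E.one1 w = 0 := by
  simpa only [Edges.Phi, one1, div_eq_mul_inv] using E.tele_PA (PAsub hw)
theorem Phi_one_G : ∃ c : ℂ, ∀ w ∈ G, E.Phi E.one1 w = c := by
  refine E.G_open.exists_is_const_of_deriv_eq_zero E.G_conn (fun w hw => ?_) (fun w hw => ?_)
  · exact (E.Phi_hasDeriv (fun i => MemLp.int01 (E.one1_memLp i)) fun h => by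
      rw [E.G_open.frontier_eq] at h; exact h.2 hw).differentiableAt.differentiableWithinAt
  · rw [(E.Phi_hasDeriv (fun i => MemLp.int01 (E.one1_memLp i)) fun h => by
      rw [E.G_open.frontier_eq] at h; exact h.2 hw).deriv]
    have hne : ∀ j, ∀ u ∈ UI, E.τ j u - w ≠ 0 := fun j u hu h =>
      E.seg_notG j hu (by grind)
    have hd : ∀ j, ∀ u ∈ UI, HasDerivAt (fun z => -(z - w)⁻¹) (((E.τ j u - w) ^ 2)⁻¹) (E.τ j u) := fun j u hu => by
      have h1 := (((hasDerivAt_id' (E.τ j u)).sub_const w).fun_inv (hne j u hu)).fun_neg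
      grind
    simp only [one1, div_eq_mul_inv, fun j => E.ftc_seg j (f := fun z => ((z - w) ^ 2)⁻¹) (hd j) ((fun j => (((E.cont_seg j).sub continuousOn_const).pow 2).inv₀ fun u hu => pow_ne_zero 2 (hne j u hu)) j)]
    exact E.tele fun z => -(z - w)⁻¹
theorem Phi_one_const (j : Fin E.M) {w : ℂ} (hw : w ∈ G) :
    E.Phi E.one1 w = SignType.sign (E.a j) * (2 * π * I) := by
  obtain ⟨c, hc⟩ := E.Phi_one_G
  have := E.trick E.one1_memLp j E.V_open (E.Th_sub j) (differentiableOn_const (c := 1))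
  have e1 : ∫ v, 1 * E.Phi E.one1 (E.τ j (pth (E.a j) v)) * pthd (E.a j) v ∂m01 = c := by
    rw [setIntegral_congr_fun measurableSet_Ioo (g := fun v => c * pthd (E.a j) v) fun v hv => by
      simp only [hc _ (E.inG j v hv), one_mul], integral_const_mul]
    have := ftc_path (E.a j) (P := fun z => z) (fun v _ => hasDerivAt_id' _) continuousOn_const
    grind
  have e2 : ∫ v, 1 * E.Phi E.one1 (E.τ j (pth (-E.a j) v)) * pthd (-E.a j) v ∂m01 = 0 :=
    setIntegral_eq_zero_of_forall_eq_zero fun v hv => by simp only [E.Phi_one_Y (E.inY j v hv), mul_zero, zero_mul]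
  have e3 : ∫ u : ℝ, E.one1 j u * (1 / deriv (E.τ j) u) ∂m01 = 1 := by
    rw [setIntegral_congr_fun measurableSet_Ioo fun v hv => by
      simp only [one1]; rw [mul_one_div_cancel (E.deriv_ne j (E.seg_mem j (Ioo_subset_Icc_self hv)))]]
    simp
  grind
end Geo
namespace Geo
variable {G F : Set ℂ} (E : Geo G F)
def j0 : Fin E.M := ⟨0, E.M_pos⟩
def sg : ℂ := ((SignType.sign (E.a E.j0) : SignType) : ℂ)
theorem sg_eq (j : Fin E.M) : ((SignType.sign (E.a j) : SignType) : ℂ) = E.sg := by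
  have hw := E.inG E.j0 (1/2) (by norm_num)
  exact mul_right_cancel₀ two_pi_I_ne_zero ((E.Phi_one_const j hw).symm.trans (E.Phi_one_const E.j0 hw))
theorem sg_sq : E.sg = 1 ∨ E.sg = -1 := by
  unfold sg
  rcases lt_or_gt_of_ne (E.a_ne E.j0) with h | h
  · simp [h]
  · simp [h]
theorem sg_norm : ‖E.sg‖ = 1 := by rcases E.sg_sq with h | h <;> simp [h]
theorem sg_ne : E.sg ≠ 0 := by rcases E.sg_sq with h | h <;> simp [h]
theorem Phi_one_G' {w : ℂ} (hw : w ∈ G) : E.Phi E.one1 w = E.sg * (2 * π * I) := E.Phi_one_const E.j0 hw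
theorem not_front {G F : Set ℂ} (E : Geo G F) {w : ℂ} (hw : w ∈ G) : w ∉ frontier G := fun h => by
  rw [E.G_open.frontier_eq] at h; exact h.2 hw
theorem seg_ne (j : Fin E.M) {u : ℝ} (hu : u ∈ UI) {w : ℂ} (hw : w ∉ frontier G) : E.τ j u - w ≠ 0 := fun h =>
  hw (by rw [← sub_eq_zero.1 h]; exact E.seg_front j hu)
theorem inv_cont (j : Fin E.M) {w : ℂ} (hw : w ∉ frontier G) : ContinuousOn (fun u : ℝ => (E.τ j u - w)⁻¹) (Icc 0 1) :=
  ((E.cont_seg j).sub continuousOn_const).inv₀ fun u hu => E.seg_ne j hu hw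
theorem div_trick {H : Fin E.M → ℝ → ℂ} (hH : ∀ j, Integrable (H j) m01) {ζ : ℂ} {c : ℂ}
    (h : ∀ P : PC, ∑ j, ∫ u, H j u * P.eval (E.τ j u) ∂m01 = c * P.eval ζ)
    {w : ℂ} (hw : w ∉ frontier G) (hwζ : w ≠ ζ ∨ c = 0) (P : PC) :
    ∑ j, ∫ u, H j u * P.eval (E.τ j u) / (E.τ j u - w) ∂m01 =
      P.eval w * E.Phi H w + c * ((P.eval ζ - P.eval w) / (ζ - w)) := by
  obtain ⟨Q, hQ⟩ := Polynomial.X_sub_C_dvd_sub_C_eval (p := P)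
  have hQe : ∀ z, P.eval z = P.eval w + (z - w) * Q.eval z := fun z => by
    have := congrArg (Polynomial.eval z) hQ
    simp at this
    rw [← this]; ring
  have e1 : c * ((P.eval ζ - P.eval w) / (ζ - w)) = c * Q.eval ζ := by grind
  rw [e1, ← h Q, Edges.Phi, mul_sum, ← sum_add_distrib]
  refine sum_congr rfl fun j _ => ?_
  have i1 : Integrable (fun u => H j u / (E.τ j u - w)) m01 := by
    simpa only [div_eq_mul_inv] using int_mul01 (hH j) (E.inv_cont j hw)
  rw [← integral_const_mul, ← integral_add (i1.const_mul _) (int_mul01 (hH j) (E.poly_cont Q j))]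
  refine setIntegral_congr_fun measurableSet_Ioo fun u hu => ?_
  have := E.seg_ne j (Ioo_subset_Icc_self hu) hw
  grind
theorem cauchy_poly {w : ℂ} (hw : w ∈ G) (P : PC) :
    ∑ j, ∫ u : ℝ, deriv (E.τ j) u * P.eval (E.τ j u) / (E.τ j u - w) ∂m01 = E.sg * (2 * π * I) * P.eval w := by
  have := E.div_trick (ζ := 0) (fun j => MemLp.int01 (E.one1_memLp j)) (fun P => by
    simpa [one1] using E.tele_poly P) (E.not_front hw) (Or.inr rfl) P
  rw [E.Phi_one_G' hw] at this
  simp only [one1] at this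
  grind
def Wt (j : Fin E.M) (u : ℝ) : ℝ := ‖deriv (E.τ j) u‖
theorem Wt_cont (j : Fin E.M) : ContinuousOn (E.Wt j) (Icc 0 1) := (E.cont_deriv j).norm
theorem Wt_pos (j : Fin E.M) {u : ℝ} (hu : u ∈ UI) : 0 < E.Wt j u := norm_pos_iff.2 (E.deriv_ne j (E.seg_mem j hu))
theorem Wt_nonneg (j : Fin E.M) (u : ℝ) : 0 ≤ E.Wt j u := norm_nonneg _
def sW (j : Fin E.M) (u : ℝ) : ℂ := (rsq (E.Wt j u) : ℝ)
theorem sW_cont (j : Fin E.M) : ContinuousOn (E.sW j) (Icc 0 1) :=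
  continuous_ofReal.comp_continuousOn (E.Wt_cont j).sqrt
theorem sW_ne (j : Fin E.M) {u : ℝ} (hu : u ∈ UI) : E.sW j u ≠ 0 := by
  simpa [sW] using (Real.sqrt_pos.2 (E.Wt_pos j hu)).ne'
theorem sW_sq (j : Fin E.M) (u : ℝ) : E.sW j u * E.sW j u = E.Wt j u := by
  rw [sW, ← ofReal_mul, Real.mul_self_sqrt (E.Wt_nonneg j u)]
theorem sW_norm (j : Fin E.M) (u : ℝ) : ‖E.sW j u‖ ^ 2 = E.Wt j u := by
  rw [sW, norm_real, Real.norm_of_nonneg (Real.sqrt_nonneg _), Real.sq_sqrt (E.Wt_nonneg j u)]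
theorem sW_conj (j : Fin E.M) (u : ℝ) : conj (E.sW j u) = E.sW j u := by simp [sW]
abbrev HS : Type := PiLp 2 (fun _ : Fin E.M => Lp ℂ 2 m01)
theorem HS_inner (x y : E.HS) : inner ℂ x y = ∑ j, ∫ u, conj (x j u) * y j u ∂m01 := by
  refine sum_congr rfl fun j _ => ?_
  rw [L2.inner_def]
  simp [mul_comm]
theorem HS_norm (x : E.HS) : ‖x‖ ^ 2 = ∑ j, ∫ u, ‖x j u‖ ^ 2 ∂m01 := by
  have h := inner_self_eq_norm_sq_to_K (𝕜 := ℂ) x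
  rw [HS_inner] at h
  have h2 : ∀ j, ∫ u, conj (x j u) * x j u ∂m01 = ((∫ u, ‖x j u‖ ^ 2 ∂m01 : ℝ) : ℂ) := fun j => by
    rw [← integral_complex_ofReal]
    simp only [mul_comm (conj _), mul_conj, normSq_eq_norm_sq]
  simp only [h2] at h
  rw [← ofReal_sum] at h
  have h3 : ((∑ j, ∫ u, ‖x j u‖ ^ 2 ∂m01 : ℝ) : ℂ) = ((‖x‖ ^ 2 : ℝ) : ℂ) := by rw [h]; simp
  exact (ofReal_injective h3).symm
def mkH (f : Fin E.M → ℝ → ℂ) (hf : ∀ j, MemLp (f j) 2 m01) : E.HS := WithLp.toLp 2 fun j => (hf j).toLp (f j)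
theorem mkH_coe (f : Fin E.M → ℝ → ℂ) (hf : ∀ j, MemLp (f j) 2 m01) (j : Fin E.M) : (E.mkH f hf j : ℝ → ℂ) =ᵐ[m01] f j :=
  (hf j).coeFn_toLp
def embf (P : PC) (j : Fin E.M) (u : ℝ) : ℂ := E.sW j u * P.eval (E.τ j u)
theorem embf_mem (P : PC) (j : Fin E.M) : MemLp (E.embf P j) 2 m01 := ((E.sW_cont j).mul (E.poly_cont P j)).memLp01
def emb : PC →ₗ[ℂ] E.HS where
  toFun P := E.mkH (E.embf P) (E.embf_mem P)
  map_add' P Q := by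
    ext1 j
    have : E.embf (P + Q) j = E.embf P j + E.embf Q j := by funext u; simp [embf, mul_add]
    simp only [mkH, PiLp.add_apply, ← MemLp.toLp_add, this]
  map_smul' c P := by
    ext1 j
    have : E.embf (c • P) j = c • E.embf P j := by funext u; simp [embf]; ring
    simp only [mkH, PiLp.smul_apply, RingHom.id_apply, ← MemLp.toLp_const_smul, this]
theorem F_dist : ∃ d > 0, ∀ ζ ∈ F, ∀ j, ∀ u ∈ UI, d ≤ ‖E.τ j u - ζ‖ := by
  have hd := disjoint_left.2 fun z hz => E.not_front (E.F_sub hz)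
  obtain ⟨d, hd, h⟩ := hd.exists_thickenings E.F_comp isClosed_frontier
  refine ⟨d, hd, fun ζ hζ j u hu => ?_⟩
  by_contra hlt
  push Not at hlt
  refine disjoint_left.1 h (self_subset_thickening hd F hζ) (mem_thickening_iff.2 ⟨_, E.seg_front j hu, ?_⟩)
  rwa [dist_comm, dist_eq_norm]
theorem exists_kernel : ∃ C > 0, ∀ ζ ∈ F, ∃ kk : Fin E.M → ℝ → ℂ, (∀ j, MemLp (kk j) 2 m01) ∧
    (∀ P : PC, ∑ j, ∫ u, E.Wt j u * conj (kk j u) * P.eval (E.τ j u) ∂m01 = P.eval ζ) ∧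
    ∑ j, ∫ u, E.Wt j u * ‖kk j u‖ ^ 2 ∂m01 ≤ C ∧
    ∀ ε > 0, ∃ P : PC, ∑ j, ∫ u, E.Wt j u * ‖kk j u - P.eval (E.τ j u)‖ ^ 2 ∂m01 ≤ ε := by
  obtain ⟨d, hd, hdist⟩ := E.F_dist
  have hWb : ∀ j, ∃ B, ∀ u ∈ UI, E.Wt j u ≤ B := fun j => by
    obtain ⟨B, hB⟩ := isCompact_Icc.exists_bound_of_continuousOn (E.Wt_cont j)
    exact ⟨B, fun u hu => (le_abs_self _).trans (hB u hu)⟩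
  choose B hB using hWb
  refine ⟨∑ j, |B j| / d ^ 2 + 1, by positivity, fun ζ hζ => ?_⟩
  have hζG := E.F_sub hζ
  set k0 : Fin E.M → ℝ → ℂ := fun j u => conj (deriv (E.τ j) u / (E.sW j u * (E.sg * (2 * π * I))) * (E.τ j u - ζ)⁻¹) with hk0
  have hpi : E.sg * (2 * π * I) ≠ 0 := mul_ne_zero E.sg_ne Complex.two_pi_I_ne_zero
  have hk0c := fun j =>
    continuous_conj.comp_continuousOn (((E.cont_deriv j).div ((E.sW_cont j).mul continuousOn_const) fun u hu =>
      mul_ne_zero (E.sW_ne j hu) hpi).mul (E.inv_cont j (E.not_front hζG)))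
  set K0 : E.HS := E.mkH k0 fun j => (hk0c j).memLp01 with hK0
  have hK0P : ∀ P, inner ℂ K0 (E.emb P) = P.eval ζ := fun P => by
    rw [HS_inner]
    have := E.cauchy_poly hζG P
    rw [mul_comm (E.sg * _)] at this
    rw [eq_div_of_mul_eq hpi this.symm, Finset.sum_div]
    refine sum_congr rfl fun j _ => ?_
    rw [← integral_div]
    refine integral_congr_ae ?_
    filter_upwards [E.mkH_coe k0 (fun j => (hk0c j).memLp01) j, E.mkH_coe _ (E.embf_mem P) j, ae_restrict_mem measurableSet_Ioo] with u h1 h2 hu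
    have h3 := E.sW_ne j (Ioo_subset_Icc_self hu)
    change conj (E.mkH _ _ j u) * (E.mkH _ _ j u) = _
    rw [h1, h2]
    simp only [hk0, conj_conj, embf]
    field_simp
  set H : Submodule ℂ E.HS := (LinearMap.range E.emb).topologicalClosure with hH
  set k := H.starProjection K0 with hk
  have hkH : k ∈ H := H.starProjection_apply_mem K0
  have hemb : ∀ P, E.emb P ∈ H := fun P => (LinearMap.range E.emb).le_topologicalClosure ⟨P, rfl⟩
  have hkP : ∀ P, inner ℂ k (E.emb P) = P.eval ζ := fun P => by
    rw [← hK0P P, ← sub_eq_zero, ← inner_sub_left, ← neg_eq_zero, ← inner_neg_left, neg_sub]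
    exact H.starProjection_inner_eq_zero K0 _ (hemb P)
  have hkn := H.norm_starProjection_apply_le K0
  have hinvW := fun j => (E.sW_cont j).inv₀ fun u hu => E.sW_ne j hu
  have key : ∀ P : PC, ‖k - E.emb P‖ ^ 2 = ∑ j, ∫ u, E.Wt j u * ‖k j u * (E.sW j u)⁻¹ - P.eval (E.τ j u)‖ ^ 2 ∂m01 := fun P => by
    rw [HS_norm]
    refine sum_congr rfl fun j _ => integral_congr_ae ?_
    filter_upwards [Lp.coeFn_sub (k j) (E.emb P j), E.mkH_coe _ (E.embf_mem P) j, ae_restrict_mem measurableSet_Ioo] with u h1 h2 hu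
    have h3 := E.sW_ne j (Ioo_subset_Icc_self hu)
    have h1' : ((k - E.emb P) j : ℝ → ℂ) u = k j u - E.emb P j u := h1
    have h2' : (E.emb P j : ℝ → ℂ) u = E.embf P j u := h2
    rw [h1', h2', ← E.sW_norm, ← mul_pow, ← norm_mul, embf]
    field_simp
  refine ⟨fun j u => k j u * (E.sW j u)⁻¹, fun j => memLp_mul01 (Lp.memLp _) (hinvW j), fun P => ?_, ?_, fun ε hε => ?_⟩
  · rw [← hkP P, HS_inner]
    refine sum_congr rfl fun j _ => integral_congr_ae ?_
    filter_upwards [E.mkH_coe _ (E.embf_mem P) j, ae_restrict_mem measurableSet_Ioo] with u h2 hu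
    have h2' : (E.emb P j : ℝ → ℂ) u = E.embf P j u := h2
    rw [h2', map_mul, map_inv₀, sW_conj, ← E.sW_sq, embf]; field_simp
  · have h0 := key 0
    simp only [map_zero, sub_zero, Polynomial.eval_zero] at h0
    rw [← h0]
    calc ‖k‖ ^ 2 ≤ ‖K0‖ ^ 2 := by gcongr
      _ = ∑ j, ∫ u, ‖K0 j u‖ ^ 2 ∂m01 := E.HS_norm K0
      _ ≤ ∑ j, |B j| / d ^ 2 := by
        refine sum_le_sum fun j _ => ?_
        have : ∫ u, ‖K0 j u‖ ^ 2 ∂m01 ≤ ∫ u, |B j| / d ^ 2 ∂m01 := by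
          refine integral_mono_of_nonneg (ae_of_all _ fun _ => by positivity) (integrable_const _) ?_
          filter_upwards [E.mkH_coe k0 (fun j => (hk0c j).memLp01) j, ae_restrict_mem measurableSet_Ioo] with u h1 hu
          have hu' := Ioo_subset_Icc_self hu
          have h5 := hdist ζ hζ j u hu'
          have h6 := hB j u hu'
          have h7 := E.sW_norm j u
          rw [h1, hk0]
          simp only [RCLike.norm_conj, norm_mul, norm_div, norm_inv, sg_norm, one_mul, norm_I, mul_one]
          have h9 : ‖deriv (E.τ j) u‖ = ‖E.sW j u‖ ^ 2 := h7.symm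
          rw [h9]
          have hpi3 := Real.pi_gt_three
          have e : ‖E.sW j u‖ ^ 2 / (‖E.sW j u‖ * (‖(2:ℂ)‖ * ‖(π:ℂ)‖)) * ‖E.τ j u - ζ‖⁻¹ = ‖E.sW j u‖ * (1 / (2 * π)) * ‖E.τ j u - ζ‖⁻¹ := by
            have : ‖(π:ℂ)‖ = π := by simp [abs_of_pos Real.pi_pos]
            rw [this, Complex.norm_two]
            field_simp
          rw [e, mul_pow, mul_pow, h7, div_eq_mul_inv |B j|, ← inv_pow]
          have h10 : (1 / (2 * π)) ^ 2 ≤ 1 := pow_le_one₀ (by positivity) (by rw [div_le_one (by positivity)]; linarith)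
          have h11 : E.Wt j u * (1 / (2 * π)) ^ 2 ≤ |B j| * 1 := mul_le_mul (h6.trans (le_abs_self _)) h10 (by positivity) (abs_nonneg _)
          rw [mul_one] at h11
          gcongr
        simpa using this
      _ ≤ _ := by linarith
  · have := hkH
    obtain ⟨_, ⟨P, rfl⟩, hP⟩ := Metric.mem_closure_iff.1 this (rsq ε) (Real.sqrt_pos.2 hε)
    refine ⟨P, ?_⟩
    rw [← key P]
    rw [dist_eq_norm] at hP
    calc _ ≤ rsq ε ^ 2 := by gcongr
      _ = ε := Real.sq_sqrt hε.le
end Geo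
theorem conj_pth (a v : ℝ) : conj (pth a v) = pth (-a) v := pth_conj a v
theorem exists_log {V : Set ℂ} (hV : IsOpen V) (hc : Convex ℝ V) {f : ℂ → ℂ} (hf : DifferentiableOn ℂ f V)
    (h0 : ∀ x ∈ V, f x ≠ 0) : ∃ l : ℂ → ℂ, DifferentiableOn ℂ l V ∧ ∀ x ∈ V, Complex.exp (l x) = f x := by
  rcases V.eq_empty_or_nonempty with rfl | ⟨x0, hx0⟩
  · grind
  obtain ⟨l, hl⟩ := hc.exists_forall_hasDerivWithinAt ((hf.deriv hV).div hf h0)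
  have hl' : ∀ x ∈ V, HasDerivAt l (deriv f x / f x) x := fun x hx => (hl x hx).hasDerivAt (hV.mem_nhds hx)
  have hd : ∀ x ∈ V, HasDerivAt (fun x => f x * exp (-l x)) 0 x := fun x hx => by
    refine ((((hf x hx).differentiableAt (hV.mem_nhds hx)).hasDerivAt).fun_mul (hl' x hx).fun_neg.cexp).congr_deriv ?_
    grind
  obtain ⟨c, hcc⟩ := hV.exists_is_const_of_deriv_eq_zero hc.isPreconnected (fun x hx => (hd x hx).differentiableAt.differentiableWithinAt)
    (fun x hx => (hd x hx).deriv)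
  have hc0 : c ≠ 0 := by rw [← hcc x0 hx0]; exact mul_ne_zero (h0 _ hx0) (exp_ne_zero _)
  refine ⟨fun x => l x + log c, fun x hx => ((hl' x hx).add_const _).differentiableAt.differentiableWithinAt, fun x hx => ?_⟩
  rw [exp_add, exp_log hc0, ← hcc x hx, Complex.exp_neg]
  field_simp
theorem DifferentiableOn.sharp {V : Set ℂ} (hV : IsOpen V) (hc : ∀ x ∈ V, conj x ∈ V) {f : ℂ → ℂ} (hf : DifferentiableOn ℂ f V) :
    DifferentiableOn ℂ (fun x => conj (f (conj x))) V := fun x hx => by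
  have h1 := (hf _ (hc x hx)).differentiableAt (hV.mem_nhds (hc x hx))
  have := h1.conj_conj
  simp only [conj_conj] at this
  exact this.differentiableWithinAt
namespace Geo
variable {G F : Set ℂ} (E : Geo G F)
theorem exists_A (j : Fin E.M) : ∃ A : ℂ → ℂ, DifferentiableOn ℂ A E.V ∧ ∀ u ∈ UI, A u = E.Wt j u := by
  obtain ⟨l, hl, he⟩ := exists_log E.V_open E.V_convex (E.diff_deriv j) (fun x hx => E.deriv_ne j hx)
  refine ⟨fun x => exp ((l x + conj (l (conj x))) / 2), ?_, fun u hu => ?_⟩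
  · exact ((hl.add (hl.sharp E.V_open E.V_conj)).div_const 2).cexp
  · change exp ((l u + conj (l (conj u))) / 2) = _
    rw [Wt, ← he u (E.seg_mem j hu), norm_exp, conj_ofReal, add_conj]
    push_cast; ring
def AA (j : Fin E.M) : ℂ → ℂ := (E.exists_A j).choose
theorem AA_diff (j : Fin E.M) : DifferentiableOn ℂ (E.AA j) E.V := (E.exists_A j).choose_spec.1
theorem AA_eq (j : Fin E.M) {u : ℝ} (hu : u ∈ UI) : E.AA j u = E.Wt j u := (E.exists_A j).choose_spec.2 u hu
structure RK (ζ : ℂ) (kk : Fin E.M → ℝ → ℂ) : Prop where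
  mem : ζ ∈ F
  lp : ∀ j, MemLp (kk j) 2 m01
  rep : ∀ P : PC, ∑ j, ∫ u, E.Wt j u * conj (kk j u) * P.eval (E.τ j u) ∂m01 = P.eval ζ
  app : ∀ ε > 0, ∃ P : PC, ∑ j, ∫ u, E.Wt j u * ‖kk j u - P.eval (E.τ j u)‖ ^ 2 ∂m01 ≤ ε
variable {E} {ζ : ℂ} {kk : Fin E.M → ℝ → ℂ}
theorem RK.limit (h : E.RK ζ kk) {b : Fin E.M → ℝ → ℂ} (hb : ∀ j, MemLp (b j) 2 m01)
    (h0 : ∀ P : PC, ∑ j, ∫ u, P.eval (E.τ j u) * b j u ∂m01 = 0) :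
    ∑ j, ∫ u, kk j u * b j u ∂m01 = 0 := by
  obtain ⟨c, hc, hcW⟩ : ∃ c > 0, ∀ j, ∀ u ∈ UI, c ≤ E.Wt j u := by
    have : ∀ j, ∃ c > 0, ∀ u ∈ UI, c ≤ E.Wt j u := fun j => by
      obtain ⟨u, hu, hm⟩ := isCompact_Icc.exists_isMinOn (nonempty_Icc.2 zero_le_one) (E.Wt_cont j)
      exact ⟨_, E.Wt_pos j hu, hm⟩
    choose c hc h using this
    obtain ⟨c0, h0, h1⟩ : ∃ c0 > 0, ∀ j, c0 ≤ c j := by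
      haveI : Nonempty (Fin E.M) := ⟨E.j0⟩
      obtain ⟨j, hj⟩ := Finite.exists_min c
      grind
    grind
  set B : ℝ := ∑ j, rsq (∫ u, ‖b j u‖ ^ 2 ∂m01) with hB
  refine norm_eq_zero.1 (le_antisymm (le_of_forall_pos_le_add fun ε hε => ?_) (norm_nonneg _))
  obtain ⟨P, hP⟩ := h.app (c * (ε / (B + 1)) ^ 2) (by positivity)
  have hm := fun j => (h.lp j).sub (E.poly_cont P j).memLp01
  have e : ∑ j, ∫ u, kk j u * b j u ∂m01 = ∑ j, ∫ u, (kk j u - P.eval (E.τ j u)) * b j u ∂m01 := by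
    rw [← sub_zero (∑ j, ∫ u, kk j u * b j u ∂m01), ← h0 P, ← sum_sub_distrib]
    refine sum_congr rfl fun j _ => ?_
    have i1 : Integrable (fun u => kk j u * b j u) m01 := (h.lp j).integrable_mul (hb j)
    have i2 : Integrable (fun u : ℝ => P.eval (E.τ j u) * b j u) m01 := (E.poly_cont P j).memLp01.integrable_mul (hb j)
    rw [← integral_sub i1 i2]
    grind
  have h2 : ∀ j, Integrable (fun u => E.Wt j u * ‖kk j u - P.eval (E.τ j u)‖ ^ 2) m01 := fun j => by
    have h3 := (hm j).integrable_norm_pow (by norm_num)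
    obtain ⟨C, hC⟩ := isCompact_Icc.exists_bound_of_continuousOn (E.Wt_cont j)
    refine h3.bdd_mul (c := C) (((E.Wt_cont j).mono Ioo_subset_Icc_self).aestronglyMeasurable measurableSet_Ioo) ?_
    filter_upwards [ae_restrict_mem measurableSet_Ioo] with u hu using hC u (Ioo_subset_Icc_self hu)
  have h1 : ∀ j, rsq (∫ u, ‖kk j u - P.eval (E.τ j u)‖ ^ 2 ∂m01) ≤ ε / (B + 1) := fun j => by
    rw [Real.sqrt_le_left (by positivity)]
    have h4 : c * ∫ u, ‖kk j u - P.eval (E.τ j u)‖ ^ 2 ∂m01 ≤ ∫ u, E.Wt j u * ‖kk j u - P.eval (E.τ j u)‖ ^ 2 ∂m01 := by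
      rw [← integral_const_mul]
      refine setIntegral_mono_on (((hm j).integrable_norm_pow (by norm_num)).const_mul _) (h2 j) measurableSet_Ioo fun u hu => ?_
      gcongr
      grind
    exact le_of_mul_le_mul_left (h4.trans ((single_le_sum (f := fun j => ∫ u, E.Wt j u * ‖kk j u - P.eval (E.τ j u)‖ ^ 2 ∂m01) (fun j _ => integral_nonneg fun u => mul_nonneg (E.Wt_nonneg j u) (by positivity)) (mem_univ j)).trans hP)) hc
  rw [e, zero_add]
  calc ‖∑ j, ∫ u, (kk j u - P.eval (E.τ j u)) * b j u ∂m01‖ ≤ ∑ j, (ε / (B + 1)) * rsq (∫ u, ‖b j u‖ ^ 2 ∂m01) := by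
        refine (norm_sum_le _ _).trans (sum_le_sum fun j _ => ?_)
        refine (norm_integral_le_integral_norm _).trans ?_
        simp only [norm_mul]
        refine (cs (hm j) (hb j)).trans ?_
        gcongr
        exact h1 j
    _ = ε / (B + 1) * B := by rw [← mul_sum]
    _ ≤ ε := by
        rw [div_mul_eq_mul_div, div_le_iff₀ (by positivity)]
        nlinarith
def gN (E : Geo G F) (kk : Fin E.M → ℝ → ℂ) (j : Fin E.M) (u : ℝ) : ℂ := E.Wt j u * conj (kk j u)
def NN (E : Geo G F) (kk : Fin E.M → ℝ → ℂ) (ζ w : ℂ) : ℂ := E.Phi (E.gN kk) w + (w - ζ)⁻¹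
def kt (E : Geo G F) (kk : Fin E.M → ℝ → ℂ) (j : Fin E.M) (u : ℝ) : ℂ := kk j u * deriv (E.τ j) u
def tE (E : Geo G F) (j : Fin E.M) (v : ℝ) : ℂ := E.τ j (pth (-E.a j) v)
def tG (E : Geo G F) (j : Fin E.M) (v : ℝ) : ℂ := E.τ j (pth (E.a j) v)
def rho (E : Geo G F) (kk : Fin E.M → ℝ → ℂ) (ζ : ℂ) (j : Fin E.M) (v : ℝ) : ℂ :=
  conj ((E.sg * (2 * π * I))⁻¹ * (E.AA j (pth (E.a j) v) * E.NN kk ζ (E.tG j v) * pthd (E.a j) v))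
theorem conj_memLp {f : ℝ → ℂ} (hf : MemLp f 2 m01) : MemLp (fun u => conj (f u)) 2 m01 := hf.star
theorem RK.gN_lp (h : E.RK ζ kk) (j : Fin E.M) : MemLp (E.gN kk j) 2 m01 := by
  refine (memLp_mul01 (conj_memLp (h.lp j)) (continuous_ofReal.comp_continuousOn (E.Wt_cont j))).ae_eq (ae_of_all _ fun u => ?_)
  simp [gN, mul_comm]
theorem RK.kt_lp (h : E.RK ζ kk) (j : Fin E.M) : MemLp (E.kt kk j) 2 m01 := memLp_mul01 (h.lp j) (E.cont_deriv j)
theorem RK.inG (h : E.RK ζ kk) : ζ ∈ G := E.F_sub h.mem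
theorem RK.Phi_gN_Y (h : E.RK ζ kk) {w : ℂ} (hw : w ∈ Yset G) : E.Phi (E.gN kk) w = -(w - ζ)⁻¹ := by
  have := E.polyfun (fun j => MemLp.int01 (h.gN_lp j)) (subset_closure h.inG) (c := 1) (fun P => by simpa [gN] using h.rep P) (PAsub hw)
  simp only [Edges.Phi]
  grind
theorem RK.kt_Y (h : E.RK ζ kk) {w : ℂ} (hw : w ∈ Yset G) : E.Phi (E.kt kk) w = 0 := by
  have := h.limit (b := fun j u => deriv (E.τ j) u * (E.τ j u - w)⁻¹)
    (fun j => ((E.cont_deriv j).mul (E.inv_cont j (fun hh => hw.1 (frontier_subset_closure hh)))).memLp01) fun P => by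
      rw [← E.tele_PA ((PA.poly P).mul E.K_compact (PAsub hw))]
      grind
  rw [← this]
  refine sum_congr rfl fun j _ => ?_
  congr 1; funext u; simp only [kt]; ring
theorem sgpi_ne : E.sg * (2 * π * I) ≠ 0 := mul_ne_zero E.sg_ne (by simp)
theorem RK.stepA (h : E.RK ζ kk) {w : ℂ} (hw : ∀ j, ∀ x ∈ Th (E.a j), E.τ j x ≠ w) :
    E.Phi (E.kt kk) w = ∑ j, ∫ v, E.rho kk ζ j v / (E.tE j v - w) ∂m01 := by
  have key : ∀ j, ∫ u, E.kt kk j u / (E.τ j u - w) ∂m01 = ∫ v, E.rho kk ζ j v / (E.tE j v - w) ∂m01 := by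
    intro j
    have hVW : IsOpen (E.V ∩ {x | E.τ j x ≠ w ∧ E.τ j x ≠ ζ}) :=
      (E.diff j).continuousOn.isOpen_inter_preimage E.V_open (isOpen_compl_singleton.inter isOpen_compl_singleton)
    set W : Set ℂ := (E.V ∩ {x | E.τ j x ≠ w ∧ E.τ j x ≠ ζ}) ∩ (conj ⁻¹' (E.V ∩ {x | E.τ j x ≠ w ∧ E.τ j x ≠ ζ})) with hWdef
    have hW := hVW.inter (hVW.preimage continuous_conj)
    have hsub : ∀ x ∈ Th (E.a j), x ∈ E.V ∩ {x | E.τ j x ≠ w ∧ E.τ j x ≠ ζ} := fun x hx =>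
      ⟨E.Th_sub j hx, hw j x hx, fun hh => E.avoid j x hx (hh ▸ h.mem)⟩
    have hTW : Th (E.a j) ⊆ W := fun x hx => ⟨hsub x hx, hsub _ (Th_conj hx)⟩
    set ψ : ℂ → ℂ := fun x => E.AA j x / (conj (E.τ j (conj x)) - conj w) with hψd
    have hψ : DifferentiableOn ℂ ψ W := by
      refine ((E.AA_diff j).mono fun x hx => hx.1.1).div ((((E.diff j).sharp E.V_open E.V_conj).mono fun x hx => hx.1.1).sub_const _) fun x hx hh => ?_
      exact hx.2.2.1 (star_injective (sub_eq_zero.1 hh))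
    have t1 := E.trick h.gN_lp j hW hTW hψ
    have hφ : DifferentiableOn ℂ (fun x => ψ x * (E.τ j x - ζ)⁻¹) W :=
      hψ.mul ((((E.diff j).mono fun x hx => hx.1.1).sub_const _).inv fun x hx => sub_ne_zero.2 hx.1.2.2)
    have e1 : ∫ v, ψ (pth (-E.a j) v) * E.Phi (E.gN kk) (E.τ j (pth (-E.a j) v)) * pthd (-E.a j) v ∂m01 =
        - ∫ v, ψ (pth (E.a j) v) * (E.τ j (pth (E.a j) v) - ζ)⁻¹ * pthd (E.a j) v ∂m01 := by
      rw [cauchy_Th hW hTW hφ, ← integral_neg]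
      refine setIntegral_congr_fun measurableSet_Ioo fun v hv => ?_
      rw [h.Phi_gN_Y (E.inY j v hv)]; ring
    have i2 : Integrable (fun v => ψ (pth (E.a j) v) * (E.τ j (pth (E.a j) v) - ζ)⁻¹ * pthd (E.a j) v) m01 := by
      refine ContinuousOn.int01 (ContinuousOn.mul ?_ (pthd_continuous _).continuousOn)
      exact (hφ.continuousOn.mono hTW).comp (pth_continuous _).continuousOn fun v hv => pth_mem _ hv
    rw [e1, sub_neg_eq_add, ← integral_add ((E.Phi_path h.gN_lp j (Or.inl rfl) (hψ.continuousOn.mono hTW)).1) i2, E.sg_eq j] at t1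
    have t3 : conj (∫ u, E.kt kk j u / (E.τ j u - w) ∂m01) = ∫ u : ℝ, E.gN kk j u * (ψ u / deriv (E.τ j) u) ∂m01 := by
      rw [← integral_conj]
      refine setIntegral_congr_fun measurableSet_Ioo fun u hu => ?_
      have hu' := Ioo_subset_Icc_self hu
      have hd := E.deriv_ne j (E.seg_mem j hu')
      have hW2 : (E.Wt j u : ℂ) * E.Wt j u = deriv (E.τ j) u * conj (deriv (E.τ j) u) := by
        rw [mul_conj, normSq_eq_norm_sq]; simp [Wt, sq]
      simp only [kt, gN, hψd, map_div₀, map_mul, map_sub, conj_ofReal, E.AA_eq j hu']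
      have hW3 : conj (deriv (E.τ j) u) = E.Wt j u * E.Wt j u * (deriv (E.τ j) u)⁻¹ := by
        rw [hW2]; field_simp
      rw [hW3]; ring
    rw [← t3] at t1
    apply star_injective
    change conj _ = conj _
    rw [(eq_inv_mul_iff_mul_eq₀ sgpi_ne).2 t1.symm, ← integral_const_mul, ← integral_conj]
    congr 1; funext v
    simp only [rho, NN, tE, tG, hψd, map_div₀, conj_conj, map_sub, pth_conj]
    ring
  exact sum_congr rfl fun j _ => key j
end Geo
theorem meets_frontier {G S : Set ℂ} (hG : IsOpen G) (hS : IsPreconnected S) {x y : ℂ} (hx : x ∈ S) (hxG : x ∈ G)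
    (hy : y ∈ S) (hyG : y ∉ G) : ∃ z ∈ S, z ∈ frontier G := by
  by_contra hcon
  push Not at hcon
  have hsub : S ⊆ G ∪ (closure G)ᶜ := fun z hz => by
    by_cases h : z ∈ closure G
    · have := hcon z hz
      rw [hG.frontier_eq] at this
      grind
    · grind
  obtain ⟨z, -, hz, hz'⟩ := hS G _ hG isClosed_closure.isOpen_compl hsub ⟨x, hx, hxG⟩ ⟨y, hy, (hsub hy).resolve_left hyG⟩
  exact hz' (subset_closure hz)
theorem seg_frontier {G : Set ℂ} (hG : IsOpen G) {x y : ℂ} (hxG : x ∈ G) (hyG : y ∉ G) :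
    ∃ z ∈ frontier G, ‖z - y‖ ≤ ‖x - y‖ ∧ ‖z - x‖ ≤ ‖x - y‖ := by
  obtain ⟨z, hz, hzf⟩ := meets_frontier hG (convex_segment x y).isPreconnected (left_mem_segment ℝ x y) hxG (right_mem_segment ℝ x y) hyG
  refine ⟨z, hzf, ?_, ?_⟩
  · have := norm_sub_le_of_mem_segment (segment_symm ℝ x y ▸ hz); rwa [norm_sub_rev z] at *
  · have := norm_sub_le_of_mem_segment hz; rw [norm_sub_rev y] at this; exact this
namespace Geo
variable {G F : Set ℂ} {E : Geo G F} {ζ : ℂ} {kk : Fin E.M → ℝ → ℂ}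
theorem tE_contOn (j : Fin E.M) : ContinuousOn (E.tE j) (Icc 0 1) :=
  (E.diff j).continuousOn.comp (pth_continuous _).continuousOn fun v hv => E.Th_sub j (Th_neg (E.a j) ▸ pth_mem _ hv)
theorem tG_contOn (j : Fin E.M) : ContinuousOn (E.tG j) (Icc 0 1) :=
  (E.diff j).continuousOn.comp (pth_continuous _).continuousOn fun v hv => E.Th_sub j (pth_mem _ hv)
theorem tE_notK (j : Fin E.M) {v : ℝ} (hv : v ∈ UO) : E.tE j v ∉ closure G := (E.inY j v hv).1
theorem tE_dist (i : Fin E.M) {v : ℝ} (hv : v ∈ UO) {z : ℂ} (hz : z ∈ closure G) : E.cd * (v * (1 - v)) ≤ ‖z - E.tE i v‖ := by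
  have hfr : ∀ z ∈ frontier G, E.cd * (v * (1 - v)) ≤ ‖z - E.tE i v‖ := fun z hz => by
    rw [E.hL] at hz
    obtain ⟨j, u, hu, rfl⟩ := mem_iUnion.1 hz
    exact E.dist j i u hu v hv _ (Or.inr rfl)
  by_cases hzG : z ∈ G
  · obtain ⟨y, hy, h1, -⟩ := seg_frontier E.G_open hzG fun h => tE_notK i hv (subset_closure h)
    grind
  · exact hfr z (by rw [E.G_open.frontier_eq]; exact ⟨hz, hzG⟩)
def NI (E : Geo G F) (kk : Fin E.M → ℝ → ℂ) (ζ : ℂ) : Prop :=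
  ∀ j, Integrable (fun v => E.NN kk ζ (E.tG j v) * (((rsq (v * (1 - v)))⁻¹ : ℝ) : ℂ)) m01
theorem NI.rho (h : E.NI kk ζ) (j : Fin E.M) : Integrable (fun v => E.rho kk ζ j v * (((rsq (v * (1 - v)))⁻¹ : ℝ) : ℂ)) m01 := by
  have hc : ContinuousOn (fun v => (E.sg * (2 * π * I))⁻¹ * (E.AA j (pth (E.a j) v) * pthd (E.a j) v)) (Icc 0 1) :=
    continuousOn_const.mul (((E.AA_diff j).continuousOn.comp (pth_continuous _).continuousOn fun v hv => E.Th_sub j (pth_mem _ hv)).mul (pthd_continuous _).continuousOn)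
  have h1 : Integrable (fun v => conj (_ * _)) m01 := (conjCLE : ℂ →L[ℝ] ℂ).integrable_comp (int_mul01 (h j) hc)
  refine h1.congr (ae_of_all _ fun v => ?_)
  simp only [Geo.rho, map_mul, conj_ofReal]
  ring
theorem NI.rho_int (h : E.NI kk ζ) (j : Fin E.M) : Integrable (E.rho kk ζ j) m01 := by
  refine (int_mul01 (h.rho j) (g := fun v => ((rsq (v * (1 - v)) : ℝ) : ℂ)) (by fun_prop)).congr ?_
  filter_upwards [ae_restrict_mem measurableSet_Ioo] with v hv
  have h1 := hv.1
  have h2 : 0 < 1 - v := by grind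
  have : rsq (v * (1 - v)) ≠ 0 := (Real.sqrt_pos.2 (by positivity)).ne'
  rw [mul_assoc, ← ofReal_mul, inv_mul_cancel₀ this]; simp
theorem RK.stepB (h : E.RK ζ kk) (hN : E.NI kk ζ) {w : ℂ} (hw : w ∈ G) :
    E.Phi (E.kt kk) w = ∑ j, ∫ v, E.rho kk ζ j v / (E.tE j v - w) ∂m01 := by
  have h1 : AnalyticOnNhd ℂ (E.Phi (E.kt kk)) G := by
    refine DifferentiableOn.analyticOnNhd (fun x hx => ?_) E.G_open
    exact (E.Phi_hasDeriv (fun i => MemLp.int01 (h.kt_lp i)) (E.not_front hx)).differentiableAt.differentiableWithinAt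
  have h2 : AnalyticOnNhd ℂ (fun w => ∑ j, ∫ v, E.rho kk ζ j v / (E.tE j v - w) ∂m01) G := by
    refine DifferentiableOn.analyticOnNhd (fun x hx => ?_) E.G_open
    refine (HasDerivAt.fun_sum fun i _ => cauchy_holo (hN.rho_int i)
      (((tE_contOn i).mono Ioo_subset_Icc_self).aestronglyMeasurable measurableSet_Ioo)
      (E.G_open.isClosed_compl) (by
      filter_upwards [ae_restrict_mem measurableSet_Ioo] with u hu using fun hh => tE_notK i hu (subset_closure hh)) (fun hh => hh hx)).differentiableAt.differentiableWithinAt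
  refine h1.eqOn_of_preconnected_of_eventuallyEq h2 E.G_conn h.inG ?_ hw
  have hz : ζ ∈ (⋃ j, E.τ j '' Th (E.a j))ᶜ := fun hh => by
    obtain ⟨j, x, hx, he⟩ := mem_iUnion.1 hh
    exact E.avoid j x hx (he ▸ h.mem)
  filter_upwards [(isClosed_iUnion_of_finite fun j => ((Th_compact _).image_of_continuousOn ((E.diff j).continuousOn.mono (E.Th_sub j))).isClosed).isOpen_compl.mem_nhds hz] with w hw
  exact h.stepA fun j x hx he => hw (mem_iUnion.2 ⟨j, x, hx, he⟩)
theorem PA_cauchy {f : ℂ → ℂ} (hf : PA (closure G) f) {w : ℂ} (hw : w ∈ G) :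
    E.Phi (fun j u => f (E.τ j u) * deriv (E.τ j) u) w = E.sg * (2 * π * I) * f w := by
  have := E.polyfun (H := fun j u => deriv (E.τ j) u * (E.τ j u - w)⁻¹) (fun j => ((E.cont_deriv j).mul (E.inv_cont j (E.not_front hw))).int01)
    (subset_closure hw) (fun P => by
      rw [← E.cauchy_poly hw P]
      refine sum_congr rfl fun j _ => ?_
      congr 1; funext u; ring) hf
  rw [← this]
  refine sum_congr rfl fun j _ => ?_
  grind
theorem PA_Y {f : ℂ → ℂ} (hf : PA (closure G) f) {w : ℂ} (hw : w ∈ Yset G) :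
    E.Phi (fun j u => f (E.τ j u) * deriv (E.τ j) u) w = 0 := by
  rw [← E.tele_PA (hf.mul E.K_compact (PAsub hw))]
  refine sum_congr rfl fun j _ => ?_
  grind
def HH (E : Geo G F) (q : PC) (t : ℂ) : ℂ := ∑ j, ∫ u, E.Wt j u * conj (q.eval (E.τ j u)) / (t - E.τ j u) ∂m01
theorem stepD (q : PC) (j : Fin E.M) {f : Fin E.M → ℝ → ℂ} (hf : ∀ i, MemLp (f i) 2 m01)
    (hY : ∀ w ∈ Yset G, E.Phi (fun i u => f i u * deriv (E.τ i) u) w = 0) :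
    E.sg * (2 * π * I) * ∫ u, f j u * (E.Wt j u * conj (q.eval (E.τ j u))) ∂m01 =
    ∫ v, (E.AA j (pth (E.a j) v) * conj (q.eval (E.tE j v))) * E.Phi (fun i u => f i u * deriv (E.τ i) u) (E.tG j v) * pthd (E.a j) v ∂m01 := by
  have hψ : DifferentiableOn ℂ (fun x => E.AA j x * conj (q.eval (E.τ j (conj x)))) E.V :=
    (E.AA_diff j).mul (DifferentiableOn.sharp E.V_open E.V_conj (q.differentiable.comp_differentiableOn (E.diff j)))
  have := E.trick (fun i => memLp_mul01 (hf i) (E.cont_deriv i)) j E.V_open (E.Th_sub j) hψ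
  have e2 : ∫ v, (fun x => E.AA j x * conj (q.eval (E.τ j (conj x)))) (pth (-E.a j) v) * E.Phi (fun i u => f i u * deriv (E.τ i) u) (E.τ j (pth (-E.a j) v)) * pthd (-E.a j) v ∂m01 = 0 :=
    setIntegral_eq_zero_of_forall_eq_zero fun v hv => by rw [hY _ (E.inY j v hv)]; ring
  rw [e2, sub_zero, E.sg_eq j] at this
  have e3 : ∫ u, f j u * (E.Wt j u * conj (q.eval (E.τ j u))) ∂m01 = ∫ u : ℝ, f j u * deriv (E.τ j) u * ((fun x => E.AA j x * conj (q.eval (E.τ j (conj x)))) u / deriv (E.τ j) u) ∂m01 := by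
    refine setIntegral_congr_fun measurableSet_Ioo fun u hu => ?_
    have hu' := Ioo_subset_Icc_self hu
    have hd := E.deriv_ne j (E.seg_mem j hu')
    simp only [conj_ofReal, E.AA_eq j hu']
    field_simp
  rw [e3, ← this]
  simp only [pth_conj, tE, tG]
theorem tG_kernel (E : Geo G F) (j : Fin E.M) : ∃ C > 0, ∀ (w : ℂ) (d : ℝ), 0 < d → (∀ u ∈ UI, d ≤ ‖E.tG j u - w‖) →
      ∫ u, ‖(E.tG j u - w)⁻¹‖ ^ 2 ∂m01 ≤ C / d := by
  obtain ⟨c, hc, h⟩ := bilip E.V_open (E.diff j) (E.inj j) (Th_compact (E.a j)) (E.Th_sub j)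
  refine kernel_bound (tG_contOn j) hc fun x hx y hy => le_trans ?_ (h _ (pth_mem _ hx) _ (pth_mem _ hy))
  gcongr
  simpa using abs_re_le_norm (pth (E.a j) x - pth (E.a j) y)
theorem tG_K (j : Fin E.M) {u : ℝ} (hu : u ∈ UI) : E.tG j u ∈ closure G := by
  rcases eq_or_lt_of_le hu.1 with rfl | h1
  · have := E.seg_K j hu; simpa [tG] using this
  rcases eq_or_lt_of_le hu.2 with rfl | h2
  · have := E.seg_K j hu; simpa [tG] using this
  exact subset_closure (E.inG j u ⟨h1, h2⟩)
theorem stepE_int (hN : E.NI kk ζ) {B : ℝ → ℂ} (hB : ContinuousOn B (Icc 0 1)) (i j : Fin E.M) :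
    Integrable (fun q : ℝ × ℝ => E.rho kk ζ i q.1 * (B q.2 / (E.tE i q.1 - E.tG j q.2))) (m01.prod m01) := by
  obtain ⟨C, hC, hk⟩ := E.tG_kernel j
  have hd : ∀ v ∈ UO, 0 < E.cd * (v * (1 - v)) := fun v hv =>
    mul_pos E.cd_pos (mul_pos hv.1 (by grind))
  have hdd : ∀ v ∈ UO, ∀ u ∈ UI, E.cd * (v * (1 - v)) ≤ ‖E.tG j u - E.tE i v‖ := fun v hv u hu =>
    tE_dist i hv (tG_K j hu)
  have hne : ∀ v ∈ UO, ∀ u ∈ UI, E.tE i v - E.tG j u ≠ 0 := fun v hv u hu => by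
    rw [← norm_pos_iff, norm_sub_rev]
    grind
  have hmeas : AEStronglyMeasurable (fun q : ℝ × ℝ => E.rho kk ζ i q.1 * (B q.2 / (E.tE i q.1 - E.tG j q.2))) (m01.prod m01) := by
    refine AEStronglyMeasurable.mul (hN.rho_int i).1.comp_fst ?_
    rw [Measure.prod_restrict]
    refine ContinuousOn.aestronglyMeasurable ?_ (measurableSet_Ioo.prod measurableSet_Ioo)
    refine ContinuousOn.div (hB.comp continuousOn_snd fun q hq => Ioo_subset_Icc_self hq.2) (ContinuousOn.sub ?_ ?_) fun q hq => hne _ hq.1 _ (Ioo_subset_Icc_self hq.2)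
    · exact (tE_contOn i).comp continuousOn_fst fun q hq => Ioo_subset_Icc_self hq.1
    · exact (tG_contOn j).comp continuousOn_snd fun q hq => Ioo_subset_Icc_self hq.2
  have hinv : ∀ v ∈ UO, ContinuousOn (fun u => (E.tG j u - E.tE i v)⁻¹) (Icc 0 1) := fun v hv =>
    ((tG_contOn j).sub continuousOn_const).inv₀ fun u hu hh => hne v hv u hu (by simpa [sub_eq_zero, eq_comm] using hh)
  rw [integrable_prod_iff hmeas]
  constructor
  · filter_upwards [ae_restrict_mem measurableSet_Ioo] with v hv
    refine (ContinuousOn.int01 (hB.div (continuousOn_const.sub (tG_contOn j)) fun u hu => hne v hv u hu)).const_mul _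
  · refine Integrable.mono' ((hN.rho i).norm.mul_const (rsq (∫ u, ‖B u‖ ^ 2 ∂m01) * rsq (C / E.cd))) hmeas.norm.integral_prod_right' ?_
    filter_upwards [ae_restrict_mem measurableSet_Ioo] with v hv
    rw [Real.norm_of_nonneg (integral_nonneg fun _ => norm_nonneg _)]
    simp only [norm_mul (E.rho _ _ _ _)]
    rw [integral_const_mul]
    have h3 : rsq (C / (E.cd * (v * (1 - v)))) = rsq (C / E.cd) * (rsq (v * (1 - v)))⁻¹ := by
      rw [← div_div, Real.sqrt_div (by have := E.cd_pos; positivity), div_eq_mul_inv]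
    have h4 : ∫ u, ‖B u / (E.tE i v - E.tG j u)‖ ∂m01 ≤ rsq (∫ u, ‖B u‖ ^ 2 ∂m01) * (rsq (C / E.cd) * (rsq (v * (1 - v)))⁻¹) := by
      rw [← h3]
      refine le_trans (le_of_eq ?_) ((cs hB.memLp01 (hinv v hv).memLp01).trans (mul_le_mul_of_nonneg_left (Real.sqrt_le_sqrt (hk (E.tE i v) _ (hd v hv) (hdd v hv))) (Real.sqrt_nonneg _)))
      congr 1; funext u
      rw [norm_div, norm_inv, norm_sub_rev, div_eq_mul_inv]
    refine (mul_le_mul_of_nonneg_left h4 (norm_nonneg _)).trans (le_of_eq ?_)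
    rw [Complex.norm_real, Real.norm_of_nonneg (inv_nonneg.2 (Real.sqrt_nonneg _))]; ring
theorem RK.repr (h : E.RK ζ kk) (hN : E.NI kk ζ) (q : PC) :
    E.sg * (2 * π * I) * conj (q.eval ζ) = ∑ i, ∫ v, E.rho kk ζ i v * E.HH q (E.tE i v) ∂m01 := by
  set B : Fin E.M → ℝ → ℂ := fun j v => E.AA j (pth (E.a j) v) * conj (q.eval (E.tE j v)) * pthd (E.a j) v with hBd
  have hB : ∀ j, ContinuousOn (B j) (Icc 0 1) := fun j =>
    ((((E.AA_diff j).continuousOn.comp (pth_continuous _).continuousOn fun v hv => E.Th_sub j (pth_mem _ hv))).mul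
      (continuous_conj.comp_continuousOn (q.continuous.comp_continuousOn (tE_contOn j)))).mul (pthd_continuous _).continuousOn
  have hI := fun i j => stepE_int hN (hB j) i j
  have e1 : conj (q.eval ζ) = ∑ j, ∫ u, kk j u * (E.Wt j u * conj (q.eval (E.τ j u))) ∂m01 := by
    rw [← h.rep q, map_sum]
    refine sum_congr rfl fun j _ => ?_
    rw [← integral_conj]
    congr 1; funext u; simp; ring
  have e2 : ∀ j, E.sg * (2 * π * I) * ∫ u, kk j u * (E.Wt j u * conj (q.eval (E.τ j u))) ∂m01 =
      ∑ i, ∫ v, E.rho kk ζ i v * ∫ u, B j u / (E.tE i v - E.tG j u) ∂m01 ∂m01 := fun j => by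
    rw [stepD q j h.lp fun w hw => h.kt_Y hw]
    have : ∀ i, ∫ v, E.rho kk ζ i v * ∫ u, B j u / (E.tE i v - E.tG j u) ∂m01 ∂m01 =
        ∫ u, ∫ v, E.rho kk ζ i v * (B j u / (E.tE i v - E.tG j u)) ∂m01 ∂m01 := fun i => by
      rw [← integral_integral_swap (f := fun v u => E.rho kk ζ i v * (B j u / (E.tE i v - E.tG j u))) (hI i j)]
      simp only [integral_const_mul]
    simp only [this]
    rw [← integral_finsetSum _ fun i _ => (hI i j).integral_prod_right]
    refine setIntegral_congr_fun measurableSet_Ioo fun u hu => ?_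
    change _ * E.Phi (E.kt kk) (E.τ j (pth (E.a j) u)) * _ = _
    rw [h.stepB hN (E.inG j u hu), mul_sum, sum_mul]
    refine sum_congr rfl fun i _ => ?_
    rw [← integral_const_mul, ← integral_mul_const]
    congr 1; funext v; simp only [tG]; ring
  have e3 : ∀ i j, ∀ v ∈ UO, ∫ u, B j u / (E.tE i v - E.tG j u) ∂m01 =
      ∫ u, E.Wt j u * conj (q.eval (E.τ j u)) / (E.tE i v - E.τ j u) ∂m01 := fun i j v hv => by
    have hY := E.inY i v hv
    apply mul_left_cancel₀ (sgpi_ne)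
    have e4 : ∫ u, E.Wt j u * conj (q.eval (E.τ j u)) / (E.tE i v - E.τ j u) ∂m01 = ∫ u, (E.tE i v - E.τ j u)⁻¹ * (E.Wt j u * conj (q.eval (E.τ j u))) ∂m01 := by grind
    rw [e4, stepD q j (f := fun j u => (E.tE i v - E.τ j u)⁻¹) (fun j => (E.PA_cont hY.2 j).memLp01) (fun w hw => PA_Y hY.2 hw), ← integral_const_mul]
    refine setIntegral_congr_fun measurableSet_Ioo fun u hu => ?_
    change _ = _ * E.Phi (fun j u => (E.τ i (pth (-E.a i) v) - E.τ j u)⁻¹ * deriv (E.τ j) u) (E.τ j (pth (E.a j) u)) * _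
    rw [PA_cauchy (E := E) hY.2 (E.inG j u hu)]
    simp only [hBd, tG, tE]; ring
  rw [e1, mul_sum, sum_congr rfl fun j _ => e2 j, Finset.sum_comm]
  refine sum_congr rfl fun i _ => ?_
  have hI2 := fun j => by
    simpa only [integral_const_mul] using (hI i j).integral_prod_left
  rw [← integral_finsetSum _ fun j _ => hI2 j]
  refine setIntegral_congr_fun measurableSet_Ioo fun v hv => ?_
  simp only [HH]
  rw [mul_sum]
  exact sum_congr rfl fun j _ => by rw [e3 i j v hv]
end Geo
theorem abs_arg_conj (x : ℂ) : |arg (conj x)| = |arg x| := by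
  rw [arg_conj]; split_ifs with h <;> simp [h]
theorem abs_arg_add_le (x : ℂ) {r : ℝ} (hr : 0 ≤ r) : |arg (x + r)| ≤ |arg x| := by
  have key : ∀ x : ℂ, 0 < x.im → |arg (x + r)| ≤ |arg x| := fun x hx => by
    have hx2 : 0 < (x + r).im := by simpa
    have a1 := arg_nonneg_iff.2 hx.le
    rw [abs_of_nonneg a1, abs_of_nonneg (arg_nonneg_iff.2 hx2.le)]
    by_contra hlt
    have h0 : x ≠ 0 := fun h => by simp [h] at hx
    have h1 : x + r ≠ 0 := fun h => by simp [h] at hx2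
    have hs : 0 < rsin (arg (x + r) - arg x) := Real.sin_pos_of_pos_of_lt_pi (by linarith) (by
      have : arg x ≠ 0 := fun h => by
        have := (arg_eq_zero_iff.1 h).2; linarith
      have := lt_of_le_of_ne a1 this.symm
      linarith [arg_le_pi (x + r)])
    rw [Real.sin_sub, sin_arg, sin_arg, cos_arg h0, cos_arg h1] at hs
    have : (x + r).im / ‖x + r‖ * (x.re / ‖x‖) - (x + r).re / ‖x + r‖ * (x.im / ‖x‖) = -(r * x.im) / (‖x + r‖ * ‖x‖) := by
      simp; ring
    have : -(r * x.im) / (‖x + r‖ * ‖x‖) ≤ 0 := div_nonpos_of_nonpos_of_nonneg (by nlinarith) (by positivity)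
    linarith
  rcases lt_trichotomy x.im 0 with h | h | h
  · have := key (conj x) (by simpa using h)
    rwa [show conj x + r = conj (x + r) by simp, abs_arg_conj, abs_arg_conj] at this
  · have hx : x = x.re := by apply Complex.ext <;> simp [h]
    rw [hx, ← ofReal_add]
    rcases le_or_gt 0 (x.re + r) with h1 | h1
    · rw [arg_ofReal_of_nonneg h1]; simp
    · rw [arg_ofReal_of_neg h1, arg_ofReal_of_neg (by linarith)]
  · grind
theorem abs_arg_neg_of {X : ℂ} (hX : X ≠ 0) : |arg (-X)| = π - |arg X| := by
  rcases lt_trichotomy X.im 0 with h | h | h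
  · rw [arg_neg_eq_arg_add_pi_of_im_neg h, abs_of_nonpos (arg_neg_iff.2 h).le, abs_of_nonneg (by linarith [neg_pi_lt_arg X])]; ring
  · have hx : X = X.re := by apply Complex.ext <;> simp [h]
    have h0 : X.re ≠ 0 := fun h' => hX (by rw [hx, h']; simp)
    rw [hx, ← ofReal_neg]
    rcases lt_or_gt_of_ne h0 with h1 | h1
    · rw [arg_ofReal_of_nonneg (by linarith), arg_ofReal_of_neg h1, abs_of_pos Real.pi_pos]; simp
    · rw [arg_ofReal_of_neg (by linarith), arg_ofReal_of_nonneg h1.le, abs_of_pos Real.pi_pos]; simp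
  · rw [arg_neg_eq_arg_sub_pi_of_im_pos h, abs_of_nonneg (arg_nonneg_iff.2 h.le), abs_of_nonpos (by linarith [arg_le_pi X])]; ring
structure Corner (G : Set ℂ) (v z1 : ℂ) (lv : ℝ) : Prop where
  l0 : 0 < lv
  l2 : lv < 2
  vK : v ∈ frontier G
  z1Y : z1 ∈ Yset G
  lens : ∀ ξ : ℂ, ξ ≠ 0 → |arg ξ| ≤ lv * π / 2 → v + (z1 - v) * (ξ / (1 + ξ)) ∈ Yset G
namespace Corner
variable {G : Set ℂ} {v z1 : ℂ} {lv : ℝ}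
def X (v z1 z : ℂ) : ℂ := (z - v) / (z - z1)
theorem ne (h : Corner G v z1 lv) : z1 ≠ v := fun e => h.z1Y.1 (e ▸ frontier_subset_closure h.vK)
theorem arg_X (h : Corner G v z1 lv) {z : ℂ} (hz : z ∈ closure G) (hzv : z ≠ v) :
    X v z1 z ≠ 0 ∧ |arg (X v z1 z)| < (2 - lv) * π / 2 := by
  have h1 : z - z1 ≠ 0 := sub_ne_zero.2 fun e => h.z1Y.1 (e ▸ hz)
  have h0 : X v z1 z ≠ 0 := div_ne_zero (sub_ne_zero.2 hzv) h1
  by_contra hlt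
  have h3 := abs_arg_neg_of h0
  apply (h.lens (-X v z1 z) (neg_ne_zero.2 h0) (by grind)).1
  have h4 := sub_ne_zero.2 h.ne
  have e : v + (z1 - v) * (-X v z1 z / (1 + -X v z1 z)) = z := by
    have h5 : 1 + -X v z1 z = -(z1 - v) / (z - z1) := by unfold X; field_simp; ring
    grind
  grind
theorem arg_add (h : Corner G v z1 lv) {z : ℂ} (hz : z ∈ closure G) {r : ℝ} (hr : 0 < r) {t : ℝ} (ht : 0 ≤ t) :
    (r : ℂ) + t * X v z1 z ≠ 0 ∧ |arg (r + t * X v z1 z)| < (2 - lv) * π / 2 := by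
  have hα : 0 < (2 - lv) * π / 2 := by have := h.l2; have := Real.pi_pos; nlinarith
  have hr' : (r : ℂ) ≠ 0 := by exact_mod_cast hr.ne'
  have ht0 : |arg (r + 0)| < (2 - lv) * π / 2 := by rw [add_zero, arg_ofReal_of_nonneg hr.le]; simpa using hα
  rcases ht.eq_or_lt with rfl | ht
  · simpa [hr'] using ht0
  by_cases hzv : z = v
  · subst hzv; simpa [X, hr'] using ht0
  obtain ⟨h0, h1⟩ := h.arg_X hz hzv
  have h2 := abs_arg_add_le (t * X v z1 z) hr.le
  rw [arg_real_mul _ ht] at h2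
  rw [add_comm]
  refine ⟨fun he => ?_, h2.trans_lt h1⟩
  have he' : X v z1 z = ((-(r / t) : ℝ) : ℂ) := by
    have : (t:ℂ) ≠ 0 := by grind
    push_cast; field_simp; linear_combination he
  rw [he', arg_ofReal_of_neg (by have := div_pos hr ht; linarith), abs_of_pos Real.pi_pos] at h1
  have := h.l0
  nlinarith [Real.pi_pos]
theorem arg_one (h : Corner G v z1 lv) {z : ℂ} (hz : z ∈ closure G) {r : ℝ} (hr : 0 < r) :
    |arg (1 + X v z1 z / r)| < (2 - lv) * π / 2 ∧ 1 + X v z1 z / r ∈ slitPlane := by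
  have hr' : (r : ℂ) ≠ 0 := by exact_mod_cast hr.ne'
  obtain ⟨h1, h2⟩ := h.arg_add hz hr zero_le_one
  have e : 1 + X v z1 z / r = ((r⁻¹ : ℝ) : ℂ) * (r + rI * X v z1 z) := by push_cast; field_simp
  have e2 : arg (1 + X v z1 z / r) = arg (r + rI * X v z1 z) := by rw [e, arg_real_mul _ (inv_pos.2 hr)]
  rw [mem_slitPlane_iff_arg, e2]
  refine ⟨h2, fun h3 => ?_, by rw [e]; exact mul_ne_zero (by exact_mod_cast (inv_pos.2 hr).ne') h1⟩
  rw [h3, abs_of_pos Real.pi_pos] at h2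
  have := h.l0
  nlinarith [Real.pi_pos]
theorem X_cont (h : Corner G v z1 lv) : ContinuousOn (X v z1) (closure G) :=
  ContinuousOn.div (by fun_prop) (by fun_prop) fun z hz => sub_ne_zero.2 fun e => h.z1Y.1 (e ▸ hz)
def b (lv : ℝ) : ℝ := 1 / (2 - lv)
def L (v z1 : ℂ) (r : ℝ) (z : ℂ) : ℂ := Complex.log (1 + X v z1 z / r)
def Yr (v z1 : ℂ) (lv r : ℝ) (z : ℂ) : ℂ := Complex.exp (b lv * L v z1 r z)
def fr (v z1 : ℂ) (lv r : ℝ) (z : ℂ) : ℂ := (1 + Yr v z1 lv r z)⁻¹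
theorem PA_L (h : Corner G v z1 lv) (hK : IsCompact (closure G)) {r : ℝ} (hr : 0 < r) : PA (closure G) (L v z1 r) := by
  have hr' : (r : ℂ) ≠ 0 := by exact_mod_cast hr.ne'
  have hcont : ContinuousOn (fun p : ℝ × ℂ => r + p.1 * X v z1 p.2) (Icc 0 1 ×ˢ closure G) :=
    continuousOn_const.add ((continuous_ofReal.comp continuous_fst).continuousOn.mul (h.X_cont.comp continuousOn_snd fun p hp => hp.2))
  rcases (closure G).eq_empty_or_nonempty with he | hne
  · rw [he]; exact fun ε hε => ⟨0, by simp⟩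
  obtain ⟨p0, hp0, hmin⟩ := (isCompact_Icc.prod hK).exists_isMinOn ((nonempty_Icc.2 zero_le_one).prod hne) hcont.norm
  set c := ‖r + p0.1 * X v z1 p0.2‖ with hc
  have hc0 := norm_pos_iff.2 (h.arg_add hp0.2 hr hp0.1.1).1
  have hcb : ∀ t ∈ UI, ∀ z ∈ closure G, c ≤ ‖(r:ℂ) + t * X v z1 z‖ := fun t ht z hz => hmin (show (t, z) ∈ UI ×ˢ closure G from ⟨ht, hz⟩)
  obtain ⟨B, hB⟩ := hK.exists_bound_of_continuousOn h.X_cont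
  have hg : ∀ t ∈ UI, PA (closure G) (fun z => X v z1 z / (r + t * X v z1 z)) := fun t ht => by
    have hrt : (r:ℂ) + t ≠ 0 := by exact_mod_cast (add_pos_of_pos_of_nonneg hr ht.1).ne'
    have hzc : (r * z1 + t * v) / (r + t) ∈ Yset G := by
      rcases ht.1.eq_or_lt with rfl | ht0
      · simpa [hr'] using h.z1Y
      · have hx := div_pos hr ht0
        have ht' : (t : ℂ) ≠ 0 := by exact_mod_cast ht0.ne'
        convert (h.lens ((r / t : ℝ) : ℂ) (by exact_mod_cast hx.ne') (by rw [arg_ofReal_of_nonneg hx.le]; simpa using by have := h.l0; positivity)) using 1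
        have h1 : 1 + ((r / t : ℝ):ℂ) = (r + t) / t := by push_cast; field_simp; ring
        grind
    refine ((((PA.ident).add (PA.const (-v))).mul hK (Geo.PAsub hzc)).cmul (r + t)⁻¹).congr fun z hz => ?_
    have h1 : z - z1 ≠ 0 := sub_ne_zero.2 fun e => h.z1Y.1 (e ▸ hz)
    have h3 := (h.arg_add hz hr ht.1).1
    have e3 : r + t * X v z1 z = (r + t) * (z - (r * z1 + t * v) / (r + t)) / (z - z1) := by
      unfold X; field_simp; ring
    simp only
    rw [e3]
    unfold X; field_simp; ring
  refine (PA.integral hg (C := B ^ 2 / c ^ 2) (by positivity) fun z hz t ht s hs => ?_).congr fun z hz => ?_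
  · have e : X v z1 z / (r + t * X v z1 z) - X v z1 z / (r + s * X v z1 z) =
        X v z1 z ^ 2 * (s - t) / ((r + t * X v z1 z) * (r + s * X v z1 z)) := by rw [div_sub_div _ _ ((h.arg_add hz hr ht.1).1) ((h.arg_add hz hr hs.1).1)]; ring
    rw [e, norm_div, norm_mul, norm_mul, norm_pow, ← ofReal_sub, norm_real, Real.norm_eq_abs, abs_sub_comm]
    rw [div_mul_eq_mul_div, sq c]
    have := hB z hz
    have := hcb t ht z hz
    have := hcb s hs z hz
    gcongr
  · have := log_eq_integral (z := X v z1 z / r) ?_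
    · simp only [L]; rw [this, ← intervalIntegral.integral_const_mul]
      refine intervalIntegral.integral_congr fun t ht => ?_
      rw [uIcc_of_le zero_le_one] at ht
      simp only [real_smul]
      grind
    · exact (h.arg_one hz hr).2
end Corner
namespace Geo
variable {G F : Set ℂ} {E : Geo G F} {ζ : ℂ} {kk : Fin E.M → ℝ → ℂ}
theorem RK.polyfun (h : E.RK ζ kk) {f : ℂ → ℂ} (hf : PA (closure G) f) : ∑ j, ∫ u, E.gN kk j u * f (E.τ j u) ∂m01 = f ζ := by
  have := E.polyfun (fun j => MemLp.int01 (h.gN_lp j)) (subset_closure h.inG) (fun P => by rw [one_mul]; exact h.rep P) hf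
  grind
theorem RK.N_mul (h : E.RK ζ kk) {w : ℂ} (hw : w ∈ G) (hwζ : w ≠ ζ) {f : ℂ → ℂ} (hf : PA (closure G) f) :
    f w * E.NN kk ζ w = ∑ j, ∫ u, E.gN kk j u * f (E.τ j u) / (E.τ j u - w) ∂m01 + f ζ * (w - ζ)⁻¹ := by
  have hwf := E.not_front hw
  have hI := fun j => MemLp.int01 (h.gN_lp j)
  have hc1 : ∀ j, ContinuousOn (fun u : ℝ => E.τ j u - ζ) (Icc 0 1) := fun j => (E.cont_seg j).sub continuousOn_const
  have hI0 := fun j => int_mul01 (hI j) (hc1 j)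
  have h0 : ∀ P : PC, ∑ j, ∫ u, (E.gN kk j u * (E.τ j u - ζ)) * P.eval (E.τ j u) ∂m01 = 0 * P.eval ζ := fun P => by
    have := h.polyfun (PA.poly ((Polynomial.X - Polynomial.C ζ) * P))
    simpa [mul_assoc] using this
  have h1 := fun P => E.div_trick hI0 h0 hwf (Or.inr rfl) P
  simp only [zero_mul, add_zero] at h1
  have h2 := E.polyfun (H := fun j u => E.gN kk j u * (E.τ j u - ζ) * (E.τ j u - w)⁻¹)
    (fun j => int_mul01 (hI0 j) (E.inv_cont j hwf)) (subset_closure hw)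
    (c := E.Phi (fun j u => E.gN kk j u * (E.τ j u - ζ)) w) (fun P => by
      rw [mul_comm, ← h1 P]
      refine sum_congr rfl fun j _ => ?_
      congr 1; funext u; rw [div_eq_mul_inv]; ring) hf
  have hsplit : ∀ g : ℂ → ℂ, (∀ j, ContinuousOn (fun u : ℝ => g (E.τ j u)) (Icc 0 1)) →
      ∑ j, ∫ u, E.gN kk j u * (E.τ j u - ζ) * (E.τ j u - w)⁻¹ * g (E.τ j u) ∂m01 =
      ∑ j, ∫ u, E.gN kk j u * g (E.τ j u) ∂m01 + (w - ζ) * ∑ j, ∫ u, E.gN kk j u * g (E.τ j u) / (E.τ j u - w) ∂m01 := fun g hg => by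
    rw [mul_sum, ← sum_add_distrib]
    refine sum_congr rfl fun j _ => ?_
    rw [← integral_const_mul, ← integral_add (int_mul01 (hI j) (hg j))]
    · refine integral_congr_ae ?_
      filter_upwards [ae_restrict_mem measurableSet_Ioo] with u hu
      have h4 := E.seg_ne j (Ioo_subset_Icc_self hu) hwf
      grind
    · refine Integrable.const_mul ?_ _
      simpa [div_eq_mul_inv] using int_mul01 (int_mul01 (hI j) (hg j)) (E.inv_cont j hwf)
  rw [hsplit f (E.PA_cont hf), h.polyfun hf] at h2
  have h3 := hsplit (fun _ => 1) (fun j => continuousOn_const)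
  have h4 := h.polyfun (PA.const 1)
  simp only [mul_one] at h3 h4
  rw [h4] at h3
  have h5 : E.Phi (fun j u => E.gN kk j u * (E.τ j u - ζ)) w = 1 + (w - ζ) * E.Phi (E.gN kk) w := by
    exact h3
  unfold NN
  grind
theorem Wt_bdd (E : Geo G F) : ∃ B > 0, ∀ j, ∀ u ∈ UI, E.Wt j u ≤ B := by
  have hWb : ∀ j, ∃ B, ∀ u ∈ UI, E.Wt j u ≤ B := fun j => by
    obtain ⟨B, hB⟩ := isCompact_Icc.exists_bound_of_continuousOn (E.Wt_cont j)
    exact ⟨B, fun u hu => (le_abs_self _).trans (hB u hu)⟩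
  choose B hB using hWb
  refine ⟨∑ j, |B j| + 1, by positivity, fun j u hu => ?_⟩
  have := single_le_sum (f := fun j => |B j|) (fun j _ => abs_nonneg _) (mem_univ j)
  grind
theorem RK.f_bound (h : E.RK ζ kk) {f : ℂ → ℂ} (hf : PA (closure G) f) (hre : ∀ z ∈ closure G, ‖f z‖ ^ 2 ≤ (f z).re)
    {B : ℝ} (hB : ∀ j, ∀ u ∈ UI, E.Wt j u ≤ B) {C0 : ℝ} (hC0 : ∑ j, ∫ u, E.Wt j u * ‖kk j u‖ ^ 2 ∂m01 ≤ C0) (j : Fin E.M) :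
    MemLp (fun u => E.gN kk j u * f (E.τ j u)) 2 m01 ∧ ∫ u, ‖E.gN kk j u * f (E.τ j u)‖ ^ 2 ∂m01 ≤ B * (‖f ζ‖ * C0) := by
  have hm : ∀ j, MemLp (fun u => E.gN kk j u * f (E.τ j u)) 2 m01 := fun j => memLp_mul01 (h.gN_lp j) (E.PA_cont hf j)
  refine ⟨hm j, ?_⟩
  have hB0 : 0 ≤ B := (E.Wt_nonneg j 0).trans (hB j 0 (by simp))
  have i1 : ∀ j, Integrable (fun u => kk j u * (E.gN kk j u * f (E.τ j u))) m01 := fun j => (h.lp j).integrable_mul (hm j)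
  have i2 : ∀ j, Integrable (fun u => kk j u * E.gN kk j u) m01 := fun j => (h.lp j).integrable_mul (h.gN_lp j)
  have h0 := h.limit (b := fun j u => E.gN kk j u * f (E.τ j u) - f ζ * E.gN kk j u) (fun j => (hm j).sub ((h.gN_lp j).const_mul _)) fun P => by
    have e1 := h.polyfun (hf.mul E.K_compact (PA.poly P))
    have e2 := h.polyfun ((PA.poly P).cmul (f ζ))
    rw [← sub_eq_zero.2 (e1.trans e2.symm), ← sum_sub_distrib]
    refine sum_congr rfl fun j _ => ?_
    rw [← integral_sub]
    · grind
    · exact int_mul01 (MemLp.int01 (h.gN_lp j)) ((E.PA_cont hf j).mul (E.poly_cont P j))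
    · exact int_mul01 (MemLp.int01 (h.gN_lp j)) (continuousOn_const.mul (E.poly_cont P j))
  have e3 : ∑ j, ∫ u, kk j u * (E.gN kk j u * f (E.τ j u)) ∂m01 = f ζ * ((∑ j, ∫ u, E.Wt j u * ‖kk j u‖ ^ 2 ∂m01 : ℝ) : ℂ) := by
    have : ((∑ j, ∫ u, E.Wt j u * ‖kk j u‖ ^ 2 ∂m01 : ℝ) : ℂ) = ∑ j, ∫ u, kk j u * E.gN kk j u ∂m01 := by
      rw [Complex.ofReal_sum]
      refine sum_congr rfl fun j _ => ?_
      rw [← integral_complex_ofReal]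
      congr 1; funext u
      simp only [gN, ofReal_mul, ofReal_pow]
      rw [← Complex.mul_conj']; ring
    rw [this, ← sub_eq_zero, ← h0, mul_sum, ← sum_sub_distrib]
    refine sum_congr rfl fun j _ => ?_
    rw [← integral_const_mul, ← integral_sub (i1 j) ((i2 j).const_mul _)]
    grind
  have hS0 : 0 ≤ ∑ j, ∫ u, E.Wt j u * ‖kk j u‖ ^ 2 ∂m01 := sum_nonneg fun j _ => integral_nonneg fun u => mul_nonneg (E.Wt_nonneg j u) (by positivity)
  have ptw : ∀ j, ∀ u ∈ UI, ‖E.gN kk j u * f (E.τ j u)‖ ^ 2 ≤ B * (kk j u * (E.gN kk j u * f (E.τ j u))).re := fun j u hu => by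
    have e : kk j u * (E.gN kk j u * f (E.τ j u)) = ((E.Wt j u * ‖kk j u‖ ^ 2 : ℝ) : ℂ) * f (E.τ j u) := by
      simp only [gN, ofReal_mul, ofReal_pow]
      rw [← mul_conj']; ring
    rw [e, re_ofReal_mul, norm_mul, gN, norm_mul, norm_conj, norm_real, Real.norm_of_nonneg (E.Wt_nonneg j u), mul_pow, mul_pow]
    have h1 := hre _ (E.seg_K j hu)
    have h2 := hB j u hu
    have h3 := E.Wt_nonneg j u
    calc E.Wt j u ^ 2 * ‖kk j u‖ ^ 2 * ‖f (E.τ j u)‖ ^ 2 = E.Wt j u * (E.Wt j u * ‖kk j u‖ ^ 2 * ‖f (E.τ j u)‖ ^ 2) := by ring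
      _ ≤ B * (E.Wt j u * ‖kk j u‖ ^ 2 * (f (E.τ j u)).re) := by gcongr
  have hj : ∀ j, ∫ u, ‖E.gN kk j u * f (E.τ j u)‖ ^ 2 ∂m01 ≤ B * (∫ u, kk j u * (E.gN kk j u * f (E.τ j u)) ∂m01).re := fun j => by
    have : (∫ u, kk j u * (E.gN kk j u * f (E.τ j u)) ∂m01).re = ∫ u, (kk j u * (E.gN kk j u * f (E.τ j u))).re ∂m01 := (integral_re (i1 j)).symm
    rw [this, ← integral_const_mul]
    exact setIntegral_mono_on ((hm j).integrable_norm_pow (p := 2) (by norm_num)) ((i1 j).re.const_mul B) measurableSet_Ioo fun u hu => ptw j u (Ioo_subset_Icc_self hu)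
  calc _ ≤ ∑ j, ∫ u, ‖E.gN kk j u * f (E.τ j u)‖ ^ 2 ∂m01 :=
        single_le_sum (fun j _ => integral_nonneg fun u => by positivity) (mem_univ j)
    _ ≤ ∑ j, B * (∫ u, kk j u * (E.gN kk j u * f (E.τ j u)) ∂m01).re := sum_le_sum fun j _ => hj j
    _ = B * (∑ j, ∫ u, kk j u * (E.gN kk j u * f (E.τ j u)) ∂m01).re := by rw [← mul_sum, re_sum]
    _ = B * ((f ζ).re * ∑ j, ∫ u, E.Wt j u * ‖kk j u‖ ^ 2 ∂m01) := by rw [e3, re_mul_ofReal]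
    _ ≤ B * (‖f ζ‖ * C0) := by gcongr; exact re_le_norm _
theorem RK.N_le (h : E.RK ζ kk) {f : ℂ → ℂ} (hf : PA (closure G) f) (hre : ∀ z ∈ closure G, ‖f z‖ ^ 2 ≤ (f z).re)
    {B : ℝ} (hB : ∀ j, ∀ u ∈ UI, E.Wt j u ≤ B) {C0 : ℝ} (hC0 : ∑ j, ∫ u, E.Wt j u * ‖kk j u‖ ^ 2 ∂m01 ≤ C0)
    {w : ℂ} (hw : w ∈ G) {d d' : ℝ} (hd : 0 < d) (hd' : 0 < d') (hwd : ∀ j, ∀ u ∈ UI, d ≤ ‖E.τ j u - w‖) (hwd' : d' ≤ ‖w - ζ‖) :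
    ‖f w‖ * ‖E.NN kk ζ w‖ ≤ E.M * (rsq (B * (‖f ζ‖ * C0)) * rsq (E.ker / d)) + ‖f ζ‖ / d' := by
  have hwζ : w ≠ ζ := fun e => by rw [e, sub_self, norm_zero] at hwd'; linarith
  rw [← norm_mul, h.N_mul hw hwζ hf]
  refine (norm_add_le _ _).trans ?_
  gcongr
  · refine (norm_sum_le _ _).trans ?_
    refine (sum_le_card_nsmul _ _ (rsq (B * (‖f ζ‖ * C0)) * rsq (E.ker / d)) fun j _ => ?_).trans (by simp)
    obtain ⟨h1, h2⟩ := h.f_bound hf hre hB hC0 j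
    refine (norm_integral_le_integral_norm _).trans ((E.cs_kernel h1 j hd (hwd j)).2.trans ?_)
    gcongr
  · rw [norm_mul, norm_inv, ← div_eq_mul_inv]
    gcongr
end Geo
namespace Corner
variable {G : Set ℂ} {v z1 : ℂ} {lv : ℝ}
theorem b_pos (h : Corner G v z1 lv) : 0 < b lv := by have := h.l2; unfold b; exact one_div_pos.2 (by linarith)
theorem Yr_re (h : Corner G v z1 lv) {z : ℂ} (hz : z ∈ closure G) {r : ℝ} (hr : 0 < r) : 0 < (Yr v z1 lv r z).re := by
  unfold Yr
  rw [exp_re, re_ofReal_mul, im_ofReal_mul]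
  refine mul_pos (Real.exp_pos _) (Real.cos_pos_of_mem_Ioo (abs_lt.1 ?_))
  rw [L, log_im, abs_mul, abs_of_pos h.b_pos, b]
  have h1 := (h.arg_one hz hr).1
  have : 0 < 2 - lv := by linarith [h.l2]
  rw [one_div, inv_mul_lt_iff₀ this]; linarith
theorem Yr_norm (h : Corner G v z1 lv) {z : ℂ} (hz : z ∈ closure G) {r : ℝ} (hr : 0 < r) :
    ‖Yr v z1 lv r z‖ = ‖1 + X v z1 z / r‖ ^ b lv := by
  rw [Yr, norm_exp, re_ofReal_mul, L, log_re, Real.rpow_def_of_pos (norm_pos_iff.2 (slitPlane_ne_zero (h.arg_one hz hr).2)), mul_comm]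
theorem PA_fr (h : Corner G v z1 lv) (hK : IsCompact (closure G)) {r : ℝ} (hr : 0 < r) : PA (closure G) (fr v z1 lv r) := by
  refine PA.inv hK ((PA.const 1).add (PA.exp hK ((h.PA_L hK hr).cmul (b lv)))) one_pos fun t ht z hz => ?_
  refine le_trans ?_ (re_le_norm _)
  have := h.Yr_re hz hr
  simp; linarith
theorem fr_re (h : Corner G v z1 lv) {r : ℝ} (hr : 0 < r) : ∀ z ∈ closure G, ‖fr v z1 lv r z‖ ^ 2 ≤ (fr v z1 lv r z).re := fun z hz => by
  have := h.Yr_re hz hr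
  have h2 : 1 ≤ (1 + Yr v z1 lv r z).re := by simp; linarith
  rw [fr, inv_re, norm_inv, inv_pow, normSq_eq_norm_sq, inv_eq_one_div]
  gcongr
theorem fr_lower (h : Corner G v z1 lv) {z : ℂ} (hz : z ∈ closure G) {r : ℝ} (hr : 0 < r) {A : ℝ} (hA : ‖X v z1 z‖ ≤ A * r) :
    (1 + (1 + A) ^ b lv)⁻¹ ≤ ‖fr v z1 lv r z‖ := by
  have h0 := h.Yr_re hz hr
  have h2 : 1 ≤ (1 + Yr v z1 lv r z).re := by simp; linarith
  have h3 := lt_of_lt_of_le one_pos (h2.trans (re_le_norm _))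
  rw [fr, norm_inv]
  gcongr
  refine (norm_add_le _ _).trans ?_
  rw [h.Yr_norm hz hr, norm_one]
  have := h.b_pos
  gcongr
  refine (norm_add_le _ _).trans ?_
  rw [norm_one, norm_div, norm_real, Real.norm_of_nonneg hr.le]
  gcongr
  rwa [div_le_iff₀ hr]
theorem fr_upper (h : Corner G v z1 lv) {z : ℂ} (hz : z ∈ closure G) {r c : ℝ} (hr : 0 < r) (hc : 0 < c) (hA : c ≤ ‖r + X v z1 z‖) :
    ‖fr v z1 lv r z‖ ≤ c ^ (-b lv) * r ^ b lv := by
  have h0 := h.Yr_re hz hr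
  have hb := h.b_pos
  have e : c ^ (-b lv) * r ^ b lv = ((c / r) ^ b lv)⁻¹ := by
    rw [Real.div_rpow hc.le hr.le, Real.rpow_neg hc.le, inv_div, div_eq_mul_inv, mul_comm]
  rw [e, fr, norm_inv]
  gcongr
  have h1 : (c / r) ^ b lv ≤ ‖Yr v z1 lv r z‖ := by
    rw [h.Yr_norm hz hr]
    have hr' : (r : ℂ) ≠ 0 := by exact_mod_cast hr.ne'
    rw [show 1 + X v z1 z / r = (r + X v z1 z) / r by field_simp, norm_div, norm_real, Real.norm_of_nonneg hr.le]
    gcongr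
  refine h1.trans ?_
  rw [← sq_le_sq₀ (norm_nonneg _) (norm_nonneg _), ← normSq_eq_norm_sq, ← normSq_eq_norm_sq, normSq_apply, normSq_apply]
  simp; nlinarith
theorem z1_dist (h : Corner G v z1 lv) : ∃ d > 0, ∀ z ∈ closure G, d ≤ ‖z - z1‖ := by
  obtain ⟨d, hd, h1⟩ := isOpen_iff.1 isClosed_closure.isOpen_compl z1 h.z1Y.1
  refine ⟨d, hd, fun z hz => ?_⟩
  by_contra hlt
  push Not at hlt
  exact h1 (by rwa [mem_ball, dist_eq_norm]) hz
theorem N_bound {F : Set ℂ} (E : Geo G F) (h : Corner G v z1 lv) (C0 : ℝ) {cd' CL d' : ℝ} (hcd : 0 < cd') (hCL : 0 < CL) (hd' : 0 < d') :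
    ∃ C > 0, ∀ ζ kk, E.RK ζ kk → ∑ j, ∫ u, E.Wt j u * ‖kk j u‖ ^ 2 ∂m01 ≤ C0 → ∀ s ∈ Ioc rO 1, ∀ w ∈ G,
      (∀ j, ∀ u ∈ UI, cd' * s ≤ ‖E.τ j u - w‖) → ‖w - v‖ ≤ CL * s → d' ≤ ‖w - ζ‖ →
      ‖E.NN kk ζ w‖ ≤ C * s ^ ((b lv - 1) / 2) := by
  obtain ⟨δ, hδ, hz1⟩ := h.z1_dist
  obtain ⟨B, hB0, hB⟩ := E.Wt_bdd
  have hb := h.b_pos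
  obtain ⟨c, hc, hcF⟩ : ∃ c > 0, ∀ r ∈ UI, ∀ ζ ∈ F, c ≤ ‖r + X v z1 ζ‖ := by
    rcases F.eq_empty_or_nonempty with he | hne
    · grind
    have hFK : F ⊆ closure G := E.F_sub.trans subset_closure
    have hcont : ContinuousOn (fun p : ℝ × ℂ => p.1 + X v z1 p.2) (Icc 0 1 ×ˢ F) :=
      (continuous_ofReal.comp continuous_fst).continuousOn.add (h.X_cont.comp continuousOn_snd fun p hp => hFK hp.2)
    obtain ⟨p0, hp0, hmin⟩ := (isCompact_Icc.prod E.F_comp).exists_isMinOn ((nonempty_Icc.2 zero_le_one).prod hne) hcont.norm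
    refine ⟨_, ?_, fun r hr ζ hζ => hmin (show (r, ζ) ∈ UI ×ˢ F from ⟨hr, hζ⟩)⟩
    refine norm_pos_iff.2 ?_
    rcases hp0.1.1.eq_or_lt with h0 | h0
    · rw [← h0]; simp only [ofReal_zero, zero_add]
      exact (h.arg_X (hFK hp0.2) fun e => E.not_front (E.F_sub hp0.2) (e ▸ h.vK)).1
    · have := (h.arg_add (hFK hp0.2) h0 zero_le_one).1
      simpa using this
  set c1 := (1 + (1 + CL / δ) ^ b lv)⁻¹ with hc1
  have hc1p : 0 < c1 := by positivity
  set C2 := c ^ (-b lv) with hC2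
  set C3 := E.M * rsq (B * C2 * |C0| * (E.ker / cd')) + C2 / d' with hC3
  refine ⟨C3 / c1, by positivity, fun ζ kk hk hkC s hs w hw hw1 hw2 hw3 => ?_⟩
  have hs0 := hs.1
  have hwK := subset_closure hw
  have f1 : c1 ≤ ‖fr v z1 lv s w‖ := by
    refine h.fr_lower hwK hs0 ?_
    rw [X, norm_div, div_mul_eq_mul_div]
    gcongr
    grind
  have f2 : ‖fr v z1 lv s ζ‖ ≤ C2 * s ^ b lv :=
    h.fr_upper (subset_closure hk.inG) hs0 hc (hcF s ⟨hs0.le, hs.2⟩ ζ hk.mem)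
  have hsb : s ^ b lv / s = (s ^ ((b lv - 1) / 2)) ^ 2 := by
    rw [← Real.rpow_natCast, ← Real.rpow_mul hs0.le]
    push_cast
    rw [div_mul_cancel₀ _ two_ne_zero, Real.rpow_sub hs0, Real.rpow_one]
  have hker := E.ker_pos
  have f4 : rsq (B * (‖fr v z1 lv s ζ‖ * |C0|)) * rsq (E.ker / (cd' * s)) ≤ rsq (B * C2 * |C0| * (E.ker / cd')) * s ^ ((b lv - 1) / 2) := by
    rw [← Real.sqrt_mul (by positivity)]
    refine Real.sqrt_le_iff.2 ⟨by positivity, ?_⟩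
    rw [mul_pow, Real.sq_sqrt (by positivity), ← hsb]
    calc _ ≤ B * (C2 * s ^ b lv * |C0|) * (E.ker / (cd' * s)) := by gcongr
      _ = _ := by field_simp
  have f5 : s ^ b lv ≤ s ^ ((b lv - 1) / 2) := Real.rpow_le_rpow_of_exponent_ge hs0 hs.2 (by linarith)
  have f6 : c1 * ‖E.NN kk ζ w‖ ≤ C3 * s ^ ((b lv - 1) / 2) := by
    calc _ ≤ ‖fr v z1 lv s w‖ * ‖E.NN kk ζ w‖ := by gcongr
      _ ≤ _ := hk.N_le (h.PA_fr E.K_compact hs0) (h.fr_re hs0) hB (hkC.trans (le_abs_self C0)) hw (mul_pos hcd hs0) hd' hw1 hw3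
      _ ≤ E.M * (rsq (B * C2 * |C0| * (E.ker / cd')) * s ^ ((b lv - 1) / 2)) + C2 * s ^ ((b lv - 1) / 2) / d' := by
        gcongr
        exact f2.trans (by gcongr)
      _ = _ := by rw [hC3]; ring
  rw [div_mul_eq_mul_div, le_div_iff₀ hc1p]; linarith
end Corner
namespace Geo
variable {G F : Set ℂ} (E : Geo G F)
def qn (q : PC) : ℝ := rsq (∑ j, ∫ u, E.Wt j u * ‖q.eval (E.τ j u)‖ ^ 2 ∂m01)
def Orth (n : ℕ) (q : PC) : Prop :=
  ∀ P : PC, P.natDegree ≤ n → ∑ j, ∫ u, E.Wt j u * conj (q.eval (E.τ j u)) * P.eval (E.τ j u) ∂m01 = 0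
def gq (q : PC) (j : Fin E.M) (u : ℝ) : ℂ := E.Wt j u * conj (q.eval (E.τ j u))
theorem qn_nonneg (q : PC) : 0 ≤ E.qn q := Real.sqrt_nonneg _
theorem gq_cont (q : PC) (j : Fin E.M) : ContinuousOn (E.gq q j) (Icc 0 1) :=
  (continuous_ofReal.comp_continuousOn (E.Wt_cont j)).mul (continuous_conj.comp_continuousOn (E.poly_cont q j))
theorem gq_le : ∃ B > 0, ∀ q j, rsq (∫ u, ‖E.gq q j u‖ ^ 2 ∂m01) ≤ B * E.qn q := by
  obtain ⟨B, hB0, hB⟩ := E.Wt_bdd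
  refine ⟨rsq B, Real.sqrt_pos.2 hB0, fun q j => ?_⟩
  rw [qn, ← Real.sqrt_mul hB0.le]
  apply Real.sqrt_le_sqrt
  have h2 : ∀ {f : ℝ → ℝ}, ContinuousOn f (Icc 0 1) → Integrable f m01 := fun hf =>
    (hf.integrableOn_Icc).mono_set Ioo_subset_Icc_self
  calc ∫ u, ‖E.gq q j u‖ ^ 2 ∂m01 ≤ ∫ u, B * (E.Wt j u * ‖q.eval (E.τ j u)‖ ^ 2) ∂m01 := by
        refine setIntegral_mono_on (h2 ((E.gq_cont q j).norm.pow 2)) ((h2 ((fun j => (E.Wt_cont j).mul ((E.poly_cont q j).norm.pow 2)) j)).const_mul B) measurableSet_Ioo fun u hu => ?_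
        rw [gq, norm_mul, norm_conj, norm_real, Real.norm_of_nonneg (E.Wt_nonneg j u), mul_pow, sq (E.Wt j u), mul_assoc]
        have := hB j u (Ioo_subset_Icc_self hu)
        have := E.Wt_nonneg j u
        gcongr
    _ ≤ B * ∑ j, ∫ u, E.Wt j u * ‖q.eval (E.τ j u)‖ ^ 2 ∂m01 := by
        rw [integral_const_mul]
        gcongr
        exact single_le_sum (f := fun j => ∫ u, E.Wt j u * ‖q.eval (E.τ j u)‖ ^ 2 ∂m01)
          (fun j _ => integral_nonneg fun u => mul_nonneg (E.Wt_nonneg j u) (by positivity)) (mem_univ j)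
theorem HH_Phi (q : PC) (t : ℂ) : E.HH q t = -E.Phi (E.gq q) t := by
  simp only [HH, Edges.Phi, ← Finset.sum_neg_distrib, ← integral_neg, gq]
  grind
theorem HH_diff (q : PC) {t : ℂ} (ht : t ∉ frontier G) : DifferentiableAt ℂ (E.HH q) t := by
  rw [funext (E.HH_Phi q)]
  exact (E.Phi_hasDeriv (fun j => (E.gq_cont q j).int01) ht).differentiableAt.neg
theorem HH_le : ∃ C > 0, ∀ q t d, 0 < d → (∀ j, ∀ u ∈ UI, d ≤ ‖E.τ j u - t‖) → ‖E.HH q t‖ ≤ C * E.qn q / rsq d := by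
  obtain ⟨B, hB0, hB⟩ := E.gq_le
  have hk := Real.sqrt_pos.2 E.ker_pos
  have hM : rO < E.M := by exact_mod_cast E.M_pos
  refine ⟨E.M * B * rsq E.ker, by positivity, fun q t d hd h => ?_⟩
  rw [HH_Phi, norm_neg, Edges.Phi]
  refine (norm_sum_le _ _).trans ?_
  refine (sum_le_card_nsmul _ _ (B * E.qn q * (rsq E.ker / rsq d)) fun j _ => ?_).trans (le_of_eq (by simp; ring))
  refine (norm_integral_le_integral_norm _).trans ((E.cs_kernel (E.gq_cont q j).memLp01 j hd (h j)).2.trans ?_)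
  rw [Real.sqrt_div E.ker_pos.le]
  gcongr
  exact hB q j
variable {E}
theorem Orth.HH_eq {n : ℕ} {q : PC} (h : E.Orth n q) {t : ℂ} (ht : t ∉ frontier G) {P : PC} (hP : P.natDegree ≤ n) :
    E.HH q t = ∑ j, ∫ u, E.gq q j u * ((t - E.τ j u)⁻¹ - P.eval (E.τ j u)) ∂m01 := by
  rw [← sub_zero (E.HH q t), ← h P hP, HH, ← sum_sub_distrib]
  refine sum_congr rfl fun j _ => ?_
  rw [← integral_sub]
  · congr 1; funext u; rw [gq]; ring
  · have : ContinuousOn (fun u => E.gq q j u * (-(E.τ j u - t)⁻¹)) (Icc 0 1) := (E.gq_cont q j).mul (E.inv_cont j ht).neg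
    refine this.int01.congr (ae_of_all _ fun u => ?_)
    simp only [gq]
    grind
  · exact ((E.gq_cont q j).mul (E.poly_cont P j)).int01
variable (E)
theorem Orth_le : ∃ C > 0, ∀ n q, E.Orth n q → ∀ t, t ∉ frontier G → ∀ P : PC, P.natDegree ≤ n →
    ∀ ε, (∀ z ∈ closure G, ‖(t - z)⁻¹ - P.eval z‖ ≤ ε) → ‖E.HH q t‖ ≤ C * E.qn q * ε := by
  obtain ⟨B, hB0, hB⟩ := E.gq_le
  have hM : rO < E.M := by exact_mod_cast E.M_pos
  refine ⟨E.M * B, by positivity, fun n q h t ht P hP ε hε => ?_⟩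
  have hε0 := (norm_nonneg _).trans (hε _ (E.seg_K E.j0 (u := 0) (by simp)))
  rw [h.HH_eq ht hP]
  refine (norm_sum_le _ _).trans ?_
  refine (sum_le_card_nsmul _ _ (B * E.qn q * ε) fun j _ => ?_).trans (le_of_eq (by simp; ring))
  have h1 : ∫ u, ‖E.gq q j u‖ ∂m01 ≤ B * E.qn q := by
    have := cs (E.gq_cont q j).memLp01 (continuousOn_const (c := 1)).memLp01
    simp only [norm_one, mul_one] at this
    refine this.trans ?_
    have h1 : ∫ u, rI ∂m01 = 1 := by simp
    simpa using hB q j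
  calc _ ≤ ∫ u, ‖E.gq q j u‖ * ε ∂m01 := by
        refine norm_integral_le_of_norm_le ((E.gq_cont q j).int01.norm.mul_const _) ?_
        filter_upwards [ae_restrict_mem measurableSet_Ioo] with u hu
        rw [norm_mul]; gcongr
        exact hε _ (E.seg_K j (Ioo_subset_Icc_self hu))
    _ ≤ _ := by rw [integral_mul_const]; gcongr
theorem decay_pt {w : ℂ} (hw : w ∈ Yset G) : ∃ U ∈ nhds w, ∃ C > 0, ∃ c > 0, ∀ n q, E.Orth n q → ∀ t ∈ U, ‖E.HH q t‖ ≤ C * E.qn q * rexp (-c * n) := by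
  obtain ⟨C, hC, hO⟩ := E.Orth_le
  obtain ⟨d, hd, hball⟩ := isOpen_iff.1 isClosed_closure.isOpen_compl w hw.1
  obtain ⟨R, hR⟩ := E.K_compact.isBounded.exists_norm_le
  obtain ⟨P0, hP0⟩ := hw.2 (1 / (4 * (‖w‖ + |R| + 1))) (by positivity)
  obtain ⟨B, hB, hPB⟩ := PA.poly_bdd E.K_compact P0
  set D := P0.natDegree with hD
  refine ⟨ball w (min (d / 2) (1 / (4 * B))), ball_mem_nhds _ (by positivity), C * (2 * (d / 2)⁻¹), by positivity,
    Real.log 2 / (D + 1), by positivity, fun n q hq t ht => ?_⟩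
  rw [mem_ball, dist_eq_norm, lt_min_iff] at ht
  have htd : ∀ z ∈ closure G, d / 2 ≤ ‖t - z‖ := fun z hz => by
    by_contra hlt
    refine hball (?_ : z ∈ ball w d) hz
    rw [mem_ball, dist_eq_norm]
    calc ‖z - w‖ = ‖(t - w) - (t - z)‖ := by ring
      _ ≤ ‖t - w‖ + ‖t - z‖ := norm_sub_le _ _
      _ < d := by linarith
  have htK : t ∉ closure G := fun h => by have := htd t h; simp at this; linarith
  set R0 : PC := 1 - (Polynomial.C t - Polynomial.X) * P0 with hR0
  have hR0d : R0.natDegree ≤ D + 1 := by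
    refine (Polynomial.natDegree_sub_le _ _).trans (max_le (by simp) ?_)
    refine Polynomial.natDegree_mul_le.trans ?_
    rw [add_comm]
    gcongr
    refine (Polynomial.natDegree_sub_le _ _).trans (max_le (by simp) (by simp))
  have hR0e : ∀ z ∈ closure G, ‖R0.eval z‖ ≤ 1 / 2 := fun z hz => by
    have hwz : w - z ≠ 0 := sub_ne_zero.2 fun e => hw.1 (e ▸ hz)
    have e : R0.eval z = (w - z) * ((w - z)⁻¹ - P0.eval z) - (t - w) * P0.eval z := by
      rw [mul_sub, mul_inv_cancel₀ hwz]; simp [hR0]; ring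
    rw [e]
    refine (norm_sub_le _ _).trans ?_
    rw [norm_mul, norm_mul]
    have h1 : ‖w - z‖ ≤ ‖w‖ + |R| + 1 := (norm_sub_le _ _).trans (by linarith [hR z hz, le_abs_self R])
    have h2 : ‖w - z‖ * ‖(w - z)⁻¹ - P0.eval z‖ ≤ (‖w‖ + |R| + 1) * (1 / (4 * (‖w‖ + |R| + 1))) := by
      gcongr
      exact hP0 z hz
    have h3 : ‖t - w‖ * ‖P0.eval z‖ ≤ 1 / (4 * B) * B := by
      gcongr
      · exact ht.2.le
      · exact hPB z hz
    have h4 : (‖w‖ + |R| + 1) * (1 / (4 * (‖w‖ + |R| + 1))) = 1 / 4 := by field_simp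
    have h5 : 1 / (4 * B) * B = 1 / 4 := by field_simp
    linarith
  set m := n / (D + 1) with hm
  set Pm : PC := P0 * ∑ k ∈ Finset.range m, R0 ^ k with hPm
  have hPd : Pm.natDegree ≤ n := by
    rcases Nat.eq_zero_or_pos m with h0 | h0
    · simp [hPm, h0]
    have h1 : (∑ k ∈ Finset.range m, R0 ^ k).natDegree ≤ (m - 1) * (D + 1) := by
      refine Polynomial.natDegree_sum_le_of_forall_le _ _ fun k hk => ?_
      refine Polynomial.natDegree_pow_le.trans ?_
      have := Finset.mem_range.1 hk
      exact Nat.mul_le_mul (by omega) hR0d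
    refine Polynomial.natDegree_mul_le.trans ?_
    have h2 : m * (D + 1) ≤ n := Nat.div_mul_le_self _ _
    have h3 : (m - 1) * (D + 1) + (D + 1) = m * (D + 1) := by
      obtain ⟨k, hk⟩ := Nat.exists_eq_succ_of_ne_zero h0.ne'
      rw [hk]; simp; ring
    omega
  refine (hO n q hq t (fun h => htK (frontier_subset_closure h)) Pm hPd ((1 / 2) ^ m * (d / 2)⁻¹) fun z hz => ?_).trans ?_
  · have htz : t - z ≠ 0 := sub_ne_zero.2 fun e => htK (e ▸ hz)
    have e : (t - z)⁻¹ - Pm.eval z = R0.eval z ^ m * (t - z)⁻¹ := by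
      have h1 := mul_neg_geom_sum (R0.eval z) m
      have h2 : 1 - R0.eval z = (t - z) * P0.eval z := by simp [hR0]
      rw [h2] at h1
      have h3 : Pm.eval z = P0.eval z * ∑ k ∈ Finset.range m, R0.eval z ^ k := by simp [hPm, Polynomial.eval_finset_sum]
      rw [h3]
      apply mul_left_cancel₀ htz
      have h4 := mul_inv_cancel₀ htz
      linear_combination (1 - R0.eval z ^ m) * h4 - h1
    rw [e, norm_mul, norm_pow, norm_inv]
    gcongr
    · exact hR0e z hz
    · exact htd z hz
  · have h1 : (rI / 2) ^ m ≤ 2 * rexp (-(Real.log 2 / (D + 1)) * n) := by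
      have h2 : (n : ℝ) / (D + 1) ≤ m + 1 := by
        rw [div_le_iff₀ (by positivity)]
        have : n < (m + 1) * (D + 1) := by
          exact Nat.lt_mul_of_div_lt (Nat.lt_succ_self _) (Nat.succ_pos _)
        exact_mod_cast this.le
      have h3 : (rI / 2) ^ m = rexp (-(Real.log 2 * m)) := by
        rw [Real.exp_neg, mul_comm, Real.exp_nat_mul, Real.exp_log two_pos]; simp
      have h4 : 2 * rexp (-(Real.log 2 / (D + 1)) * n) = rexp (Real.log 2 + (-(Real.log 2 / (D + 1)) * n)) := by
        rw [Real.exp_add, Real.exp_log two_pos]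
      rw [h3, h4]
      apply Real.exp_le_exp.2
      have : Real.log 2 / (D + 1) * n = Real.log 2 * (n / (D + 1)) := by ring
      have hl := Real.log_pos one_lt_two
      nlinarith
    have hqn := E.qn_nonneg q
    calc C * E.qn q * ((1 / 2) ^ m * (d / 2)⁻¹) ≤ C * E.qn q * (2 * rexp (-(Real.log 2 / (D + 1)) * n) * (d / 2)⁻¹) := by gcongr
      _ = _ := by ring
theorem decay {Q : Set ℂ} (hQ : IsCompact Q) (hQY : Q ⊆ Yset G) : ∃ C > 0, ∃ c > 0, ∀ n q, E.Orth n q → ∀ t ∈ Q, ‖E.HH q t‖ ≤ C * E.qn q * rexp (-c * n) := by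
  refine hQ.induction_on ?_ ?_ ?_ ?_
  · exact ⟨1, one_pos, 1, one_pos, by simp⟩
  · grind
  · rintro s t ⟨C, hC, c, hc, h⟩ ⟨C', hC', c', hc', h'⟩
    refine ⟨max C C', lt_max_of_lt_left hC, min c c', lt_min hc hc', fun n q hq x hx => ?_⟩
    have := E.qn_nonneg q
    rcases hx with hx | hx
    · refine (h n q hq x hx).trans ?_
      gcongr
      · grind
      · grind
    · refine (h' n q hq x hx).trans ?_
      gcongr
      · grind
      · grind
  · intro x hx
    obtain ⟨U, hU, h⟩ := E.decay_pt (hQY hx)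
    exact ⟨U, mem_nhdsWithin_of_mem_nhds hU, h⟩
end Geo
theorem sector_dist {x y : ℂ} {ψ : ℝ} (h0 : 0 ≤ ψ) (h1 : ψ ≤ π / 2) (h : y = 0 ∨ |arg x| + ψ ≤ |arg y|) :
    ‖x‖ * rsin ψ ≤ ‖x - y‖ := by
  rcases h with rfl | h
  · rw [sub_zero]; exact mul_le_of_le_one_right (norm_nonneg _) (Real.sin_le_one _)
  have hs0 := Real.sin_nonneg_of_nonneg_of_le_pi h0 (by grind)
  have hsa : ∀ t : ℝ, |t| ≤ π → |rsin t| = rsin |t| := fun t ht => by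
    rcases abs_cases t with ⟨e, h⟩ | ⟨e, h⟩ <;> rw [e] at ht ⊢
    · exact abs_of_nonneg (Real.sin_nonneg_of_nonneg_of_le_pi h ht)
    · rw [Real.sin_neg]; exact abs_of_nonpos (Real.sin_nonpos_of_nonpos_of_neg_pi_le h.le (by linarith))
  have hc : rcos (arg x) * rcos (arg y) + rsin (arg x) * rsin (arg y) ≤ rcos ψ := by
    calc _ ≤ rcos |arg x| * rcos |arg y| + rsin |arg x| * rsin |arg y| := by
          rw [Real.cos_abs, Real.cos_abs, ← hsa _ (abs_arg_le_pi x), ← hsa _ (abs_arg_le_pi y), ← abs_mul]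
          gcongr; exact le_abs_self _
      _ = rcos (|arg y| - |arg x|) := by rw [Real.cos_sub]; ring
      _ ≤ rcos ψ := Real.cos_le_cos_of_nonneg_of_le_pi h0 (by linarith [abs_arg_le_pi y, abs_nonneg (arg x)]) (by linarith)
  have e : ‖x - y‖ ^ 2 = ‖x‖ ^ 2 + ‖y‖ ^ 2 - 2 * (‖x‖ * ‖y‖ * (rcos (arg x) * rcos (arg y) + rsin (arg x) * rsin (arg y))) := by
    have e1 := norm_mul_cos_arg x
    have e2 := norm_mul_sin_arg x
    have e3 := norm_mul_cos_arg y
    have e4 := norm_mul_sin_arg y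
    have : ‖x‖ * ‖y‖ * (rcos (arg x) * rcos (arg y) + rsin (arg x) * rsin (arg y)) = x.re * y.re + x.im * y.im := by grind
    rw [this, ← normSq_eq_norm_sq, ← normSq_eq_norm_sq, ← normSq_eq_norm_sq, normSq_apply, normSq_apply, normSq_apply]
    simp; ring
  rw [← sq_le_sq₀ (by positivity) (norm_nonneg _), e]
  have hxy : 0 ≤ ‖x‖ * ‖y‖ := by positivity
  have := Real.sin_sq_add_cos_sq ψ
  nlinarith [sq_nonneg (‖y‖ - ‖x‖ * rcos ψ)]
theorem arg_cpow_real {x : ℂ} (hx : x ≠ 0) {l : ℝ} (h : |l * arg x| < π) : arg (x ^ (l : ℂ)) = l * arg x := by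
  have : (log x * l).im = l * arg x := by rw [im_mul_ofReal, log_im, mul_comm]
  rw [cpow_def_of_ne_zero hx, ← log_im, log_exp (by grind) (by grind), this]
namespace Corner
variable {G : Set ℂ} {v z1 : ℂ} {lv : ℝ}
def zz (v z1 ξ : ℂ) : ℂ := v + (z1 - v) * (ξ / (1 + ξ))
theorem pow_arg (h : Corner G v z1 lv) {η : ℂ} (hη : 0 ≤ η.re) (h0 : η ≠ 0) : arg (η ^ (lv : ℂ)) = lv * arg η := by
  have h1 := abs_arg_le_pi_div_two_iff.2 hη
  refine arg_cpow_real h0 ?_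
  rw [abs_mul, abs_of_pos h.l0]
  have := h.l0; have := h.l2
  calc lv * |arg η| ≤ lv * (π / 2) := by gcongr
    _ < π := by nlinarith [Real.pi_pos]
theorem pow_ne {η : ℂ} (h0 : η ≠ 0) : η ^ (lv : ℂ) ≠ 0 := by simp [h0]
theorem zz_Y (h : Corner G v z1 lv) {η : ℂ} (hη : 0 ≤ η.re) (h0 : η ≠ 0) : zz v z1 (η ^ (lv : ℂ)) ∈ Yset G := by
  refine h.lens _ (pow_ne h0) ?_
  have h1 := abs_arg_le_pi_div_two_iff.2 hη
  rw [h.pow_arg hη h0, abs_mul, abs_of_pos h.l0]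
  have := h.l0
  calc lv * |arg η| ≤ lv * (π / 2) := by gcongr
    _ = _ := by ring
theorem one_add_ne (h : Corner G v z1 lv) {η : ℂ} (hη : 0 ≤ η.re) (h0 : η ≠ 0) : 1 + η ^ (lv : ℂ) ≠ 0 := fun e => by
  have h1 := h.pow_arg hη h0
  rw [eq_neg_of_add_eq_zero_right e, arg_neg_one] at h1
  have h2 := abs_arg_le_pi_div_two_iff.2 hη
  have := h.l0; have := h.l2
  have h3 : lv * arg η ≤ lv * (π / 2) := by gcongr; exact (le_abs_self _).trans h2
  nlinarith [Real.pi_pos]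
theorem zz_dist (h : Corner G v z1 lv) : ∃ c > 0, ∀ η : ℂ, 0 < η.re → ‖η‖ ≤ 1 → ∀ z ∈ closure G, c * (‖η‖ ^ (lv - 1) * η.re) ≤ ‖z - zz v z1 (η ^ (lv : ℂ))‖ := by
  obtain ⟨δ, hδ, hz1⟩ := h.z1_dist
  have hl0 := h.l0
  refine ⟨δ / 2 * (2 / π * min lv 1), by positivity, fun η hη hη1 z hz => ?_⟩
  have h0 : η ≠ 0 := fun e => by simp [e] at hη
  set ξ := η ^ (lv : ℂ) with hξ
  have hn : ‖ξ‖ = ‖η‖ ^ lv := by rw [hξ, norm_cpow_real]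
  have hne : 1 + ξ ≠ 0 := h.one_add_ne hη.le h0
  have hz1' : z - z1 ≠ 0 := sub_ne_zero.2 fun e => h.z1Y.1 (e ▸ hz)
  have hvz := h.ne
  have e : z - zz v z1 ξ = (ξ - -X v z1 z) * (z - z1) / (1 + ξ) := by
    unfold zz X; field_simp; ring
  set φ := π / 2 - |arg η| with hφ
  have hφ0 : 0 ≤ φ := by have := abs_arg_le_pi_div_two_iff.2 hη.le; linarith
  have hφ1 : φ ≤ π / 2 := by grind
  have hre : η.re ≤ ‖η‖ * φ := by
    rw [← norm_mul_cos_arg η, ← Real.cos_abs, ← Real.sin_pi_div_two_sub]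
    gcongr
    exact Real.sin_le hφ0
  set ψ := min lv 1 * φ with hψ
  have hψ0 : 0 ≤ ψ := by positivity
  have hψ1 : ψ ≤ π / 2 := by
    calc ψ ≤ 1 * φ := by rw [hψ]; gcongr; exact min_le_right _ _
      _ ≤ _ := by linarith
  have hsd : ‖ξ‖ * rsin ψ ≤ ‖ξ - -X v z1 z‖ := by
    refine sector_dist hψ0 hψ1 ?_
    by_cases hzv : z = v
    · simp [X, hzv]
    obtain ⟨hX0, hX⟩ := h.arg_X hz hzv
    rw [abs_arg_neg_of hX0, h.pow_arg hη.le h0, abs_mul, abs_of_pos hl0]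
    have : ψ ≤ lv * φ := by rw [hψ]; gcongr; exact min_le_left _ _
    grind
  have hj := Real.mul_le_sin hψ0 hψ1
  have hd2 : ‖1 + ξ‖ ≤ 2 := (norm_add_le _ _).trans (by
    rw [norm_one, hn]; linarith [Real.rpow_le_one (norm_nonneg η) hη1 hl0.le])
  rw [e, norm_div, norm_mul]
  calc δ / 2 * (2 / π * min lv 1) * (‖η‖ ^ (lv - 1) * η.re) ≤ δ / 2 * (2 / π * min lv 1) * (‖η‖ ^ (lv - 1) * (‖η‖ * φ)) := by gcongr
    _ = ‖η‖ ^ lv * (2 / π * ψ) * δ / 2 := by rw [Real.rpow_sub_one (norm_pos_iff.2 h0).ne', hψ]; field_simp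
    _ ≤ ‖η‖ ^ lv * rsin ψ * δ / 2 := by gcongr
    _ ≤ ‖ξ - -X v z1 z‖ * ‖z - z1‖ / ‖1 + ξ‖ := by
      gcongr
      · grind
      · grind
theorem HH_decay {F : Set ℂ} (E : Geo G F) (h : Corner G v z1 lv) : ∃ C > 0, ∃ c > 0, ∀ n q, E.Orth n q → ∀ η : ℂ, 0 < η.re → ‖η‖ < 1 →
    ‖E.HH q (zz v z1 (η ^ (lv : ℂ)))‖ ≤ C * E.qn q * ((rsq η.re)⁻¹ * ‖η‖ ^ (-((lv - 1) / 2)) * rexp (-c * (n * η.re))) := by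
  have hzc : ∀ x : ℂ, 0 ≤ x.re → x ≠ 0 → ContinuousAt (fun η => zz v z1 (η ^ (lv : ℂ))) x := fun x hx h0 => by
    have hs : x ∈ slitPlane := by
      rw [mem_slitPlane_iff_arg]
      refine ⟨fun e => ?_, h0⟩
      have := abs_arg_le_pi_div_two_iff.2 hx
      rw [e, abs_of_pos Real.pi_pos] at this
      linarith [Real.pi_pos]
    have h1 : ContinuousAt (fun η => η ^ (lv : ℂ)) x := continuousAt_id.cpow continuousAt_const hs
    exact continuousAt_const.add (continuousAt_const.mul (h1.div (continuousAt_const.add h1) (h.one_add_ne hx h0)))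
  obtain ⟨C1, hC1, c1, hc1, hdec⟩ := E.decay (Q := (fun η => zz v z1 (η ^ (lv : ℂ))) '' ({x : ℂ | 0 ≤ x.re} ∩ sphere 0 1))
    (((isCompact_sphere _ _).inter_left (isClosed_le continuous_const continuous_re)).image_of_continuousOn fun x hx =>
      (hzc x hx.1 fun e => by simpa [e] using hx.2).continuousWithinAt) (by
      rintro _ ⟨x, hx, rfl⟩
      exact h.zz_Y hx.1 fun e => by simpa [e] using hx.2)
  obtain ⟨C2, hC2, hHH⟩ := E.HH_le
  obtain ⟨c3, hc3, hdist⟩ := h.zz_dist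
  have hs3 := Real.sqrt_pos.2 hc3
  refine ⟨(C1 + C2 / rsq c3) * rsq 2, by positivity, c1 / 2, by positivity, fun n q hq η hη hη1 => ?_⟩
  have hqn := E.qn_nonneg q
  set a := η.re / 2 with ha
  have ha0 : 0 < a := by positivity
  have ha1 : a ≤ 1 := by have := (re_le_norm η).trans hη1.le; linarith
  set U : Set ℂ := {x | a < x.re} ∩ ball 0 1 with hU
  have hUo : IsOpen U := (isOpen_lt continuous_const continuous_re).inter isOpen_ball
  have hUc : closure U ⊆ {x | a ≤ x.re} ∩ closedBall 0 1 :=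
    closure_minimal (inter_subset_inter (fun x (hx : a < x.re) => show a ≤ x.re from hx.le) ball_subset_closedBall) ((isClosed_le continuous_const continuous_re).inter isClosed_closedBall)
  set f : ℂ → ℂ := fun x => E.HH q (zz v z1 (x ^ (lv : ℂ))) * x ^ (((lv - 1) / 2 : ℝ) : ℂ) * exp (c1 * n * (x - a)) with hf
  have hfd : DifferentiableOn ℂ f (closure U) := fun x hx => by
    have hx0 : 0 < x.re := lt_of_lt_of_le ha0 (hUc hx).1
    have hxn : x ≠ 0 := fun e => by simp [e] at hx0
    have hs : x ∈ slitPlane := Or.inl hx0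
    have h1 : DifferentiableAt ℂ (fun η => η ^ (lv : ℂ)) x := differentiableAt_id.cpow (differentiableAt_const _) hs
    have h2 : DifferentiableAt ℂ (fun η => η ^ (((lv - 1) / 2 : ℝ) : ℂ)) x := differentiableAt_id.cpow (differentiableAt_const _) hs
    have h3 : DifferentiableAt ℂ (fun η => zz v z1 (η ^ (lv : ℂ))) x :=
      (differentiableAt_const _).add ((differentiableAt_const _).mul (h1.div ((differentiableAt_const _).add h1) (h.one_add_ne hx0.le hxn)))
    have h4 : DifferentiableAt ℂ (fun η => E.HH q (zz v z1 (η ^ (lv : ℂ)))) x :=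
      DifferentiableAt.comp (g := E.HH q) x (E.HH_diff q fun hfr => (h.zz_Y hx0.le hxn).1 (frontier_subset_closure hfr)) h3
    exact ((h4.mul h2).mul (by fun_prop)).differentiableWithinAt
  have hfn : ∀ x : ℂ, ‖f x‖ = ‖E.HH q (zz v z1 (x ^ (lv : ℂ)))‖ * ‖x‖ ^ ((lv - 1) / 2) * rexp (c1 * n * (x.re - a)) := fun x => by
    rw [hf]
    rw [norm_mul, norm_mul, norm_cpow_real, norm_exp]
    congr 2
    have : (c1 * n * (x - a) : ℂ) = ((c1 * n : ℝ) : ℂ) * (x - a) := by push_cast; ring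
    rw [this, re_ofReal_mul]; simp
  have hbd : ∀ x ∈ frontier U, ‖f x‖ ≤ (C1 + C2 / rsq c3) * E.qn q * (rsq a)⁻¹ := fun x hx => by
    have hxc := hUc (frontier_subset_closure hx)
    have hx1 : ‖x‖ ≤ 1 := by simpa using hxc.2
    have hx0 : 0 < x.re := lt_of_lt_of_le ha0 hxc.1
    have hxn : x ≠ 0 := fun e => by simp [e] at hx0
    have hxp : 0 < ‖x‖ := norm_pos_iff.2 hxn
    have hsa := Real.sqrt_pos.2 ha0
    have hnot : x ∉ U := by rw [hUo.frontier_eq] at hx; exact hx.2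
    rw [hfn]
    by_cases hx2 : ‖x‖ = 1
    · have h1 := hdec n q hq _ ⟨x, ⟨hx0.le, by simpa using hx2⟩, rfl⟩
      have h2 : x.re - a ≤ 1 := by linarith [re_le_norm x]
      rw [hx2, Real.one_rpow, mul_one]
      calc _ ≤ C1 * E.qn q * rexp (-c1 * n) * rexp (c1 * n * 1) := by gcongr
        _ = C1 * E.qn q * 1 := by rw [mul_assoc, ← Real.exp_add]; simp
        _ ≤ _ := by
          gcongr
          · have : 0 ≤ C2 / rsq c3 := by positivity
            linarith
          · exact (one_le_inv₀ hsa).2 (Real.sqrt_le_one.2 ha1)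
    · have hra : x.re = a := by
        by_contra hne
        exact hnot ⟨lt_of_le_of_ne hxc.1 (Ne.symm hne), by simpa using lt_of_le_of_ne hx1 hx2⟩
      have hpos : 0 < c3 * (‖x‖ ^ (lv - 1) * x.re) := by positivity
      have h1 := hHH q (zz v z1 (x ^ (lv : ℂ))) _ hpos fun j u hu => hdist x hx0 hx1 _ (E.seg_K j hu)
      have hsq : rsq (c3 * (‖x‖ ^ (lv - 1) * x.re)) = rsq c3 * (‖x‖ ^ ((lv - 1) / 2) * rsq a) := by
        rw [Real.sqrt_mul hc3.le, Real.sqrt_mul (by positivity), hra, Real.sqrt_eq_rpow (‖x‖ ^ (lv - 1)), ← Real.rpow_mul hxp.le]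
        congr 3; ring
      rw [hsq] at h1
      rw [hra, sub_self, mul_zero, Real.exp_zero, mul_one]
      calc _ ≤ C2 * E.qn q / (rsq c3 * (‖x‖ ^ ((lv - 1) / 2) * rsq a)) * ‖x‖ ^ ((lv - 1) / 2) := by gcongr
        _ = (0 + C2 / rsq c3) * E.qn q * (rsq a)⁻¹ := by field_simp; ring
        _ ≤ _ := by gcongr
  have hmem : η ∈ U := ⟨by change a < η.re; linarith, by simpa using hη1⟩
  have key := norm_le_of_forall_mem_frontier_norm_le (isBounded_ball.subset inter_subset_right) hfd.diffContOnCl hbd (subset_closure hmem)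
  rw [hfn] at key
  have hηp : 0 < ‖η‖ := norm_pos_iff.2 fun e => by simp [e] at hη
  have e1 : c1 * n * (η.re - a) = -(-(c1 / 2) * (n * η.re)) := by rw [ha]; ring
  rw [e1, Real.exp_neg] at key
  have hA : 0 < ‖η‖ ^ ((lv - 1) / 2) := by positivity
  have e2 : (rsq a)⁻¹ = rsq 2 * (rsq η.re)⁻¹ := by
    rw [ha, Real.sqrt_div hη.le, inv_div, div_eq_mul_inv]
  rw [e2, ← div_eq_mul_inv, div_le_iff₀ (Real.exp_pos (-(c1 / 2) * (n * η.re))), ← le_div_iff₀ hA] at key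
  refine key.trans (le_of_eq ?_)
  rw [Real.rpow_neg hηp.le]; field_simp
end Corner
def ep (e : Bool) (s : ℝ) : ℝ := if e then 1 - s else s
theorem ep_mem (e : Bool) {s : ℝ} (hs : s ∈ Ioc rO (1/2)) : ep e s ∈ UO := by
  obtain ⟨h1, h2⟩ := hs
  cases e <;> simp [ep] <;> constructor <;> linarith
theorem ep_mul (e : Bool) {s : ℝ} (hs : s ∈ Ioc rO (1/2)) : s / 2 ≤ ep e s * (1 - ep e s) := by
  obtain ⟨h1, h2⟩ := hs
  cases e <;> simp [ep] <;> nlinarith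
theorem two_ends {f : ℝ → ℂ} (hf : AEStronglyMeasurable f m01) (g : Bool → ℝ → ℝ) (hg : ∀ e, IntegrableOn (g e) (Ioi 0))
    (hg0 : ∀ e s, 0 < s → 0 ≤ g e s) (h : ∀ e, ∀ s ∈ Ioc rO (1/2), ‖f (ep e s)‖ ≤ g e s) :
    Integrable f m01 ∧ ‖∫ v, f v ∂m01‖ ≤ ∑ e, ∫ s in Ioi 0, g e s := by
  have hi0 : Integrable (g false) m01 := (hg false).mono_set Ioo_subset_Ioi_self
  have hi1' : IntervalIntegrable (g true) volume 0 1 :=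
    (intervalIntegrable_iff_integrableOn_Ioo_of_le zero_le_one).2 ((hg true).mono_set Ioo_subset_Ioi_self)
  have hi1'' : IntervalIntegrable (fun v => g true (1 - v)) volume 0 1 := by simpa using (hi1'.comp_sub_left 1).symm
  have hi1 := (intervalIntegrable_iff_integrableOn_Ioo_of_le zero_le_one).1 hi1''
  have hle : ∀ᵐ v ∂m01, ‖f v‖ ≤ g false v + g true (1 - v) := by
    filter_upwards [ae_restrict_mem measurableSet_Ioo] with v hv
    have a0 := hg0 false v hv.1
    rcases le_total v (1/2) with hv2 | hv2
    · have := h false v ⟨hv.1, hv2⟩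
      simp only [ep] at this
      grind
    · have := h true (1 - v) ⟨by linarith [hv.2], by linarith⟩
      simp [ep] at this
      linarith
  refine ⟨(hi0.add hi1).mono' hf hle, ?_⟩
  refine (norm_integral_le_of_norm_le (hi0.add hi1) hle).trans ?_
  have e2 : ∫ v, g true (1 - v) ∂m01 = ∫ v, g true v ∂m01 := by
    rw [← integral_Ioc_eq_integral_Ioo, ← integral_Ioc_eq_integral_Ioo, ← intervalIntegral.integral_of_le zero_le_one,
      ← intervalIntegral.integral_of_le zero_le_one, intervalIntegral.integral_comp_sub_left (fun v => g true v) 1]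
    simp
  have mono : ∀ e, ∫ v, g e v ∂m01 ≤ ∫ s in Ioi 0, g e s := fun e =>
    setIntegral_mono_set (hg e) (by
      filter_upwards [ae_restrict_mem measurableSet_Ioi] with s hs using hg0 e s hs) (Ioo_subset_Ioi_self.eventuallyLE)
  have := mono false; have := mono true
  simp only [Fintype.sum_bool]
  calc _ = ∫ v, g false v ∂m01 + ∫ v, g true v ∂m01 := by rw [← e2]; exact integral_add hi0 hi1
    _ ≤ _ := by linarith
namespace Geo
variable {G F : Set ℂ}
def EndD (E : Geo G F) (lam : ℝ) (j : Fin E.M) (e : Bool) : Prop :=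
  ∃ z1 lv, lam ≤ lv ∧ Corner G (E.τ j (ep e 0 : ℝ)) z1 lv ∧ ∃ u0 > 0, ∃ δ > 0, δ ≤ lv * π / 2 ∧
    ∀ s ∈ Ioc 0 u0, |arg (-Corner.X (E.τ j (ep e 0 : ℝ)) z1 (E.tE j (ep e s)))| ≤ lv * π / 2 - δ
theorem lip (E : Geo G F) (j : Fin E.M) (e : Bool) : ∃ C > 0, ∀ b, (b = E.a j ∨ b = -E.a j) → ∀ s ∈ Ioc rO (1/2),
    ‖E.τ j (pth b (ep e s)) - E.τ j (ep e 0 : ℝ)‖ ≤ C * s := by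
  obtain ⟨B, hB⟩ := (Th_compact (E.a j)).exists_bound_of_continuousOn ((E.diff_deriv j).continuousOn.mono (E.Th_sub j))
  refine ⟨(|B| + 1) * (1 + |E.a j|), by positivity, fun b hb s hs => ?_⟩
  have hb' : |b| = |E.a j| := by grind
  have hTb : Th b = Th (E.a j) := by unfold Th; rw [hb']
  have h0 : (ep e 0 : ℂ) ∈ Th (E.a j) := real_mem_Th _ (by cases e <;> simp [ep])
  refine ((Th_convex (E.a j)).norm_image_sub_le_of_norm_deriv_le (C := |B| + 1) (fun x hx => (E.diff j).differentiableAt (E.V_open.mem_nhds (E.Th_sub j hx))) (fun x hx => (hB x hx).trans (by grind)) h0 (hTb ▸ pth_mem b (Ioo_subset_Icc_self (ep_mem e hs)))).trans ?_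
  rw [mul_assoc]
  refine mul_le_mul_of_nonneg_left ?_ (by positivity)
  refine (norm_le_abs_re_add_abs_im _).trans ?_
  obtain ⟨hs0, hs1⟩ := hs
  have h2 : |(pth b (ep e s) - (ep e 0 : ℂ)).re| = s := by
    cases e <;> simp [ep, abs_of_pos hs0]
  have h3 : |(pth b (ep e s) - (ep e 0 : ℂ)).im| ≤ |E.a j| * s := by
    have : ep e s * (1 - ep e s) = s * (1 - s) := by cases e <;> simp [ep]; ring
    simp only [sub_im, pth_im, ofReal_im, sub_zero, this, abs_mul, hb', abs_of_pos hs0]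
    gcongr
    rw [abs_of_pos (by linarith)]
    nlinarith
  grind
theorem endN (E : Geo G F) {j : Fin E.M} {e : Bool} {z1 : ℂ} {lv : ℝ} (h : Corner G (E.τ j (ep e 0 : ℝ)) z1 lv) (C0 : ℝ) :
    ∃ C > 0, ∀ ζ kk, E.RK ζ kk → ∑ j, ∫ u, E.Wt j u * ‖kk j u‖ ^ 2 ∂m01 ≤ C0 → ∀ s ∈ Ioc rO (1/2),
      ‖E.NN kk ζ (E.tG j (ep e s))‖ ≤ C * s ^ ((Corner.b lv - 1) / 2) := by
  obtain ⟨CL, hCL, hl⟩ := E.lip j e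
  have hcd := E.cd_pos
  have hdis : Disjoint (E.τ j '' Th (E.a j)) F := by
    rw [disjoint_left]; rintro _ ⟨x, hx, rfl⟩; exact E.avoid j x hx
  obtain ⟨d, hd, hdd⟩ := hdis.exists_thickenings ((Th_compact _).image_of_continuousOn ((E.diff j).continuousOn.mono (E.Th_sub j))) E.F_comp.isClosed
  obtain ⟨C, hC, hb⟩ := h.N_bound E C0 (cd' := E.cd / 2) (d' := d) (by positivity) hCL hd
  refine ⟨C, hC, fun ζ kk hR hk s hs => ?_⟩
  have hm := ep_mem e hs
  refine hb ζ kk hR hk s ⟨hs.1, by linarith [hs.2]⟩ _ (E.inG j _ hm) (fun i u hu => ?_) (hl _ (Or.inl rfl) s hs) ?_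
  · have h2 := ep_mul e hs
    refine le_trans ?_ (E.dist i j u hu _ hm _ (Or.inl rfl))
    nlinarith
  · by_contra hlt
    push Not at hlt
    have hz : ζ ∈ thickening d (E.τ j '' Th (E.a j)) := by
      rw [mem_thickening_iff]
      exact ⟨_, ⟨_, pth_mem _ (Ioo_subset_Icc_self hm), rfl⟩, by rw [dist_comm, dist_eq_norm]; exact hlt⟩
    exact disjoint_left.1 hdd hz (self_subset_thickening hd _ hR.mem)
theorem endH (E : Geo G F) {j : Fin E.M} {e : Bool} {z1 : ℂ} {lv : ℝ} (h : Corner G (E.τ j (ep e 0 : ℝ)) z1 lv) {u0 δ : ℝ} (hu0 : 0 < u0)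
    (hδ : 0 < δ) (hδ1 : δ ≤ lv * π / 2)
    (harg : ∀ s ∈ Ioc 0 u0, |arg (-Corner.X (E.τ j (ep e 0 : ℝ)) z1 (E.tE j (ep e s)))| ≤ lv * π / 2 - δ) :
    ∃ C > 0, ∃ c > 0, ∀ n q, E.Orth n q → ∀ s ∈ Ioc rO (1/2),
      ‖E.HH q (E.tE j (ep e s))‖ ≤ C * E.qn q * (s ^ (-(1/2):ℝ) * rexp (-(c * n) * s ^ (1 / lv))) := by
  obtain ⟨CL, hCL, hl⟩ := E.lip j e
  have hcd := E.cd_pos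
  have hpi := Real.pi_pos
  set v := E.τ j (ep e 0 : ℝ) with hv
  have hlv := h.l0
  set D := ‖z1 - v‖ with hD
  have hD0 : 0 < D := norm_pos_iff.2 (sub_ne_zero.2 h.ne)
  obtain ⟨C1, hC1, c1, hc1, hH⟩ := h.HH_decay E
  set u1 := min (min u0 (1/2)) (D / (4 * CL)) with hu1
  have hu1p : 0 < u1 := by positivity
  obtain ⟨C2, hC2, c2, hc2, hH2⟩ := E.decay (Q := E.tE j '' Icc u1 (1 - u1))
    (isCompact_Icc.image_of_continuousOn ((E.tE_contOn j).mono (Icc_subset_Icc hu1p.le (by linarith))))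
    (by rintro _ ⟨x, hx, rfl⟩; exact E.inY j x ⟨by linarith [hx.1], by linarith [hx.2]⟩)
  set κ := rsin (δ / lv) with hκ
  have hδlv : δ / lv ≤ π / 2 := by rw [div_le_iff₀ hlv]; linarith
  have hδlv0 : 0 < δ / lv := by positivity
  have hκ0 := Real.sin_pos_of_pos_of_lt_pi hδlv0 (by linarith)
  set c0 := E.cd / (3 * D) with hc0
  have hc0p : 0 < c0 := by positivity
  refine ⟨C1 * ((rsq κ)⁻¹ * c0 ^ (-(1/2):ℝ)) + C2, by positivity, min (c1 * (κ * c0 ^ (1/lv))) c2, by positivity, fun n q hq s hs => ?_⟩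
  have hqn := E.qn_nonneg q
  have hs0 := hs.1
  set cm := min (c1 * (κ * c0 ^ (1/lv))) c2 with hcm
  have hspow : 0 < s ^ (-(1/2):ℝ) := by positivity
  by_cases hsu : s ≤ u1
  · have hsD : CL * s ≤ D / 4 := by
      have := hsu.trans (min_le_right _ _)
      rw [le_div_iff₀ (by positivity)] at this
      linarith
    set t := E.tE j (ep e s) with ht
    have ht1 : ‖t - v‖ ≤ CL * s := hl _ (Or.inr rfl) s hs
    have ht0 : E.cd * s / 2 ≤ ‖t - v‖ := by
      have := E.tE_dist j (ep_mem e hs) (frontier_subset_closure h.vK)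
      rw [norm_sub_rev] at this
      nlinarith [ep_mul e hs]
    have htz0 : 3 * D / 4 ≤ ‖t - z1‖ := by
      have : ‖z1 - v‖ ≤ ‖t - v‖ + ‖t - z1‖ := by
        rw [show z1 - v = (t - v) - (t - z1) by ring]; exact norm_sub_le _ _
      linarith
    have htz1 : ‖t - z1‖ ≤ 3 * D / 2 := by
      have : ‖t - z1‖ ≤ ‖t - v‖ + ‖z1 - v‖ := by
        rw [show t - z1 = (t - v) - (z1 - v) by ring]; exact norm_sub_le _ _
      linarith
    set ξ := -Corner.X v z1 t with hξ
    have hξn : ‖ξ‖ = ‖t - v‖ / ‖t - z1‖ := by rw [hξ, norm_neg, Corner.X, norm_div]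
    have htzp : 0 < ‖t - z1‖ := by linarith
    have hξl : c0 * s ≤ ‖ξ‖ := by
      rw [hξn, le_div_iff₀ htzp]
      calc c0 * s * ‖t - z1‖ ≤ c0 * s * (3 * D / 2) := by gcongr
        _ = E.cd * s / 2 := by rw [hc0]; field_simp
        _ ≤ _ := ht0
    have hξu : ‖ξ‖ < 1 := by rw [hξn, div_lt_one htzp]; linarith
    have hcs : 0 < c0 * s := by positivity
    have hξp : 0 < ‖ξ‖ := by linarith
    have hξ0 : ξ ≠ 0 := norm_pos_iff.1 hξp
    set η := ξ ^ ((1 / lv : ℝ) : ℂ) with hη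
    have hηn : ‖η‖ = ‖ξ‖ ^ (1 / lv) := by rw [hη, norm_cpow_real]
    have hla : |1 / lv * arg ξ| ≤ π / 2 - δ / lv := by
      rw [abs_mul, abs_of_pos (by positivity), one_div, inv_mul_le_iff₀ hlv]
      calc _ ≤ _ := harg s ⟨hs0, hsu.trans ((min_le_left _ _).trans (min_le_left _ _))⟩
        _ = _ := by field_simp
    have hηa : arg η = 1 / lv * arg ξ := arg_cpow_real hξ0 (by linarith)
    have hηp : 0 < ‖η‖ := by rw [hηn]; positivity
    have hη0 : η ≠ 0 := norm_pos_iff.1 hηp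
    have hre : κ * ‖η‖ ≤ η.re := by
      rw [← norm_mul_cos_arg η, mul_comm]
      gcongr
      rw [hηa, ← Real.cos_abs, hκ, ← Real.cos_pi_div_two_sub]
      exact Real.cos_le_cos_of_nonneg_of_le_pi (abs_nonneg _) (by linarith) hla
    have hrep : 0 < η.re := by have : 0 < κ * ‖η‖ := by positivity
                               linarith
    have hηξ : η ^ (lv : ℂ) = ξ := by
      apply ext_norm_arg
      · rw [norm_cpow_real, hηn, ← Real.rpow_mul hξp.le, one_div_mul_cancel hlv.ne', Real.rpow_one]
      · rw [h.pow_arg hrep.le hη0, hηa]; field_simp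
    have hzz : Corner.zz v z1 ξ = t := by
      have h1 : t - z1 ≠ 0 := norm_pos_iff.1 htzp
      have h2 : 1 + ξ = (v - z1) / (t - z1) := by rw [hξ, Corner.X]; field_simp; ring
      have h3 := sub_ne_zero.2 h.ne.symm
      rw [Corner.zz, h2, hξ, Corner.X]; field_simp; ring
    have hb := hH n q hq η hrep (by rw [hηn]; exact Real.rpow_lt_one hξp.le hξu (by positivity))
    rw [hηξ, hzz] at hb
    refine hb.trans ?_
    have e1 : (rsq η.re)⁻¹ ≤ (rsq κ)⁻¹ * ‖η‖ ^ (-(1/2):ℝ) := by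
      rw [Real.rpow_neg hηp.le, ← Real.sqrt_eq_rpow, ← mul_inv, ← Real.sqrt_mul hκ0.le]
      gcongr
    have e2 : ‖η‖ ^ (-(1/2):ℝ) * ‖η‖ ^ (-((lv - 1) / 2)) ≤ c0 ^ (-(1/2):ℝ) * s ^ (-(1/2):ℝ) := by
      rw [← Real.rpow_add hηp, hηn, ← Real.rpow_mul hξp.le, ← Real.mul_rpow hc0p.le hs0.le,
        show 1 / lv * (-(1 / 2) + -((lv - 1) / 2)) = -(1/2) by field_simp; ring]
      exact Real.rpow_le_rpow_of_nonpos hcs hξl (by norm_num)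
    have e3 : rexp (-c1 * (n * η.re)) ≤ rexp (-(cm * n) * s ^ (1 / lv)) := by
      apply Real.exp_le_exp.2
      have : κ * (c0 ^ (1/lv) * s ^ (1 / lv)) ≤ η.re := by
        refine le_trans ?_ hre
        rw [hηn, ← Real.mul_rpow hc0p.le hs0.le]
        gcongr
      have h2 : cm * s ^ (1 / lv) ≤ c1 * η.re := calc
        cm * s ^ (1/lv) ≤ c1 * (κ * c0 ^ (1/lv)) * s ^ (1/lv) := by gcongr; exact min_le_left _ _
        _ = c1 * (κ * (c0 ^ (1/lv) * s ^ (1 / lv))) := by ring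
        _ ≤ _ := by gcongr
      have h3 : (n:ℝ) * (cm * s ^ (1 / lv)) ≤ n * (c1 * η.re) := by gcongr
      linarith
    calc C1 * E.qn q * ((rsq η.re)⁻¹ * ‖η‖ ^ (-((lv - 1) / 2)) * rexp (-c1 * (n * η.re)))
        ≤ C1 * E.qn q * ((rsq κ)⁻¹ * ‖η‖ ^ (-(1/2):ℝ) * ‖η‖ ^ (-((lv - 1) / 2)) * rexp (-(cm * n) * s ^ (1 / lv))) := by gcongr
      _ = C1 * E.qn q * ((rsq κ)⁻¹ * (‖η‖ ^ (-(1/2):ℝ) * ‖η‖ ^ (-((lv - 1) / 2))) * rexp (-(cm * n) * s ^ (1 / lv))) := by ring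
      _ ≤ C1 * E.qn q * ((rsq κ)⁻¹ * (c0 ^ (-(1/2):ℝ) * s ^ (-(1/2):ℝ)) * rexp (-(cm * n) * s ^ (1 / lv))) := by gcongr
      _ = (C1 * ((rsq κ)⁻¹ * c0 ^ (-(1/2):ℝ)) + 0) * E.qn q * (s ^ (-(1/2):ℝ) * rexp (-(cm * n) * s ^ (1 / lv))) := by ring
      _ ≤ _ := by gcongr
  · have hs2 := hs.2
    have hmem : ep e s ∈ Icc u1 (1 - u1) := by
      cases e <;> simp [ep] <;> constructor <;> linarith [(min_le_left (min u0 (1/2)) (D / (4 * CL))).trans (min_le_right u0 (1/2))]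
    refine (hH2 n q hq _ ⟨_, hmem, rfl⟩).trans ?_
    have h1 : 1 ≤ s ^ (-(1/2):ℝ) := Real.one_le_rpow_of_pos_of_le_one_of_nonpos hs0 (by linarith) (by norm_num)
    have h2 : s ^ (1/lv) ≤ 1 := Real.rpow_le_one hs0.le (by linarith) (by positivity)
    have h3 : rexp (-c2 * n) ≤ rexp (-(cm * n) * s ^ (1 / lv)) := by
      apply Real.exp_le_exp.2
      have : n * (cm * s ^ (1/lv)) ≤ n * (c2 * 1) := by gcongr; exact min_le_right _ _
      linarith
    calc C2 * E.qn q * rexp (-c2 * n) ≤ C2 * E.qn q * (1 * rexp (-(cm * n) * s ^ (1 / lv))) := by rw [one_mul]; gcongr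
      _ ≤ (0 + C2) * E.qn q * (s ^ (-(1/2):ℝ) * rexp (-(cm * n) * s ^ (1 / lv))) := by rw [zero_add]; gcongr
      _ ≤ _ := by gcongr; positivity
end Geo
namespace Geo
variable {G F : Set ℂ}
theorem rate {lam lv c : ℝ} (h0 : 0 < lam) (hl : lam ≤ lv) (h2 : lv < 2) (hc : 0 < c) :
    ∃ C > 0, ∀ n : ℕ, 0 < n → ∫ s in Ioi rO, s ^ (Corner.b lv / 2 - 1) * rexp (-(c * n) * s ^ (1 / lv)) ≤ C * (n:ℝ) ^ (-(lam / (4 - 2 * lam))) := by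
  have hlv : 0 < lv := by linarith
  have hb : 0 < Corner.b lv := by unfold Corner.b; exact one_div_pos.2 (by linarith)
  set p := (Corner.b lv / 2 - 1 + 1) / (1 / lv) with hp
  have hp0 : 0 < p := by rw [hp, sub_add_cancel]; positivity
  have hp1 : p = lv / (4 - 2 * lv) := by
    rw [hp, sub_add_cancel, Corner.b]
    grind
  have hple : lam / (4 - 2 * lam) ≤ p := by
    rw [hp1, div_le_div_iff₀ (by linarith) (by linarith)]; nlinarith
  have hG := Real.Gamma_pos_of_pos hp0
  refine ⟨c ^ (-p) * (1 / (1 / lv)) * Real.Gamma p, by positivity, fun n hn => ?_⟩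
  have hn0 : rO < n := by exact_mod_cast hn
  rw [integral_rpow_mul_exp_neg_mul_rpow (by positivity) (by linarith) (by positivity), ← hp, neg_div, ← hp, Real.mul_rpow hc.le hn0.le]
  have : n ^ (-p) ≤ (n:ℝ) ^ (-(lam / (4 - 2 * lam))) := Real.rpow_le_rpow_of_exponent_le (by exact_mod_cast hn) (by linarith)
  calc c ^ (-p) * n ^ (-p) * (1 / (1 / lv)) * Real.Gamma p = c ^ (-p) * (1 / (1 / lv)) * Real.Gamma p * n ^ (-p) := by ring
    _ ≤ _ := by gcongr
theorem rho_le (E : Geo G F) (j : Fin E.M) : ∃ C > 0, ∀ ζ kk, ∀ v ∈ UI, ‖E.rho kk ζ j v‖ ≤ C * ‖E.NN kk ζ (E.tG j v)‖ := by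
  have hc : ContinuousOn (fun v => (E.sg * (2 * π * I))⁻¹ * (E.AA j (pth (E.a j) v) * pthd (E.a j) v)) (Icc 0 1) :=
    continuousOn_const.mul (((E.AA_diff j).continuousOn.comp (pth_continuous _).continuousOn fun v hv => E.Th_sub j (pth_mem _ hv)).mul (pthd_continuous _).continuousOn)
  obtain ⟨B, hB⟩ := isCompact_Icc.exists_bound_of_continuousOn hc
  refine ⟨|B| + 1, by positivity, fun ζ kk v hv => ?_⟩
  have e : ‖E.rho kk ζ j v‖ = ‖(E.sg * (2 * π * I))⁻¹ * (E.AA j (pth (E.a j) v) * pthd (E.a j) v)‖ * ‖E.NN kk ζ (E.tG j v)‖ := by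
    rw [rho, RCLike.norm_conj, ← norm_mul]; ring
  rw [e]
  gcongr
  grind
theorem RK.NN_contOn {E : Geo G F} {ζ : ℂ} {kk : Fin E.M → ℝ → ℂ} (h : E.RK ζ kk) (j : Fin E.M) : ContinuousOn (fun v => E.NN kk ζ (E.tG j v)) (Ioo 0 1) := by
  intro v hv
  have h1 : ContinuousAt (E.NN kk ζ) (E.tG j v) := by
    refine ContinuousAt.add (E.Phi_hasDeriv (fun i => MemLp.int01 (h.gN_lp i)) fun hf => ?_).continuousAt ?_
    · rw [E.G_open.frontier_eq] at hf; exact hf.2 (E.inG j v hv)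
    · refine (continuousAt_id.sub continuousAt_const).inv₀ (sub_ne_zero.2 fun e => ?_)
      exact E.avoid j _ (pth_mem _ (Ioo_subset_Icc_self hv)) (by
        have : E.τ j (pth (E.a j) v) = ζ := e
        rw [this]; exact h.mem)
  exact ContinuousAt.comp_continuousWithinAt h1 ((E.tG_contOn j v (Ioo_subset_Icc_self hv)).mono Ioo_subset_Icc_self)
theorem main_est (E : Geo G F) {lam : ℝ} (h0 : 0 < lam) (hE : ∀ j e, E.EndD lam j e) :
    ∃ C > 0, ∀ ζ ∈ F, ∀ n : ℕ, 0 < n → ∀ q, E.Orth n q → ‖q.eval ζ‖ ≤ C * E.qn q * (n:ℝ) ^ (-(lam / (4 - 2 * lam))) := by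
  obtain ⟨C0, hC0, hker⟩ := E.exists_kernel
  choose z1 lv hlv hcor u0 hu0 δ hδ hδ1 harg using hE
  choose CN hCN hN using fun j e => E.endN (hcor j e) C0
  choose CH hCH cH hcH hH using fun j e => E.endH (hcor j e) (hu0 j e) (hδ j e) (hδ1 j e) (harg j e)
  choose CR hCR hR using E.rho_le
  choose CI hCI hI using fun j e => rate h0 (hlv j e) (hcor j e).l2 (hcH j e)
  have hb : ∀ j e, 0 < Corner.b (lv j e) := fun j e => (hcor j e).b_pos
  have hl0 : ∀ j e, 0 < lv j e := fun j e => (hcor j e).l0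
  refine ⟨∑ j, ∑ e, CR j * CN j e * CH j e * CI j e + 1, by
    have : 0 ≤ ∑ j, ∑ e, CR j * CN j e * CH j e * CI j e := sum_nonneg fun j _ => sum_nonneg fun e _ => by
      have := hCR j; have := hCN j e; have := hCH j e; have := hCI j e; positivity
    linarith, fun ζ hζ n hn q hq => ?_⟩
  have hqn := E.qn_nonneg q
  obtain ⟨kk, k1, k2, k3, k4⟩ := hker ζ hζ
  have hRK : E.RK ζ kk := ⟨hζ, k1, k2, k4⟩
  have hpow : ∀ {s x : ℝ}, 0 < s → s ^ ((x - 1) / 2) * s ^ (-(1/2):ℝ) = s ^ (x / 2 - 1) := fun {s x} hs => by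
    rw [← Real.rpow_add hs]; congr 1; ring
  have hNI : E.NI kk ζ := fun j => by
    refine (two_ends (ContinuousOn.aestronglyMeasurable ?_ measurableSet_Ioo)
      (fun e s => CN j e * rsq 2 * rexp 1 * (s ^ (Corner.b (lv j e) / 2 - 1) * rexp (-1 * s ^ rI))) (fun e => ?_) (fun e s hs => ?_) (fun e s hs => ?_)).1
    · refine (hRK.NN_contOn j).mul (continuous_ofReal.comp_continuousOn (ContinuousOn.inv₀ (by fun_prop) fun v hv => ?_))
      exact (Real.sqrt_pos.2 (mul_pos hv.1 (by linarith [hv.2]))).ne'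
    · exact (integrableOn_rpow_mul_exp_neg_mul_rpow (by have := hb j e; linarith) one_pos one_pos).const_mul _
    · have := hCN j e; positivity
    · have h1 := hN j e ζ kk hRK k3 s hs
      have hs0 := hs.1
      have h2 : (rsq (ep e s * (1 - ep e s)))⁻¹ ≤ rsq 2 * s ^ (-(1/2):ℝ) := by
        rw [Real.rpow_neg hs0.le, ← Real.sqrt_eq_rpow]
        calc _ ≤ (rsq (s / 2))⁻¹ := by gcongr; exact ep_mul e hs
          _ = _ := by rw [Real.sqrt_div hs0.le, inv_div, div_eq_mul_inv]
      have h3 : 1 ≤ rexp 1 * rexp (-1 * s ^ rI) := by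
        rw [← Real.exp_add, Real.rpow_one]; exact Real.one_le_exp (by linarith [hs.2])
      have hc := hCN j e
      rw [norm_mul, norm_real, Real.norm_of_nonneg (by positivity)]
      calc _ ≤ CN j e * s ^ ((Corner.b (lv j e) - 1) / 2) * (rsq 2 * s ^ (-(1/2):ℝ)) := by gcongr
        _ = CN j e * rsq 2 * s ^ (Corner.b (lv j e) / 2 - 1) * 1 := by rw [← hpow hs0]; ring
        _ ≤ CN j e * rsq 2 * s ^ (Corner.b (lv j e) / 2 - 1) * (rexp 1 * rexp (-1 * s ^ rI)) := by gcongr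
        _ = _ := by ring
  have hrep := hRK.repr hNI q
  have hint : ∀ j, ‖∫ v, E.rho kk ζ j v * E.HH q (E.tE j v) ∂m01‖ ≤ ∑ e, CR j * CN j e * CH j e * CI j e * (E.qn q * (n:ℝ) ^ (-(lam / (4 - 2 * lam)))) := fun j => by
    have hHc : ContinuousOn (fun v => E.HH q (E.tE j v)) (Ioo 0 1) := fun v hv =>
      ContinuousAt.comp_continuousWithinAt (g := E.HH q) (E.HH_diff q fun hf => E.tE_notK j hv (frontier_subset_closure hf)).continuousAt
        ((E.tE_contOn j v (Ioo_subset_Icc_self hv)).mono Ioo_subset_Icc_self)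
    have hn0 : rO < n := by exact_mod_cast hn
    refine (two_ends ((hNI.rho_int j).aestronglyMeasurable.mul (hHc.aestronglyMeasurable measurableSet_Ioo))
      (fun e s => CR j * CN j e * CH j e * E.qn q * (s ^ (Corner.b (lv j e) / 2 - 1) * rexp (-(cH j e * n) * s ^ (1 / lv j e)))) (fun e => ?_) (fun e s hs => ?_) (fun e s hs => ?_)).2.trans ?_
    · have := hb j e; have := hl0 j e; have := hcH j e
      exact (integrableOn_rpow_mul_exp_neg_mul_rpow (by linarith) (by positivity) (by positivity)).const_mul _
    · have := hCN j e; have := hCR j; have := hCH j e; positivity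
    · have hs0 := hs.1
      have h1 := hN j e ζ kk hRK k3 s hs
      have h3 := hH j e n q hq s hs
      have := hCN j e; have := hCR j
      show ‖E.rho kk ζ j (ep e s) * E.HH q (E.tE j (ep e s))‖ ≤ _
      rw [norm_mul]
      calc _ ≤ CR j * (CN j e * s ^ ((Corner.b (lv j e) - 1) / 2)) * (CH j e * E.qn q * (s ^ (-(1/2):ℝ) * rexp (-(cH j e * n) * s ^ (1 / lv j e)))) := by
            gcongr; exact (hR j ζ kk _ (Ioo_subset_Icc_self (ep_mem e hs))).trans (by gcongr)
        _ = _ := by rw [← hpow hs0]; ring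
    · refine sum_le_sum fun e _ => ?_
      have := hCN j e; have := hCR j; have := hCH j e
      rw [integral_const_mul]
      calc _ ≤ CR j * CN j e * CH j e * E.qn q * (CI j e * (n:ℝ) ^ (-(lam / (4 - 2 * lam)))) := by gcongr; exact hI j e n hn
        _ = _ := by ring
  have hnorm : ‖q.eval ζ‖ ≤ ‖E.sg * (2 * π * I) * conj (q.eval ζ)‖ := by
    rw [norm_mul, RCLike.norm_conj, norm_mul, E.sg_norm]
    have : rI ≤ 2 * π := by linarith [Real.pi_gt_three]
    have e : ‖(2 * π * I : ℂ)‖ = 2 * π := by simp [abs_of_pos Real.pi_pos]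
    nlinarith [norm_nonneg (q.eval ζ)]
  refine hnorm.trans ?_
  rw [hrep]
  refine (norm_sum_le _ _).trans ((sum_le_sum fun j _ => hint j).trans ?_)
  simp_rw [← sum_mul]
  rw [mul_assoc]
  gcongr
  linarith
end Geo
theorem span_zero {p : ℕ → PC} (hd : ∀ k, (p k).natDegree = k) (hne : ∀ k, (p k).leadingCoeff ≠ 0)
    (A : PC →ₗ[ℂ] ℂ) (n : ℕ) (hA : ∀ k ≤ n, A (p k) = 0) : ∀ k ≤ n + 1, ∀ P : PC, (∀ m, k ≤ m → P.coeff m = 0) → A P = 0 := by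
  intro k
  induction k with
  | zero => intro _ P hP
            have : P = 0 := Polynomial.ext fun m => by simpa using hP m (Nat.zero_le m)
            grind
  | succ k ih =>
    intro hk P hP
    have hc : (p k).coeff k ≠ 0 := by have := hne k; rwa [Polynomial.leadingCoeff, hd k] at this
    have := ih (by omega) (P - (P.coeff k / (p k).coeff k) • p k) fun m hm => by
      rcases hm.eq_or_lt with rfl | hm
      · simp [hc]
      · rw [Polynomial.coeff_sub, Polynomial.coeff_smul, hP m hm, Polynomial.coeff_eq_zero_of_natDegree_lt (n := m) (by grind)]; simp
    rw [map_sub, map_smul, hA k (by omega), smul_zero, sub_zero] at this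
    grind
theorem final_of_geom (D : JordanDomain) (lam : ℝ) (hlam0 : 0 < lam)
    (p : ℕ → PC) (hp : D.IsONPolys p) (F : Set ℂ) (E : Geo D.G F) (hE : ∀ j e, E.EndD lam j e)
    (hint : ∀ g : ℂ → ℂ, Continuous g → ∫ s in rO..D.l, g (D.γ s) = ∑ j, ∫ u, (E.Wt j u : ℂ) * g (E.τ j u) ∂m01) :
    ∃ C : ℝ, 0 < C ∧ ∀ ζ ∈ F, ∀ n : ℕ, 0 < n →
      rsq (∑' k : ℕ, ‖(p (n + 1 + k)).eval ζ‖ ^ 2) ≤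
        C * (n : ℝ) ^ (-(lam / (4 - 2 * lam))) := by
  obtain ⟨C, hC, hmain⟩ := E.main_est hlam0 hE
  obtain ⟨hp1, hp2, hp3⟩ := hp
  have hl := D.l_pos
  have hlC : (D.l : ℂ) ≠ 0 := by exact_mod_cast hl.ne'
  have hon : ∀ j k, (∫ s in rO..D.l, (p j).eval (D.γ s) * conj ((p k).eval (D.γ s))) = if j = k then (D.l : ℂ) else 0 := fun j k => by
    have h := hp3 j k
    grind
  have hii : ∀ P Q : PC, IntervalIntegrable (fun s => P.eval (D.γ s) * conj (Q.eval (D.γ s))) volume 0 D.l := fun P Q =>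
    ((P.continuous.comp D.γ_cont).mul (continuous_conj.comp (Q.continuous.comp D.γ_cont))).intervalIntegrable _ _
  have hne : ∀ k, (p k).leadingCoeff ≠ 0 := fun k => by
    obtain ⟨c, hc, e⟩ := hp2 k; rw [e]; exact_mod_cast hc.ne'
  have key : ∀ ζ ∈ F, ∀ n : ℕ, 0 < n → ∀ N, rsq (∑ k ∈ Finset.range N, ‖(p (n + 1 + k)).eval ζ‖ ^ 2) ≤ C * rsq D.l * n ^ (-(lam / (4 - 2 * lam))) := by
    intro ζ hζ n hn N
    set S := ∑ k ∈ Finset.range N, ‖(p (n + 1 + k)).eval ζ‖ ^ 2 with hS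
    have hS0 : 0 ≤ S := sum_nonneg fun _ _ => by positivity
    set q : PC := ∑ k ∈ Finset.range N, (conj ((p (n + 1 + k)).eval ζ)) • p (n + 1 + k) with hq
    let B : PC → PC →ₗ[ℂ] ℂ := fun Q =>
      { toFun := fun P => ∫ s in rO..D.l, P.eval (D.γ s) * conj (Q.eval (D.γ s))
        map_add' := fun P R => by
          rw [← intervalIntegral.integral_add (hii P Q) (hii R Q)]; congr 1; funext s; simp; ring
        map_smul' := fun c P => by
          simp only [smul_eq_mul]
          rw [← intervalIntegral.integral_const_mul]; congr 1; funext s; simp; ring }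
    have hBd : ∀ P Q, B Q P = ∫ s in rO..D.l, P.eval (D.γ s) * conj (Q.eval (D.γ s)) := fun P Q => rfl
    have hB1 : ∀ j k, B (p k) (p j) = if j = k then (D.l : ℂ) else 0 := fun j k => hon j k
    have hconj : ∀ P Q, B Q P = conj (B P Q) := fun P Q => by
      rw [hBd, hBd, intervalIntegral.integral_of_le hl.le, intervalIntegral.integral_of_le hl.le, ← integral_conj]; congr 1; funext s; simp; ring
    have hBq : ∀ k, B q (p k) = conj (∑ i ∈ Finset.range N, conj ((p (n + 1 + i)).eval ζ) * (if n + 1 + i = k then (D.l:ℂ) else 0)) := fun k => by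
      rw [hconj, hq, map_sum]; congr 1
      refine sum_congr rfl fun i _ => ?_
      rw [map_smul, hB1, smul_eq_mul]
    have horth : E.Orth n q := fun P hP => by
      have h0 : B q P = 0 := by
        refine span_zero hp1 hne (B q) n (fun k hk => ?_) (n + 1) le_rfl P fun m hm => Polynomial.coeff_eq_zero_of_natDegree_lt (by omega)
        rw [hBq, Finset.sum_eq_zero, map_zero]
        grind
      have h1 := hint (fun z => P.eval z * conj (q.eval z)) (P.continuous.mul (continuous_conj.comp q.continuous))
      rw [hBd] at h0
      grind
    have hqζ : q.eval ζ = S := by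
      rw [hq, Polynomial.eval_finset_sum, hS]
      push_cast
      refine sum_congr rfl fun i _ => ?_
      rw [Polynomial.eval_smul, smul_eq_mul, conj_mul']
    have hqq : B q q = D.l * S := by
      rw [map_sum, hS]; push_cast
      rw [mul_sum]
      refine sum_congr rfl fun i hi => ?_
      rw [map_smul, hBq, sum_eq_single i]
      · simp; rw [← conj_mul']; ring
      · grind
      · grind
    have hqn : E.qn q = rsq D.l * rsq S := by
      rw [← Real.sqrt_mul hl.le, Geo.qn]; congr 1
      have h1 := hint (fun z => q.eval z * conj (q.eval z)) (q.continuous.mul (continuous_conj.comp q.continuous))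
      rw [← hBd, hqq] at h1
      have h2 : ∀ j, ∫ u, (E.Wt j u : ℂ) * (q.eval (E.τ j u) * conj (q.eval (E.τ j u))) ∂m01 = ((∫ u, E.Wt j u * ‖q.eval (E.τ j u)‖ ^ 2 ∂m01 : ℝ) : ℂ) := fun j => by
        rw [← integral_complex_ofReal]; congr 1; funext u; rw [Complex.mul_conj']; push_cast; ring
      rw [sum_congr rfl fun j _ => h2 j] at h1
      exact_mod_cast h1.symm
    have hm := hmain ζ hζ n hn q horth
    rw [hqζ, hqn, norm_real, Real.norm_of_nonneg hS0] at hm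
    by_cases hz : S = 0
    · rw [hz, Real.sqrt_zero]; positivity
    have hsS := Real.sqrt_pos.2 (lt_of_le_of_ne hS0 (Ne.symm hz))
    have : rsq S * rsq S ≤ (C * rsq D.l * n ^ (-(lam / (4 - 2 * lam)))) * rsq S := by grind
    exact le_of_mul_le_mul_right this hsS
  refine ⟨C * rsq D.l, by positivity, fun ζ hζ n hn => ?_⟩
  set R := C * rsq D.l * n ^ (-(lam / (4 - 2 * lam))) with hR
  have hR0 : 0 ≤ R := by positivity
  rw [Real.sqrt_le_left hR0]
  refine Real.tsum_le_of_sum_range_le (fun k => by positivity) fun N => ?_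
  exact (Real.sqrt_le_left hR0).1 (key ζ hζ n hn N)
theorem Ystep {G : Set ℂ} (hK : IsCompact (closure G)) {w w' : ℂ} (h' : w' ∈ Yset G) (hw : w ∉ closure G)
    (h : ∀ z ∈ closure G, ‖w' - w‖ ≤ 1 / 2 * ‖w' - z‖) : w ∈ Yset G := by
  refine ⟨hw, ?_⟩
  have hne : ∀ z ∈ closure G, w' - z ≠ 0 := fun z hz h0 => h'.1 (by grind)
  have h1 : PA (closure G) (fun z => (w' - w) * (w' - z)⁻¹) := h'.2.cmul _
  refine (h'.2.mul hK (PA.neumann hK h1 fun z hz => by rw [norm_mul, norm_inv, ← div_eq_mul_inv, div_le_iff₀ (norm_pos_iff.2 (hne z hz))]; exact h z hz)).congr fun z hz => ?_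
  grind
theorem Yloc {G : Set ℂ} (hK : IsCompact (closure G)) {w : ℂ} (hw : w ∉ closure G) :
    ∃ r > 0, ∀ w', ‖w' - w‖ < r → w' ∉ closure G ∧ (w' ∈ Yset G ↔ w ∈ Yset G) := by
  obtain ⟨d, hd, hb⟩ := isOpen_iff.1 isClosed_closure.isOpen_compl w hw
  have hz : ∀ z ∈ closure G, d ≤ ‖w - z‖ := fun z hz => by
    by_contra hc; push Not at hc
    exact hb (by rw [mem_ball, dist_eq_norm, norm_sub_rev]; exact hc) hz
  refine ⟨d / 4, by positivity, fun w' hw' => ?_⟩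
  have hw'K := hb (by rw [mem_ball, dist_eq_norm]; linarith)
  refine ⟨hw'K, fun h => Ystep hK h hw fun z hz1 => ?_, fun h => Ystep hK h hw'K fun z hz1 => ?_⟩
  · have := hz z hz1
    have h3 := norm_add_le (w - w') (w' - z)
    rw [norm_sub_rev w w', sub_add_sub_cancel] at h3; linarith
  · have := hz z hz1
    rw [norm_sub_rev]; linarith
theorem Yopen {G : Set ℂ} (hK : IsCompact (closure G)) : IsOpen (Yset G) := by
  rw [Metric.isOpen_iff]
  intro w hw
  obtain ⟨r, hr, h⟩ := Yloc hK hw.1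
  exact ⟨r, hr, fun w' hw' => (h w' (by rwa [← dist_eq_norm])).2.2 hw⟩
theorem Ysub {G S : Set ℂ} (hK : IsCompact (closure G)) (hS : IsPreconnected S) (hSK : ∀ z ∈ S, z ∉ closure G)
    {x : ℂ} (hx : x ∈ S) (hxY : x ∈ Yset G) : S ⊆ Yset G := by
  have hop : IsOpen {w | w ∉ closure G ∧ w ∉ Yset G} := by
    rw [Metric.isOpen_iff]
    intro w hw
    obtain ⟨r, hr, h⟩ := Yloc hK hw.1
    refine ⟨r, hr, fun w' hw' => ?_⟩
    have := h w' (by rwa [← dist_eq_norm])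
    grind
  refine hS.subset_left_of_subset_union (Yopen hK) hop ?_ (fun z hz => ?_) ⟨x, hx, hxY⟩
  · grind
  · grind
theorem Ynonempty {G : Set ℂ} (hb : Bornology.IsBounded G) : (Yset G).Nonempty := by
  obtain ⟨R, hR⟩ := hb.closure.exists_norm_le
  set A : ℝ := 2 * |R| + 1
  have hA : 0 < A := by positivity
  have hz : ∀ z ∈ closure G, ‖(A : ℂ)⁻¹ * z‖ ≤ 1 / 2 := fun z hz => by
    rw [norm_mul, norm_inv, norm_real, Real.norm_of_nonneg hA.le, inv_mul_le_iff₀ hA]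
    grind
  have hA' : (A : ℂ) ≠ 0 := by exact_mod_cast hA.ne'
  refine ⟨A, fun h => ?_, ?_⟩
  · have := hz _ h
    rw [inv_mul_cancel₀ hA'] at this; norm_num at this
  · refine ((PA.neumann hb.isCompact_closure (PA.ident.cmul _) hz).cmul A⁻¹).congr fun z hz' => ?_
    grind
theorem Yfrontier {G : Set ℂ} (hG : IsOpen G) (hne : G.Nonempty) (hb : Bornology.IsBounded G) {J : Set ℂ}
    (hJ : J.Finite) : ∃ x ∈ frontier G, x ∉ J ∧ x ∈ closure (Yset G) := by
  have hK := hb.isCompact_closure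
  by_contra hcon
  push Not at hcon
  have hrk : 1 < Module.rank ℝ ℂ := by norm_num
  have hd := hJ.countable.dense_compl ℝ
  have hdis : ∀ z ∈ G, z ∉ closure (Yset G) := fun z hz hzc => by
    obtain ⟨y, hy, hyY⟩ := mem_closure_iff.1 hzc G hG hz
    exact hyY.1 (subset_closure hy)
  obtain ⟨y, hyY, hyJ⟩ := hd.inter_open_nonempty _ (Yopen hK) (Ynonempty hb)
  obtain ⟨g, hgG, hgJ⟩ := hd.inter_open_nonempty _ hG hne
  have hsub : Jᶜ ⊆ Yset G := by
    refine ((hJ.countable.isConnected_compl_of_one_lt_rank hrk).isPreconnected).subset_left_of_subset_union (Yopen hK) (isClosed_closure (s := Yset G)).isOpen_compl ?_ (fun z hz => ?_) ⟨y, hyJ, hyY⟩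
    · rw [disjoint_left]; exact fun a ha h => h (subset_closure ha)
    · by_cases h : z ∈ closure (Yset G)
      · by_cases hzK : z ∈ closure G
        · exfalso
          by_cases hzG : z ∈ G
          · grind
          · exact hcon z (by rw [hG.frontier_eq]; exact ⟨hzK, hzG⟩) hz h
        · obtain ⟨r, hr, hl⟩ := Yloc hK hzK
          obtain ⟨w, hw, hwr⟩ := mem_closure_iff.1 h r hr
          rw [dist_comm, dist_eq_norm] at hwr
          grind
      · grind
  exact (hsub hgJ).1 (subset_closure hgG)
structure HE (G : Set ℂ) (v : ℂ) (h : Bool → ℝ → ℂ) (w : Bool → ℂ) : Prop where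
  op : IsOpen G
  w0 : ∀ k, w k ≠ 0
  quad : ∃ K > 0, ∃ r > 0, ∀ k, ∀ s ∈ Icc rO r, ‖h k s - v - w k * s‖ ≤ K * s ^ 2
  fr : ∀ k, ∀ s ∈ UI, h k s ∈ frontier G
  loc : ∀ ε > 0, ∃ r > 0, ∀ z ∈ frontier G, ‖z - v‖ < r → ∃ k, ∃ s ∈ Ico rO ε, z = h k s
def CD (S : Set ℂ) (v d : ℂ) : Prop :=
  ∃ δ > 0, ∃ r > 0, ∀ ρ ∈ Ioo rO r, ∀ z, ‖z - v - ρ * d‖ < δ * ρ → z ∈ S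
def cone (v d : ℂ) (δ r : ℝ) : Set ℂ := {z | ∃ ρ ∈ Ioo rO r, ‖z - v - ρ * d‖ < δ * ρ}
theorem cone_convex (v d : ℂ) (δ r : ℝ) : Convex ℝ (cone v d δ r) := by
  rintro x ⟨ρ, hρ, hx⟩ y ⟨σ, hσ, hy⟩ a b ha hb hab
  refine ⟨a * ρ + b * σ, (convex_Ioo rO r) hρ hσ ha hb hab, ?_⟩
  have : a • x + b • y - v - ((a * ρ + b * σ : ℝ) : ℂ) * d = a * (x - v - ρ * d) + b * (y - v - σ * d) := by
    have h1 : (a : ℂ) + b = 1 := by exact_mod_cast hab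
    simp only [real_smul]; push_cast; linear_combination v * h1
  rw [this]
  refine (norm_add_le _ _).trans_lt ?_
  rw [norm_mul, norm_mul, norm_real, norm_real, Real.norm_of_nonneg ha, Real.norm_of_nonneg hb]
  rcases ha.eq_or_lt with rfl | ha'
  · have : b = 1 := by linarith
    subst this; linarith
  · nlinarith
theorem CD.smul {S : Set ℂ} {v d : ℂ} (h : CD S v d) {c : ℝ} (hc : 0 < c) : CD S v (c * d) := by
  obtain ⟨δ, hδ, r, hr, h⟩ := h
  refine ⟨δ * c, by positivity, r / c, by positivity, fun ρ hρ z hz => h (ρ * c) ⟨mul_pos hρ.1 hc, ?_⟩ z ?_⟩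
  · exact (lt_div_iff₀ hc).1 hρ.2
  · push_cast; rw [mul_assoc]; calc _ < _ := hz
      _ = _ := by ring
theorem CD.disj {S T : Set ℂ} {v d : ℂ} (hS : CD S v d) (hT : CD T v d) : ∃ z, z ∈ S ∧ z ∈ T := by
  obtain ⟨δ, hδ, r, hr, h⟩ := hS
  obtain ⟨δ', hδ', r', hr', h'⟩ := hT
  set ρ := min r r' / 2
  have h0 : 0 < ρ := by positivity
  have h1 : ρ < r := by grind
  have h2 : ρ < r' := by grind
  have hz : ‖v + ρ * d - v - ρ * d‖ = 0 := by rw [norm_eq_zero]; ring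
  exact ⟨v + ρ * d, h ρ ⟨h0, h1⟩ _ (by rw [hz]; positivity), h' ρ ⟨h0, h2⟩ _ (by rw [hz]; positivity)⟩
theorem CD.isOpen (S : Set ℂ) (v : ℂ) : IsOpen {d | CD S v d} := by
  rw [Metric.isOpen_iff]
  rintro d ⟨δ, hδ, r, hr, h⟩
  refine ⟨δ / 2, by positivity, fun d' hd' => ⟨δ / 2, by positivity, r, hr, fun ρ hρ z hz => h ρ hρ z ?_⟩⟩
  rw [mem_ball, dist_eq_norm] at hd'
  have : z - v - ρ * d = (z - v - ρ * d') + ρ * (d' - d) := by ring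
  rw [this]
  refine (norm_add_le _ _).trans_lt ?_
  rw [norm_mul, norm_real, Real.norm_of_nonneg hρ.1.le]
  nlinarith [mul_lt_mul_of_pos_left hd' hρ.1]
theorem CD.ev {S : Set ℂ} {v d : ℂ} (h : CD S v d) {g : ℝ → ℂ} (hg : Tendsto (fun s : ℝ => (g s - v) / s) N0 (nhds d)) :
    ∀ᶠ s in N0, g s ∈ S := by
  obtain ⟨δ, hδ, r, hr, h⟩ := h
  filter_upwards [hg (ball_mem_nhds d hδ), Ioo_mem_nhdsGT hr] with s hs hs'
  refine h s hs' _ ?_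
  have h0 : (s : ℂ) ≠ 0 := by exact_mod_cast hs'.1.ne'
  have : g s - v - s * d = s * ((g s - v) / s - d) := by field_simp
  rw [this, norm_mul, norm_real, Real.norm_of_nonneg hs'.1.le, mul_comm]
  rw [mem_preimage, mem_ball, dist_eq_norm] at hs
  exact mul_lt_mul_of_pos_right hs hs'.1
theorem transv {w d : ℂ} (hw : w ≠ 0) (hd : ∀ c : ℝ, 0 ≤ c → d ≠ c * w) :
    ∃ c > 0, ∀ s ρ : ℝ, 0 ≤ s → 0 ≤ ρ → c * (s + ρ) ≤ ‖w * s - d * ρ‖ := by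
  obtain ⟨t, ht, hmin⟩ := isCompact_Icc.exists_isMinOn (nonempty_Icc.2 (zero_le_one' ℝ))
    (f := fun t => ‖w * ((1 - t : ℝ) : ℂ) - d * t‖) (by fun_prop)
  refine ⟨‖w * ((1 - t : ℝ) : ℂ) - d * t‖, norm_pos_iff.2 fun h0 => ?_, fun s ρ hs hρ => ?_⟩
  · rcases ht.1.eq_or_lt with rfl | h
    · simp at h0; exact hw h0
    · refine hd ((1 - t) / t) (div_nonneg (by grind) h.le) ?_
      push_cast at h0 ⊢
      grind
  · rcases (add_nonneg hs hρ).eq_or_lt with h | h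
    · rw [← h]; simp
    · have h1 : ρ / (s + ρ) ∈ UI := ⟨by positivity, by rw [div_le_one h]; linarith⟩
      have h3 : w * s - d * ρ = ((s + ρ : ℝ) : ℂ) * (w * ((1 - ρ / (s + ρ) : ℝ) : ℂ) - d * (ρ / (s + ρ) : ℝ)) := by
        have : (s : ℂ) + ρ ≠ 0 := by exact_mod_cast h.ne'
        push_cast; field_simp; ring
      rw [h3, norm_mul, norm_real, Real.norm_of_nonneg h.le, mul_comm]
      exact mul_le_mul_of_nonneg_left (hmin h1) h.le
namespace HE
variable {G : Set ℂ} {v : ℂ} {h : Bool → ℝ → ℂ} {w : Bool → ℂ}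
theorem good (H : HE G v h w) {d : ℂ} (hd : ∀ k, ∀ c : ℝ, 0 ≤ c → d ≠ c * w k) :
    CD G v d ∨ CD (closure G)ᶜ v d := by
  obtain ⟨c0, hc0, h0⟩ := transv (H.w0 false) (hd false)
  obtain ⟨c1, hc1, h1⟩ := transv (H.w0 true) (hd true)
  obtain ⟨K, hK, r, hr, hq⟩ := H.quad
  set c := min c0 c1
  have hc := lt_min hc0 hc1
  have hT : ∀ k, ∀ s ρ : ℝ, 0 ≤ s → 0 ≤ ρ → c * (s + ρ) ≤ ‖w k * s - d * ρ‖ := by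
    intro k s ρ hs hρ
    cases k
    · exact (mul_le_mul_of_nonneg_right (min_le_left _ _) (by positivity)).trans (h0 s ρ hs hρ)
    · exact (mul_le_mul_of_nonneg_right (min_le_right _ _) (by positivity)).trans (h1 s ρ hs hρ)
  obtain ⟨r', hr', hl⟩ := H.loc (min r (c / K)) (lt_min hr (by positivity))
  set R := r' / (‖d‖ + c + 1)
  have hR : 0 < R := by positivity
  have miss : ∀ z ∈ cone v d c R, z ∉ frontier G := by
    rintro z ⟨ρ, hρ, hz⟩ hzf
    have hzv : ‖z - v‖ < r' := by
      have e : z - v = (z - v - ρ * d) + ρ * d := by ring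
      rw [e]
      refine (norm_add_le _ _).trans_lt ?_
      rw [norm_mul, norm_real, Real.norm_of_nonneg hρ.1.le]
      have := (lt_div_iff₀ (by positivity)).1 hρ.2
      grind
    obtain ⟨k, s, hs, rfl⟩ := hl z hzf hzv
    have a := hq k s ⟨hs.1, (hs.2.trans_le (min_le_left _ _)).le⟩
    have b := hT k s ρ hs.1 hρ.1.le
    have e : w k * s - d * ρ = (h k s - v - ρ * d) - (h k s - v - w k * s) := by ring
    rw [e] at b
    have b' := b.trans (norm_sub_le _ _)
    nlinarith [mul_nonneg hs.1 (sub_nonneg.2 ((lt_div_iff₀ hK).1 (hs.2.trans_le (min_le_right _ _))).le)]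
  by_cases hG : ∃ x ∈ cone v d c R, x ∈ G
  · left
    obtain ⟨x, hx, hxG⟩ := hG
    refine ⟨c, hc, R, hR, fun ρ hρ z hz => ?_⟩
    by_contra hzG
    obtain ⟨y, hy, hyf⟩ := meets_frontier H.op ((cone_convex v d c R).isPreconnected) hx hxG ⟨ρ, hρ, hz⟩ hzG
    grind
  · right
    push Not at hG
    refine ⟨c, hc, R, hR, fun ρ hρ z hz hzK => ?_⟩
    have hm : z ∈ cone v d c R := ⟨ρ, hρ, hz⟩
    exact miss z hm (by rw [H.op.frontier_eq]; exact ⟨hzK, hG z hm⟩)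
theorem const (H : HE G v h w) {A : Set ℂ} (hA : IsPreconnected A)
    (hd : ∀ d ∈ A, ∀ k, ∀ c : ℝ, 0 ≤ c → d ≠ c * w k) :
    (∀ d ∈ A, CD G v d) ∨ (∀ d ∈ A, CD (closure G)ᶜ v d) := by
  have hdis : Disjoint {d | CD G v d} {d | CD (closure G)ᶜ v d} := by
    rw [disjoint_left]
    intro d h1 h2
    obtain ⟨z, hz, hz'⟩ := CD.disj h1 h2
    exact hz' (subset_closure hz)
  exact hA.subset_or_subset (CD.isOpen G v) (CD.isOpen (closure G)ᶜ v) hdis fun d hdA => H.good (hd d hdA)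
end HE
theorem exp_ne_smul {θ θ' c : ℝ} (hc : 0 ≤ c) (hne : θ ≠ θ') (h : |θ - θ'| < 2 * π) {b : ℝ} (hb : 0 < b) :
    exp (θ * I) ≠ c * (b * exp (θ' * I)) := by
  intro he
  have hn := congrArg norm he
  rw [norm_mul, norm_mul, norm_exp_ofReal_mul_I, norm_exp_ofReal_mul_I, norm_real, norm_real,
    Real.norm_of_nonneg hc, Real.norm_of_nonneg hb.le, mul_one] at hn
  have : (c : ℂ) * b = 1 := by exact_mod_cast hn.symm
  rw [← mul_assoc, this, one_mul, exp_eq_exp_iff_exists_int] at he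
  obtain ⟨n, hn⟩ := he
  have h1 : (θ : ℂ) = θ' + n * (2 * π) := by
    have : θ * I = (θ' + n * (2 * π)) * I := by grind
    exact mul_right_cancel₀ I_ne_zero this
  have h2 : θ = θ' + n * (2 * π) := by exact_mod_cast h1
  have h3 : θ - θ' = n * (2 * π) := by linarith
  rw [h3, abs_mul, abs_of_pos Real.two_pi_pos] at h
  have h4 : |(n : ℝ)| < 1 := by
    by_contra hc; nlinarith [Real.two_pi_pos]
  have h5 := Int.abs_lt_one_iff.1 (by exact_mod_cast h4)
  subst h5; simp at h3; exact hne (by linarith)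
def chi (G : Set ℂ) (v : ℂ) (r θ : ℝ) : ℝ := G.indicator 1 (v + r * exp (θ * I))
theorem chi_meas {G : Set ℂ} (hG : IsOpen G) (v : ℂ) (r : ℝ) : Measurable (chi G v r) :=
  (measurable_one.indicator hG.measurableSet).comp (by fun_prop : Continuous fun θ : ℝ => v + r * exp (θ * I)).measurable
theorem chi_bdd (G : Set ℂ) (v : ℂ) (r θ : ℝ) : ‖chi G v r θ‖ ≤ 1 := by
  unfold chi; by_cases h : v + r * exp (θ * I) ∈ G <;> simp [h]
theorem chi_int {G : Set ℂ} (hG : IsOpen G) (v : ℂ) (r a b : ℝ) : IntervalIntegrable (chi G v r) volume a b := by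
  refine (intervalIntegrable_const (c := rI)).mono_fun (chi_meas hG v r).aestronglyMeasurable ?_
  exact Eventually.of_forall fun θ => by simpa using chi_bdd G v r θ
theorem chi_lim {G : Set ℂ} (hG : IsOpen G) (v : ℂ) {a b g : ℝ} (hab : a ≤ b)
    (h : ∀ θ ∈ Ioo a b, ∀ᶠ r in N0, chi G v r θ = g) :
    Tendsto (fun r => ∫ θ in a..b, chi G v r θ) N0 (nhds (g * (b - a))) := by
  have e : g * (b - a) = ∫ θ in a..b, g := by rw [intervalIntegral.integral_const, smul_eq_mul, mul_comm]
  rw [e]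
  refine intervalIntegral.tendsto_integral_filter_of_dominated_convergence (fun _ => 1)
    (Eventually.of_forall fun r => (chi_meas hG v r).aestronglyMeasurable)
    (Eventually.of_forall fun r => Eventually.of_forall fun θ _ => chi_bdd G v r θ) intervalIntegrable_const ?_
  have : ∀ᵐ θ : ℝ, θ ≠ b := by simp [ae_iff]
  filter_upwards [this] with θ hθ hm
  rw [uIoc_of_le hab] at hm
  exact tendsto_const_nhds.congr' (EventuallyEq.symm (h θ ⟨hm.1, lt_of_le_of_ne hm.2 hθ⟩))
theorem chi_corner {G : Set ℂ} (hG : IsOpen G) {v : ℂ} {A : ℝ} (h : HasCornerAngle G v A) (α : ℝ) :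
    Tendsto (fun r => ∫ θ in α..(α + 2 * π), chi G v r θ) N0 (nhds A) := by
  refine h.congr fun r => ?_
  have hper : Function.Periodic (chi G v r) (2 * π) := fun θ => by
    unfold chi; congr 3; push_cast; rw [add_mul]; exact exp_periodic _
  rw [hper.intervalIntegral_add_eq α 0, zero_add, intervalIntegral.integral_of_le Real.two_pi_pos.le,
    ← integral_Ico_eq_integral_Ioc]
  have hm : MeasurableSet ((fun θ : ℝ => v + r * exp (θ * I)) ⁻¹' G) :=
    (hG.preimage (by fun_prop)).measurableSet
  have e : chi G v r = ((fun θ : ℝ => v + r * exp (θ * I)) ⁻¹' G).indicator 1 := by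
    rfl
  rw [e, integral_indicator_one hm, Measure.real, Measure.restrict_apply hm]
  congr 2
  grind
theorem chi_one {G : Set ℂ} {v : ℂ} {θ : ℝ} (h : CD G v (exp (θ * I))) :
    ∀ᶠ r in N0, chi G v r θ = 1 := by
  have := h.ev (g := fun r => v + r * exp (θ * I)) (tendsto_const_nhds.congr' (by
    filter_upwards [self_mem_nhdsWithin] with s hs
    have : (s : ℂ) ≠ 0 := by exact_mod_cast (ne_of_gt hs)
    field_simp; ring))
  filter_upwards [this] with r hr
  simp [chi, hr]
theorem chi_zero {G : Set ℂ} {v : ℂ} {θ : ℝ} (h : CD (closure G)ᶜ v (exp (θ * I))) :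
    ∀ᶠ r in N0, chi G v r θ = 0 := by
  have := h.ev (g := fun r => v + r * exp (θ * I)) (tendsto_const_nhds.congr' (by
    filter_upwards [self_mem_nhdsWithin] with s hs
    have : (s : ℂ) ≠ 0 := by exact_mod_cast (ne_of_gt hs)
    field_simp; ring))
  filter_upwards [this] with r hr
  have : v + r * exp (θ * I) ∉ G := fun h => hr (subset_closure h)
  simp [chi, this]
theorem arg_polar {c θ : ℝ} (hc : 0 < c) (h1 : -π < θ) (h2 : θ ≤ π) : arg (c * exp (θ * I)) = θ := by
  rw [exp_mul_I]; exact arg_mul_cos_add_sin_mul_I hc ⟨h1, h2⟩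
structure CornerE (G : Set ℂ) (v : ℂ) (w : Bool → ℂ) (e : ℂ) (θ0 : ℝ) : Prop where
  e1 : ‖e‖ = 1
  t0 : 0 < θ0
  tp : θ0 < π
  wk : ∀ k, |arg (w k / e)| = θ0
  dG : ∀ d, d ≠ 0 → θ0 < |arg (d / e)| → CD G v d
  dE : ∀ d, d ≠ 0 → |arg (d / e)| < θ0 → CD (closure G)ᶜ v d
theorem corner_fin {G : Set ℂ} {v : ℂ} {w : Bool → ℂ} {α β θ0 : ℝ} (t0 : 0 < θ0) (tp : θ0 < π)
    (hβ : β - α = 2 * θ0) (hE : ∀ θ ∈ Ioo α β, CD (closure G)ᶜ v (exp (θ * I)))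
    (hG : ∀ θ ∈ Ioo β (α + 2 * π), CD G v (exp (θ * I)))
    (hw : ∀ k, ∃ c : ℝ, 0 < c ∧ (w k = c * exp (α * I) ∨ w k = c * exp (β * I))) :
    CornerE G v w (exp ((α + θ0 : ℝ) * I)) θ0 := by
  have hd : ∀ d : ℂ, d ≠ 0 → d = (‖d‖ : ℝ) * exp ((α + θ0 + arg (d / exp ((α + θ0 : ℝ) * I)) : ℝ) * I) := fun d hd => by
    have h1 := norm_mul_exp_arg_mul_I (d / exp ((α + θ0 : ℝ) * I))
    rw [norm_div, Complex.norm_exp_ofReal_mul_I, div_one, eq_div_iff (Complex.exp_ne_zero _), mul_assoc, ← Complex.exp_add] at h1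
    conv_lhs => rw [← h1]
    push_cast; ring
  refine ⟨norm_exp_ofReal_mul_I _, t0, tp, fun k => ?_, fun d h0 h => ?_, fun d h0 h => ?_⟩
  · obtain ⟨c, hc, h | h⟩ := hw k
    · have : w k / exp ((α + θ0 : ℝ) * I) = c * exp ((-θ0 : ℝ) * I) := by
        rw [h, mul_div_assoc, ← exp_sub]; push_cast; ring
      rw [this, arg_polar hc (by linarith) (by linarith), abs_neg, abs_of_pos t0]
    · have : w k / exp ((α + θ0 : ℝ) * I) = c * exp (θ0 * I) := by
        have hb : β = α + 2 * θ0 := by linarith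
        rw [h, mul_div_assoc, ← exp_sub, hb]; push_cast; ring
      rw [this, arg_polar hc (by linarith) (by linarith), abs_of_pos t0]
  · rw [hd d h0]
    refine CD.smul ?_ (norm_pos_iff.2 h0)
    set ψ := arg (d / exp ((α + θ0 : ℝ) * I))
    have hp1 : -π < ψ := neg_pi_lt_arg _
    have hp2 : ψ ≤ π := arg_le_pi _
    rcases lt_abs.1 h with h | h
    · grind
    · have := hG (α + θ0 + ψ + 2 * π) ⟨by linarith, by linarith⟩
      convert this using 1
      rw [← Complex.exp_periodic]; push_cast; ring
  · rw [hd d h0]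
    refine CD.smul (hE _ ?_) (norm_pos_iff.2 h0)
    grind
theorem HE.corner {G : Set ℂ} {v : ℂ} {h : Bool → ℝ → ℂ} {w : Bool → ℂ} (H : HE G v h w) {lv : ℝ} (l0 : 0 < lv)
    (l2 : lv < 2) (hA : HasCornerAngle G v ((2 - lv) * π)) : (∃ e, CornerE G v w e (lv * π / 2)) ∧ ∀ c : ℝ, 0 ≤ c → w false ≠ c * w true := by
  obtain ⟨α, β, hab, hba, c0, hc0, hw0, c1, hc1, hw1⟩ : ∃ α β : ℝ, α ≤ β ∧ β < α + 2 * π ∧ ∃ c0 : ℝ, 0 < c0 ∧ w false = c0 * exp (α * I) ∧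
      ∃ c1 : ℝ, 0 < c1 ∧ w true = c1 * exp (β * I) := by
    have e0 := (Complex.norm_mul_exp_arg_mul_I (w false)).symm
    have e1 := (norm_mul_exp_arg_mul_I (w true)).symm
    have a1 := Complex.neg_pi_lt_arg (w false)
    have a2 := Complex.arg_le_pi (w false)
    have b1 := neg_pi_lt_arg (w true)
    have b2 := Complex.arg_le_pi (w true)
    by_cases hc : arg (w false) ≤ arg (w true)
    · exact ⟨_, _, hc, by linarith, _, norm_pos_iff.2 (H.w0 _), e0, _, norm_pos_iff.2 (H.w0 _), e1⟩
    · refine ⟨arg (w false), arg (w true) + 2 * π, by linarith, by linarith, _, norm_pos_iff.2 (H.w0 false), e0, ‖w true‖, norm_pos_iff.2 (H.w0 true), ?_⟩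
      push_cast; rw [add_mul, Complex.exp_periodic]; exact e1
  have key : ∀ a b : ℝ, (a = α ∧ b = β) ∨ (a = β ∧ b = α + 2 * π) →
      (∀ θ ∈ Ioo a b, CD G v (exp (θ * I))) ∨ (∀ θ ∈ Ioo a b, CD (closure G)ᶜ v (exp (θ * I))) := by
    intro a b hh
    have := H.const (A := (fun θ : ℝ => exp (θ * I)) '' Ioo a b) (isPreconnected_Ioo.image _ (by fun_prop)) ?_
    · grind
    · rintro _ ⟨θ, hθ, rfl⟩ k c hc
      cases k
      · rw [hw0]; refine exp_ne_smul hc ?_ ?_ hc0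
        · grind
        · grind
      · rw [hw1]; refine exp_ne_smul hc ?_ ?_ hc1
        · grind
        · grind
  have lim : ∀ g1 g2 : ℝ, (∀ θ ∈ Ioo α β, ∀ᶠ r in N0, chi G v r θ = g1) →
      (∀ θ ∈ Ioo β (α + 2 * π), ∀ᶠ r in N0, chi G v r θ = g2) →
      (2 - lv) * π = g1 * (β - α) + g2 * (α + 2 * π - β) := by
    intro g1 g2 h1 h2
    refine tendsto_nhds_unique (chi_corner H.op hA α) (((chi_lim H.op v hab h1).add (chi_lim H.op v hba.le h2)).congr fun r => ?_)
    exact intervalIntegral.integral_add_adjacent_intervals (chi_int H.op v r _ _) (chi_int H.op v r _ _)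
  have hlp : 0 < lv * π := by positivity
  have hlp2 : lv * π < 2 * π := by nlinarith
  have hαβ : α ≠ β := fun h => by
    have hv : ∀ θ ∈ Ioo α β, ∀ᶠ r in N0, chi G v r θ = 0 := fun θ hθ => by linarith [hθ.1, hθ.2]
    rcases key β _ (Or.inr ⟨rfl, rfl⟩) with h2 | h2
    · have := lim 0 1 hv (fun θ hθ => chi_one (h2 θ hθ)); nlinarith
    · have := lim 0 0 hv (fun θ hθ => chi_zero (h2 θ hθ)); nlinarith
  refine ⟨?_, fun c hc h => exp_ne_smul (c := c / c0) (by positivity) hαβ (by grind) hc1 ?_⟩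
  swap
  · rw [hw0, hw1] at h
    have : (c0 : ℂ) ≠ 0 := by exact_mod_cast hc0.ne'
    push_cast; rw [div_mul_eq_mul_div, eq_div_iff this, mul_comm, h]
  rcases key α β (Or.inl ⟨rfl, rfl⟩) with h1 | h1 <;> rcases key β _ (Or.inr ⟨rfl, rfl⟩) with h2 | h2
  · have := lim 1 1 (fun θ hθ => chi_one (h1 θ hθ)) (fun θ hθ => chi_one (h2 θ hθ))
    linarith
  · have := lim 1 0 (fun θ hθ => chi_one (h1 θ hθ)) (fun θ hθ => chi_zero (h2 θ hθ))
    refine ⟨_, corner_fin (β := α + 2 * π) (by linarith) (by linarith) (by linarith) h2 ?_ fun k => ?_⟩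
    · intro θ hθ
      convert (h1 (θ - 2 * π) ⟨by linarith [hθ.1], by linarith [hθ.2]⟩) using 1
      rw [← Complex.exp_periodic ((θ - 2 * π : ℝ) * I)]; push_cast; ring
    · cases k
      · exact ⟨c0, hc0, Or.inr (by rw [hw0]; push_cast; rw [add_mul, exp_periodic])⟩
      · grind
  · have := lim 0 1 (fun θ hθ => chi_zero (h1 θ hθ)) (fun θ hθ => chi_one (h2 θ hθ))
    refine ⟨_, corner_fin (by linarith) (by linarith) (by linarith) h1 h2 fun k => ?_⟩
    cases k
    · grind
    · grind
  · have := lim 0 0 (fun θ hθ => chi_zero (h1 θ hθ)) (fun θ hθ => chi_zero (h2 θ hθ))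
    linarith
theorem CornerE.sign {G : Set ℂ} {v e : ℂ} {w : Bool → ℂ} {θ0 : ℝ} (C : CornerE G v w e θ0) (k : Bool) :
    ∃ κ0 > 0, ∀ κ ∈ Ioo rO κ0, ∃ a : ℝ, (a = κ ∨ a = -κ) ∧ CD G v (w k * (1 + a * I)) ∧
      CD (closure G)ᶜ v (w k * (1 - a * I)) ∧ |arg (w k * (1 - a * I) / e)| < θ0 := by
  have t0 := C.t0
  have tp := C.tp
  have he : e ≠ 0 := norm_ne_zero_iff.1 (by rw [C.e1]; norm_num)
  have hw : w k ≠ 0 := by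
    intro h; have := C.wk k; rw [h] at this; simp at this; linarith
  have hu := div_ne_zero hw he
  have hc : ContinuousAt (fun κ : ℝ => arg (1 + κ * I)) 0 := by
    refine ContinuousAt.comp (continuousAt_arg (by simp)) (by fun_prop)
  have hm : 0 < min θ0 (π - θ0) := lt_min t0 (by linarith)
  obtain ⟨κ0, hκ0, hκ⟩ := Metric.continuousAt_iff.1 hc _ hm
  refine ⟨κ0, hκ0, fun κ hk => ?_⟩
  have h1 := hκ (by rw [dist_zero_right, Real.norm_of_nonneg hk.1.le]; exact hk.2)
  simp only [ofReal_zero, zero_mul, add_zero, arg_one, dist_zero_right, Real.norm_eq_abs] at h1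
  set η := arg (1 + κ * I) with hη
  have him : (1 + κ * I).im = κ := by simp
  have hη0 : 0 < η := by
    have h2 := arg_nonneg_iff.2 (by rw [him]; exact hk.1.le)
    refine lt_of_le_of_ne h2 fun h3 => ?_
    have := (arg_eq_zero_iff.1 (hη.symm.trans h3.symm)).2
    grind
  rw [abs_of_pos hη0] at h1
  have h2 := h1.trans_le (min_le_left _ _)
  have h3 := h1.trans_le (min_le_right _ _)
  have hne1 : (1 + κ * I) ≠ 0 := fun h => by rw [h] at him; simp at him; linarith [hk.1]
  have hcj : (1 - (κ:ℂ) * I) = conj (1 + κ * I) := by simp [sub_eq_add_neg]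
  have hη' : arg (1 - κ * I) = -η := by
    rw [hcj, Complex.arg_conj, if_neg]; intro h; linarith
  have hne2 : (1 - κ * I) ≠ 0 := fun h => by rw [h] at hη'; simp at hη'; linarith
  have cm : ∀ x : ℂ, w k * x / e = w k / e * x := fun x => by ring
  rcases (abs_eq t0.le).1 (C.wk k) with h | h
  · have A1 : arg (w k * (1 + κ * I) / e) = θ0 + η := by
      rw [cm, Complex.arg_mul hu hne1 (by constructor <;> linarith), h]
    have A2 : arg (w k * (1 - κ * I) / e) = θ0 - η := by
      rw [cm, Complex.arg_mul hu hne2 (by constructor <;> linarith), h, hη']; ring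
    have B : |arg (w k * (1 - κ * I) / e)| < θ0 := by grind
    exact ⟨κ, Or.inl rfl, C.dG _ (mul_ne_zero hw hne1) (by rw [A1, abs_of_pos (by linarith)]; linarith), C.dE _ (mul_ne_zero hw hne2) B, B⟩
  · have A1 : arg (w k * (1 + κ * I) / e) = -θ0 + η := by
      rw [cm, Complex.arg_mul hu hne1 (by constructor <;> linarith), h]
    have A2 : arg (w k * (1 - κ * I) / e) = -(θ0 + η) := by
      rw [cm, Complex.arg_mul hu hne2 (by constructor <;> linarith), h, hη']; ring
    have B : |arg (w k * (1 + κ * I) / e)| < θ0 := by rw [A1, abs_lt]; constructor <;> linarith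
    refine ⟨-κ, Or.inr rfl, ?_⟩
    push_cast
    rw [neg_mul, sub_neg_eq_add, ← sub_eq_add_neg]
    exact ⟨C.dG _ (mul_ne_zero hw hne2) (by rw [A2, abs_neg, abs_of_pos (by linarith)]; linarith), C.dE _ (mul_ne_zero hw hne1) B, B⟩
theorem lens_core {θ0 t K : ℝ} {Z ξ : ℂ} (t0 : 0 < θ0) (tp : θ0 < π) (ht : 0 < t) (hK : t * K < rsin θ0)
    (hZ : 0 < Z.im) (hZ2 : -K * ‖Z‖ ^ 2 ≤ (Z * exp ((-θ0 : ℝ) * I)).im) (hξ : |arg ξ| ≤ θ0)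
    (h : Z * (1 + ξ) = t * ξ) : False := by
  set W := Z * (t - conj Z) with hW
  have hZ0 : Z ≠ 0 := fun h => by simp [h] at hZ
  have hW1 : W = t * Z - ((‖Z‖ ^ 2 : ℝ) : ℂ) := by
    rw [hW, mul_sub, mul_conj Z, normSq_eq_norm_sq]; ring
  have hW2 : W = ((‖t - Z‖ ^ 2 : ℝ) : ℂ) * ξ := by
    have h2 : conj (t - Z) = t - conj Z := by simp
    have h3 := mul_conj (t - Z)
    rw [normSq_eq_norm_sq, h2] at h3
    grind
  have hne : t - Z ≠ 0 := fun h0 => by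
    grind
  have hWa : arg W = arg ξ := by rw [hW2, arg_real_mul _ (by positivity)]
  have hWi : 0 < W.im := by rw [hW1]; simp only [sub_im, ofReal_im, sub_zero, im_ofReal_mul]; positivity
  have ha := arg_nonneg_iff.2 hWi.le
  have ha2 : arg W ≤ θ0 := by grind
  have e1 : (W * exp ((-θ0 : ℝ) * I)).im = ‖W‖ * rsin (arg W - θ0) := by
    conv_lhs => rw [← norm_mul_exp_arg_mul_I W, mul_assoc, ← exp_add]
    rw [im_ofReal_mul, ← add_mul, ← ofReal_add, exp_ofReal_mul_I_im, sub_eq_add_neg]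
  have e2 : (W * exp ((-θ0 : ℝ) * I)).im = t * (Z * exp ((-θ0 : ℝ) * I)).im + ‖Z‖ ^ 2 * rsin θ0 := by
    rw [hW1, sub_mul, sub_im, mul_assoc, im_ofReal_mul, im_ofReal_mul, exp_ofReal_mul_I_im, Real.sin_neg]; ring
  have s1 : rsin (arg W - θ0) ≤ 0 := Real.sin_nonpos_of_nonpos_of_neg_pi_le (by linarith) (by linarith)
  have hp : 0 < ‖Z‖ ^ 2 := by positivity
  have := mul_nonpos_of_nonneg_of_nonpos (norm_nonneg W) s1
  nlinarith
theorem lens_near {θ0 t K A s : ℝ} {u Z ξ : ℂ} (t0 : 0 < θ0) (tp : θ0 < π) (ht : 0 < t) (hK0 : 0 < K)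
    (hA : 0 < A) (hu : A ≤ ‖u‖) (hK : t * (4 * K / A ^ 2) < rsin θ0) (hs : 0 < s) (hs2 : K * s < A / 2)
    (hs3 : K * s < A * rsin θ0) (hua : |arg u| = θ0) (hZ : ‖Z - u * s‖ ≤ K * s ^ 2) (hξ : |arg ξ| ≤ θ0)
    (h : Z * (1 + ξ) = t * ξ) : False := by
  wlog hp : arg u = θ0 generalizing u Z ξ
  · have hcu : arg (conj u) = θ0 := by
      rw [Complex.arg_conj, if_neg (by grind), ((abs_eq t0.le).1 hua).resolve_left hp, neg_neg]
    refine this (Z := conj Z) (by rwa [norm_conj]) (by grind) ?_ (by rwa [abs_arg_conj]) ?_ hcu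
    · have : conj Z - conj u * s = conj (Z - u * s) := by simp
      rw [this, norm_conj]; exact hZ
    · have := congrArg conj h; simpa using this
  have hup : u = (‖u‖ : ℝ) * exp (θ0 * I) := by conv_lhs => rw [← norm_mul_exp_arg_mul_I u, hp]
  set R := Z - u * s with hR
  have hZe : Z = u * s + R := by grind
  have hn : A / 2 * s ≤ ‖Z‖ := by
    have h1 : ‖u * s‖ ≤ ‖Z‖ + ‖R‖ := by
      have : u * s = Z - R := by grind
      rw [this]; exact norm_sub_le _ _
    rw [norm_mul, norm_real, Real.norm_of_nonneg hs.le] at h1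
    nlinarith
  have hn2 : K * s ^ 2 ≤ 4 * K / A ^ 2 * ‖Z‖ ^ 2 := by
    calc K * s ^ 2 = 4 * K / A ^ 2 * (A / 2 * s) ^ 2 := by field_simp; ring
      _ ≤ _ := by gcongr
  refine lens_core (K := 4 * K / A ^ 2) t0 tp ht hK ?_ ?_ hξ h
  · have h1 : (u * s).im = ‖u‖ * rsin θ0 * s := by
      rw [hup]; simp
    rw [hZe, add_im, h1]
    have h2 := (abs_le.1 ((abs_im_le_norm R).trans hZ)).1
    have h3 : 0 < rsin θ0 := Real.sin_pos_of_pos_of_lt_pi t0 tp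
    nlinarith [mul_le_mul_of_nonneg_right hu (mul_pos h3 hs).le]
  · have h1 : (u * s * exp ((-θ0 : ℝ) * I)).im = 0 := by
      have : u * s * exp ((-θ0 : ℝ) * I) = ((‖u‖ * s : ℝ) : ℂ) := by
        rw [hup]
        have : exp (θ0 * I) * exp ((-θ0 : ℝ) * I) = 1 := by rw [← exp_add, ← add_mul]; simp
        simp only [norm_mul, norm_real, norm_norm, norm_exp_ofReal_mul_I]
        push_cast at this ⊢; linear_combination (‖u‖ : ℂ) * s * this
      rw [this, ofReal_im]
    have h2 : (Z * exp ((-θ0 : ℝ) * I)).im = (R * exp ((-θ0 : ℝ) * I)).im := by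
      rw [hZe, add_mul, add_im, h1, zero_add]
    have h3 := abs_im_le_norm (R * exp ((-θ0 : ℝ) * I))
    rw [norm_mul, norm_exp_ofReal_mul_I, mul_one] at h3
    grind
theorem one_add_ne {ξ : ℂ} {θ0 : ℝ} (tp : θ0 < π) (h : |arg ξ| ≤ θ0) : 1 + ξ ≠ 0 := fun h0 => by
  have : ξ = -1 := by linear_combination h0
  rw [this, arg_neg_one, abs_of_pos Real.pi_pos] at h; linarith
theorem exp_arg_le {x : ℂ} {θ0 : ℝ} (tp : θ0 < π) (hx : x.im ∈ Icc (-θ0) θ0) : |arg (exp x)| ≤ θ0 := by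
  rw [← log_im, log_exp (by grind) (by grind), abs_le]; exact hx
theorem lens_conn (v c : ℂ) {θ0 : ℝ} (t0 : 0 < θ0) (tp : θ0 < π) :
    IsPreconnected {z : ℂ | ∃ ξ, ξ ≠ 0 ∧ |arg ξ| ≤ θ0 ∧ z = v + c * (ξ / (1 + ξ))} := by
  have e : {z : ℂ | ∃ ξ, ξ ≠ 0 ∧ |arg ξ| ≤ θ0 ∧ z = v + c * (ξ / (1 + ξ))} =
      (fun x => v + c * (exp x / (1 + exp x))) '' {x : ℂ | x.im ∈ Icc (-θ0) θ0} := by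
    ext z; constructor
    · rintro ⟨ξ, h0, ha, rfl⟩
      exact ⟨log ξ, by simpa [log_im] using abs_le.1 ha, by simp only [exp_log h0]⟩
    · rintro ⟨x, hx, rfl⟩
      refine ⟨exp x, exp_ne_zero _, ?_, rfl⟩
      exact exp_arg_le tp hx
  rw [e]
  refine ((convex_Icc (-θ0) θ0).linear_preimage imLm).isPreconnected.image _ ?_
  refine continuousOn_const.add (continuousOn_const.mul (ContinuousOn.div (by fun_prop) (by fun_prop) fun x hx => ?_))
  exact one_add_ne tp (exp_arg_le tp hx)
theorem HE.lens {G : Set ℂ} {v e : ℂ} {h : Bool → ℝ → ℂ} {w : Bool → ℂ} {θ0 : ℝ} (H : HE G v h w)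
    (C : CornerE G v w e θ0) : ∃ t > 0, ∃ S : Set ℂ, IsPreconnected S ∧ (∀ z ∈ S, z ∉ closure G) ∧ v + (t : ℝ) * e ∈ S ∧
      ∀ ξ, ξ ≠ 0 → |arg ξ| ≤ θ0 → v + t * e * (ξ / (1 + ξ)) ∈ S := by
  have t0 := C.t0
  have tp := C.tp
  have he := norm_ne_zero_iff.1 (by rw [C.e1]; norm_num)
  have hsin := Real.sin_pos_of_pos_of_lt_pi t0 tp
  obtain ⟨K, hK, r, hr, hq⟩ := H.quad
  set A := min ‖w false‖ ‖w true‖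
  have hA : 0 < A := lt_min (norm_pos_iff.2 (H.w0 _)) (norm_pos_iff.2 (H.w0 _))
  have hAk : ∀ k, A ≤ ‖w k‖ := fun k => by cases k; exacts [min_le_left _ _, min_le_right _ _]
  set ε := min r (min (A / 2 / K) (A * rsin θ0 / K))
  obtain ⟨r', hr', hl⟩ := H.loc ε (by positivity)
  obtain ⟨δ, hδ, ρ0, hρ0, hcone⟩ := C.dE e he (by simpa using t0)
  set ψ := min (π - θ0) (π / 2)
  have hψ : 0 < ψ := lt_min (by linarith) (by grind)
  have hψ2 : ψ ≤ π / 2 := min_le_right _ _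
  have hsψ := Real.sin_pos_of_pos_of_lt_pi hψ (by grind)
  obtain ⟨t, ht, ht1, ht2, ht3⟩ : ∃ t > 0, t < ρ0 ∧ t < r' * rsin ψ ∧ t < rsin θ0 / (4 * K / A ^ 2) := by
    obtain ⟨t, ht, h2⟩ := exists_between (show 0 < min ρ0 (min (r' * rsin ψ) (rsin θ0 / (4 * K / A ^ 2))) by positivity)
    exact ⟨t, ht, h2.trans_le (min_le_left _ _), h2.trans_le ((min_le_right _ _).trans (min_le_left _ _)), h2.trans_le ((min_le_right _ _).trans (min_le_right _ _))⟩
  rw [lt_div_iff₀ (by positivity)] at ht3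
  have hray := fun ρ hρ => hcone ρ hρ _ (by
    have : v + ρ * e - v - ρ * e = 0 := by ring
    rw [this, norm_zero]; exact mul_pos hδ hρ.1)
  set Λ := {z : ℂ | ∃ ξ, ξ ≠ 0 ∧ |arg ξ| ≤ θ0 ∧ z = v + t * e * (ξ / (1 + ξ))}
  have hΛc := lens_conn v (t * e) t0 tp
  have hmid : v + ((t / 2 : ℝ) : ℂ) * e ∈ Λ := ⟨1, one_ne_zero, by simp [t0.le], by push_cast; ring⟩
  have miss : ∀ z ∈ Λ, z ∉ frontier G := by
    rintro z ⟨ξ, h0, ha, hz⟩ hzf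
    have h1 := one_add_ne tp ha
    have hd := sector_dist (x := ξ) (y := -1) hψ.le hψ2 (Or.inr (by
      rw [arg_neg_one, abs_of_pos Real.pi_pos]; linarith [min_le_left (π - θ0) (π / 2)]))
    rw [sub_neg_eq_add, add_comm] at hd
    have hzv : ‖z - v‖ < r' := by
      rw [hz, add_sub_cancel_left, norm_mul, norm_mul, norm_div, C.e1, norm_real, Real.norm_of_nonneg ht.le, mul_one]
      have h2 : ‖ξ‖ / ‖1 + ξ‖ ≤ 1 / rsin ψ := by
        rw [div_le_div_iff₀ (norm_pos_iff.2 h1) hsψ, one_mul]; rwa [add_comm 1 ξ] at hd ⊢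
      calc t * (‖ξ‖ / ‖1 + ξ‖) ≤ t * (1 / rsin ψ) := by gcongr
        _ < r' := by rw [mul_one_div, div_lt_iff₀ hsψ]; exact ht2
    obtain ⟨k, s, hs, hzk⟩ := hl z hzf hzv
    have hs1 := hs.2.trans_le (min_le_left _ _)
    have hs2 := (lt_div_iff₀ hK).1 (hs.2.trans_le ((min_le_right _ _).trans (min_le_left _ _)))
    have hs3 := (lt_div_iff₀ hK).1 (hs.2.trans_le ((min_le_right _ _).trans (min_le_right _ _)))
    have hqk := hq k s ⟨hs.1, hs1.le⟩
    have hte : t * e ≠ 0 := mul_ne_zero (by exact_mod_cast ht.ne') he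
    have hs0 : 0 < s := by
      refine lt_of_le_of_ne hs.1 fun h => ?_
      rw [← hzk, ← h] at hqk
      norm_num at hqk
      grind
    refine lens_near (Z := (z - v) / e) (ξ := ξ) t0 tp ht hK hA (by rw [norm_div, C.e1, div_one]; exact hAk k) ht3
      hs0 (by linarith) (by linarith) (C.wk k) ?_ ha ?_
    · have : (z - v) / e - w k / e * s = (h k s - v - w k * s) / e := by grind
      rw [this, norm_div, C.e1, div_one]; exact hqk
    · rw [hz]; field_simp; ring
  have hΛE : ∀ z ∈ Λ, z ∉ closure G := fun z hz hzK => by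
    have hzG : z ∈ G := by
      by_contra hzG
      exact miss z hz (by rw [H.op.frontier_eq]; exact ⟨hzK, hzG⟩)
    obtain ⟨y, hy, hyf⟩ := meets_frontier H.op hΛc hz hzG hmid fun h => (hray (t / 2) ⟨by positivity, by linarith⟩) (subset_closure h)
    grind
  set T := (fun ρ : ℝ => v + ρ * e) '' Icc (t / 2) t
  refine ⟨t, ht, Λ ∪ T, hΛc.union (v + ((t / 2 : ℝ) : ℂ) * e) hmid ⟨t / 2, ⟨le_rfl, by linarith⟩, rfl⟩
    (isPreconnected_Icc.image _ (by fun_prop)), ?_, Or.inr ⟨t, ⟨by linarith, le_rfl⟩, rfl⟩, fun ξ h0 ha => Or.inl ⟨ξ, h0, ha, rfl⟩⟩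
  grind
structure ArcD (γ : ℝ → ℂ) (a b : ℝ) (τ : ℂ → ℂ) (U : Set ℂ) (σ : ℝ → ℝ) : Prop where
  op : IsOpen U
  seg : ∀ u ∈ UI, (u : ℂ) ∈ U
  diff : DifferentiableOn ℂ τ U
  inj : InjOn τ U
  mono : StrictMonoOn σ (Icc 0 1)
  cont : ContinuousOn σ (Icc 0 1)
  s0 : σ 0 = a
  s1 : σ 1 = b
  eq : ∀ u ∈ UI, γ (σ u) = τ u
namespace ArcD
variable {γ : ℝ → ℂ} {a b : ℝ} {τ : ℂ → ℂ} {U : Set ℂ} {σ : ℝ → ℝ}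
theorem hd (A : ArcD γ a b τ U σ) {u : ℝ} (hu : u ∈ UI) : HasDerivAt (fun x : ℝ => τ x) (deriv τ u) u :=
  (A.diff.differentiableAt (A.op.mem_nhds (A.seg u hu))).hasDerivAt.comp_ofReal
theorem cd (A : ArcD γ a b τ U σ) : ContinuousOn (fun u : ℝ => ‖deriv τ u‖) (Icc 0 1) := by
  exact (((A.diff.deriv A.op).continuousOn).comp (by fun_prop) A.seg).norm
theorem mem (A : ArcD γ a b τ U σ) {u : ℝ} (hu : u ∈ UI) : σ u ∈ Icc a b :=
  ⟨A.s0 ▸ A.mono.monotoneOn ⟨le_rfl, zero_le_one⟩ hu hu.1, A.s1 ▸ A.mono.monotoneOn hu ⟨zero_le_one, le_rfl⟩ hu.2⟩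
theorem surj (A : ArcD γ a b τ U σ) {x : ℝ} (hx : x ∈ Icc a b) : ∃ u ∈ UI, σ u = x := by
  have := intermediate_value_Icc (zero_le_one' ℝ) A.cont
  rw [A.s0, A.s1] at this
  grind
theorem lower (A : ArcD γ a b τ U σ) {l : ℝ} (hab : b ≤ a + l)
    (hvar : ∀ s t : ℝ, s ≤ t → t ≤ s + l → eVariationOn γ (Icc s t) = ENNReal.ofReal (t - s))
    {u u' : ℝ} (hu : u ∈ UI) (hu' : u' ∈ UI) (h : u ≤ u') : ‖τ u' - τ u‖ ≤ σ u' - σ u := by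
  have hs := A.mono.monotoneOn hu hu' h
  have h1 := A.mem hu
  have h2 := A.mem hu'
  have h3 := eVariationOn.edist_le γ (s := Icc (σ u) (σ u')) (right_mem_Icc.2 hs) (left_mem_Icc.2 hs)
  rw [hvar _ _ hs (by grind), A.eq u hu, A.eq u' hu', edist_dist, dist_eq_norm,
    ENNReal.ofReal_le_ofReal_iff (by linarith)] at h3
  grind
theorem upper (A : ArcD γ a b τ U σ) {l : ℝ} (hab : b ≤ a + l)
    (hvar : ∀ s t : ℝ, s ≤ t → t ≤ s + l → eVariationOn γ (Icc s t) = ENNReal.ofReal (t - s))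
    {u u' C : ℝ} (hu : u ∈ UI) (hu' : u' ∈ UI) (h : u ≤ u') (hC : 0 ≤ C)
    (hb : ∀ x ∈ Icc u u', ‖deriv τ (x : ℝ)‖ ≤ C) : σ u' - σ u ≤ C * (u' - u) := by
  have hsub := Icc_subset_Icc hu.1 hu'.2
  have him : σ '' Icc u u' = Icc (σ u) (σ u') := by
    refine subset_antisymm ?_ (intermediate_value_Icc h (A.cont.mono hsub))
    rintro _ ⟨x, hx, rfl⟩
    exact ⟨A.mono.monotoneOn hu (hsub hx) hx.1, A.mono.monotoneOn (hsub hx) hu' hx.2⟩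
  have e1 := eVariationOn.comp_eq_of_monotoneOn γ σ (A.mono.monotoneOn.mono hsub)
  rw [him, hvar _ _ (A.mono.monotoneOn hu hu' h) (by linarith [(A.mem hu).1, (A.mem hu').2])] at e1
  have e2 : eVariationOn (γ ∘ σ) (Icc u u') = eVariationOn ((fun x : ℝ => τ x) ∘ id) (Icc u u') :=
    eVariationOn.congr fun x hx => A.eq x (hsub hx)
  have hL : LipschitzOnWith C.toNNReal (fun x : ℝ => τ x) (Icc u u') := by
    refine LipschitzOnWith.of_dist_le_mul fun x hx y hy => ?_
    rw [dist_eq_norm, dist_eq_norm, Real.coe_toNNReal C hC]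
    exact (convex_Icc u u').norm_image_sub_le_of_norm_hasDerivWithin_le (fun z hz => (A.hd (hsub hz)).hasDerivWithinAt) hb hy hx
  have e3 := hL.comp_eVariationOn_le (s := Icc u u') (mapsTo_id _)
  rw [← e2, e1, eVariationOn_id_Icc] at e3
  have e4 : (C.toNNReal : ENNReal) = ENNReal.ofReal C := rfl
  rw [e4, ← ENNReal.ofReal_mul hC, ENNReal.ofReal_le_ofReal_iff (mul_nonneg hC (by linarith))] at e3
  exact e3
theorem sderiv (A : ArcD γ a b τ U σ) {l : ℝ} (hab : b ≤ a + l)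
    (hvar : ∀ s t : ℝ, s ≤ t → t ≤ s + l → eVariationOn γ (Icc s t) = ENNReal.ofReal (t - s))
    {u : ℝ} (hu : u ∈ UO) : HasDerivWithinAt σ ‖deriv τ u‖ (Ioi u) u := by
  have huI := Ioo_subset_Icc_self hu
  rw [hasDerivWithinAt_iff_tendsto_slope' (by simp)]
  have ht : Tendsto (fun x => ‖slope (fun x : ℝ => τ x) u x‖) (nhdsWithin u (Ioi u)) (nhds ‖deriv τ u‖) := by
    exact ((hasDerivWithinAt_iff_tendsto_slope' (by simp)).1 ((A.hd huI).hasDerivWithinAt (s := Ioi u))).norm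
  rw [tendsto_order]
  refine ⟨fun c hc => ?_, fun c hc => ?_⟩
  · filter_upwards [(tendsto_order.1 ht).1 c hc, Ioo_mem_nhdsGT hu.2] with x hx hx1
    refine hx.trans_le ?_
    have := A.lower hab hvar huI (u' := x) ⟨by linarith [hu.1, hx1.1], hx1.2.le⟩ hx1.1.le
    have hp : 0 < x - u := by linarith [hx1.1]
    rw [slope_def_module, norm_smul, norm_inv, Real.norm_of_nonneg hp.le, slope_def_field, div_eq_inv_mul]
    gcongr
  · obtain ⟨c', h1, h2⟩ := exists_between hc
    obtain ⟨r, hr, hr2⟩ := Metric.eventually_nhds_iff.1 ((tendsto_order.1 (A.cd.continuousAt (Icc_mem_nhds hu.1 hu.2)).tendsto).2 c' h1)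
    filter_upwards [Ioo_mem_nhdsGT hu.2, Ioo_mem_nhdsGT (show u < u + r by linarith)] with x hx1 hx2
    refine lt_of_le_of_lt ?_ h2
    have hp : 0 < x - u := by grind
    rw [slope_def_field, div_le_iff₀ hp]
    refine A.upper hab hvar huI ⟨by linarith [hu.1], hx1.2.le⟩ hx1.1.le ((norm_nonneg _).trans h1.le) fun y hy => ?_
    exact (hr2 (by rw [Real.dist_eq, abs_of_nonneg (by grind)]; linarith [hy.2, hx2.2])).le
theorem integ (A : ArcD γ a b τ U σ) {l : ℝ} (hab : b ≤ a + l)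
    (hvar : ∀ s t : ℝ, s ≤ t → t ≤ s + l → eVariationOn γ (Icc s t) = ENNReal.ofReal (t - s)) (hγ : Continuous γ)
    {g : ℂ → ℂ} (hg : Continuous g) : ∫ s in a..b, g (γ s) = ∫ u, (‖deriv τ (u : ℝ)‖ : ℂ) * g (τ u) ∂m01 := by
  have e := intervalIntegral.integral_deriv_smul_comp'' (b := 1) (f' := fun u => ‖deriv τ u‖)
    (g := fun s => g (γ s)) (by rw [uIcc_of_le zero_le_one]; exact A.cont)
    (by rw [min_eq_left zero_le_one, max_eq_right zero_le_one]; exact fun u hu => A.sderiv hab hvar hu)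
    (by rw [uIcc_of_le zero_le_one]; exact A.cd) (hg.comp hγ).continuousOn
  rw [A.s0, A.s1] at e
  rw [← e, intervalIntegral.integral_of_le zero_le_one, integral_Ioc_eq_integral_Ioo]
  refine setIntegral_congr_fun measurableSet_Ioo fun u hu => ?_
  simp only [Function.comp, real_smul]
  rw [A.eq u (Ioo_subset_Icc_self hu)]
end ArcD
theorem lift_cont {γ : ℝ → ℂ} {a b p q : ℝ} (hγ : Continuous γ) (hi : InjOn γ (Icc a b)) {f : ℝ → ℂ} {σ : ℝ → ℝ}
    (hf : ContinuousOn f (Icc p q)) (hσ : ∀ u ∈ Icc p q, σ u ∈ Icc a b) (he : ∀ u ∈ Icc p q, γ (σ u) = f u) :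
    ContinuousOn σ (Icc p q) := by
  have hemb : Topology.IsClosedEmbedding (fun x : Icc a b => γ x) :=
    Continuous.isClosedEmbedding (by fun_prop) fun x y h => Subtype.ext (hi x.2 y.2 h)
  have h1 : Continuous (fun u : Icc p q => (⟨σ u, hσ u u.2⟩ : Icc a b)) := by
    rw [hemb.isInducing.continuous_iff]
    have : ((fun x : Icc a b => γ x) ∘ fun u : Icc p q => (⟨σ u, hσ u u.2⟩ : Icc a b)) = (Icc p q).restrict f := by
      ext u; exact he u u.2
    rw [this]; exact hf.restrict
  exact continuousOn_iff_continuous_restrict.2 (continuous_subtype_val.comp h1)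
theorem arc_exists {γ : ℝ → ℂ} {a b l us c : ℝ} {J U : Set ℂ} {τ : ℂ → ℂ} (hγ : Continuous γ) (hJ : J.Finite)
    (hinj : ∀ x ∈ Icc a (a + l), ∀ y ∈ Icc a (a + l), γ x = γ y → x = y ∨ (x = a ∧ y = a + l) ∨ (x = a + l ∧ y = a))
    (hbl : b < a + l) (haJ : γ a ∈ J) (hbJ : γ b ∈ J) (hJo : ∀ t ∈ Ioo a b, γ t ∉ J)
    (hU : IsOpen U) (hseg : ∀ u ∈ UI, (u : ℂ) ∈ U) (hdf : DifferentiableOn ℂ τ U) (hti : InjOn τ U)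
    (h0J : τ rO ∈ J) (h1J : τ rI ∈ J) (hcov : ∀ u ∈ UI, τ u ∈ γ '' Icc a (a + l))
    (hus : us ∈ UI) (hc : c ∈ Ioo a b) (hcu : γ c = τ us) :
    ∃ τ' U' σ, ArcD γ a b τ' U' σ := by
  have hab : a < b := hc.1.trans hc.2
  have hfc := hdf.continuousOn.comp (by fun_prop) hseg
  have hfi : InjOn (fun u : ℝ => τ u) (Icc 0 1) := fun x hx y hy h => by
    exact_mod_cast hti (hseg x hx) (hseg y hy) h
  have hgi : InjOn γ (Icc a b) := fun x hx y hy h => by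
    grind
  have hS : IsClosed (UI ∩ (fun u : ℝ => τ u) ⁻¹' J) := hfc.preimage_isClosed_of_isClosed isClosed_Icc hJ.isClosed
  obtain ⟨α, ⟨⟨hα1, hαJ⟩, hα2⟩, hαm⟩ := ((isCompact_Icc (a := rO)).inter_left hS).exists_isGreatest ⟨0, ⟨⟨le_rfl, zero_le_one⟩, h0J⟩, ⟨le_rfl, hus.1⟩⟩
  obtain ⟨β, ⟨⟨hβ1, hβJ⟩, hβ2⟩, hβm⟩ := ((isCompact_Icc (b := rI)).inter_left hS).exists_isLeast ⟨1, ⟨⟨zero_le_one, le_rfl⟩, h1J⟩, ⟨hus.2, le_rfl⟩⟩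
  have husJ : τ us ∉ J := hcu ▸ hJo c hc
  have hαu : α < us := lt_of_le_of_ne hα2.2 fun h => husJ (h ▸ hαJ)
  have huβ : us < β := lt_of_le_of_ne hβ2.1 fun h => husJ (h ▸ hβJ)
  have hsub : Icc α β ⊆ Icc 0 1 := Icc_subset_Icc hα1.1 hβ1.2
  have hno : ∀ u ∈ Ioo α β, τ u ∉ J := fun u hu hJu => by
    have hu1 := hsub (Ioo_subset_Icc_self hu)
    rcases le_total u us with h | h
    · exact absurd (hαm ⟨⟨hu1, hJu⟩, ⟨hu1.1, h⟩⟩) (not_le.2 hu.1)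
    · exact absurd (hβm ⟨⟨hu1, hJu⟩, ⟨h, hu1.2⟩⟩) (not_le.2 hu.2)
  have hcl1 : IsClosed (γ '' Icc a b) := (isCompact_Icc.image hγ).isClosed
  have hcl2 : IsClosed (γ '' Icc b (a + l)) := (isCompact_Icc.image hγ).isClosed
  have hsubo : ∀ u ∈ Ioo α β, τ u ∈ γ '' Icc a b := by
    have hcon : IsPreconnected ((fun u : ℝ => τ u) '' Ioo α β) :=
      isPreconnected_Ioo.image _ (hfc.mono (Ioo_subset_Icc_self.trans hsub))
    have h12 : (fun u : ℝ => τ u) '' Ioo α β ⊆ γ '' Icc a b ∪ γ '' Icc b (a + l) := by grind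
    intro u hu
    rcases h12 ⟨u, hu, rfl⟩ with h | h
    · grind
    exfalso
    obtain ⟨_, ⟨u1, hu1, rfl⟩, ⟨x, hx, hxe⟩, ⟨y, hy, hye⟩⟩ := isPreconnected_closed_iff.1 hcon _ _ hcl1 hcl2 h12
      ⟨τ us, ⟨us, ⟨hαu, huβ⟩, rfl⟩, ⟨c, Ioo_subset_Icc_self hc, hcu⟩⟩ ⟨_, ⟨u, hu, rfl⟩, h⟩
    grind
  have hsubc : ∀ u ∈ Icc α β, τ u ∈ γ '' Icc a b := by
    have h1 : Icc α β ∩ (fun u : ℝ => τ u) ⁻¹' (γ '' Icc a b) = Icc α β := by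
      refine subset_antisymm inter_subset_left ?_
      have hcl := (hfc.mono hsub).preimage_isClosed_of_isClosed isClosed_Icc hcl1
      have h2 : closure (Ioo α β) ⊆ Icc α β ∩ (fun u : ℝ => τ u) ⁻¹' (γ '' Icc a b) :=
        closure_minimal (fun u hu => ⟨Ioo_subset_Icc_self hu, hsubo u hu⟩) hcl
      rwa [closure_Ioo (by linarith)] at h2
    grind
  choose! σ hσ1 hσ2 using hsubc
  have hσc : ContinuousOn σ (Icc α β) := lift_cont hγ hgi (hfc.mono hsub) hσ1 hσ2
  have hσi : InjOn σ (Icc α β) := fun x hx y hy h => hfi (hsub hx) (hsub hy) (by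
    have := congrArg γ h; rwa [hσ2 x hx, hσ2 y hy] at this)
  have hend : ∀ u ∈ Icc α β, τ u ∈ J → σ u = a ∨ σ u = b := fun u hu hJu => by
    have h1 := hσ1 u hu
    by_contra hcon
    push Not at hcon
    exact hJo (σ u) ⟨lt_of_le_of_ne h1.1 hcon.1.symm, lt_of_le_of_ne h1.2 hcon.2⟩ (by grind)
  have hαI : α ∈ Icc α β := ⟨le_rfl, by linarith⟩
  have hβI : β ∈ Icc α β := ⟨by linarith, le_rfl⟩
  have hαβ : α < β := by linarith
  have hne : σ α ≠ σ β := fun h => hαβ.ne (hσi hαI hβI h)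
  obtain ⟨p, q, hpq, hp, hq, hpI, hqI⟩ : ∃ p q : ℝ, p ≠ q ∧ σ p = a ∧ σ q = b ∧ p ∈ Icc α β ∧ q ∈ Icc α β := by grind
  have hφ : ∀ u ∈ UI, p + (q - p) * u ∈ Icc α β := fun u hu => by
    have := (convex_Icc α β) hpI hqI (a := 1 - u) (b := u) (by grind) hu.1 (by ring)
    convert this using 1; simp only [smul_eq_mul]; ring
  have hmap : MapsTo (fun x => (p : ℂ) + (q - p) * x) ((fun x : ℂ => (p : ℂ) + (q - p) * x) ⁻¹' U) U := fun x hx => hx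
  have hcast : ∀ u : ℝ, (p : ℂ) + (q - p) * u = ((p + (q - p) * u : ℝ) : ℂ) := fun u => by push_cast; ring
  have hsc : ContinuousOn (fun u => σ (p + (q - p) * u)) (Icc 0 1) := hσc.comp (by fun_prop) hφ
  refine ⟨fun x => τ (p + (q - p) * x), (fun x => (p : ℂ) + (q - p) * x) ⁻¹' U, fun u => σ (p + (q - p) * u), ?_⟩
  refine ⟨hU.preimage (by fun_prop), fun u hu => ?_, hdf.comp (by fun_prop) hmap, fun x hx y hy h => ?_, ?_, hsc, ?_, ?_, fun u hu => ?_⟩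
  · grind
  · have := hti hx hy h
    grind
  · refine ContinuousOn.strictMonoOn_of_injOn_Icc zero_le_one ?_ hsc fun x hx y hy h => ?_
    · grind
    · have := hσi (hφ x hx) (hφ y hy) h
      grind
  · grind
  · grind
  · grind
structure ES (G : Set ℂ) (lam : ℝ) where
  M : ℕ
  Mp : 0 < M
  τ : Fin M → ℂ → ℂ
  V : Set ℂ
  V_open : IsOpen V
  V_convex : Convex ℝ V
  V_conj : ∀ x ∈ V, conj x ∈ V
  seg : ∀ u ∈ UI, (u : ℂ) ∈ V
  diff : ∀ j, DifferentiableOn ℂ (τ j) V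
  inj : ∀ j, InjOn (τ j) V
  nx : Equiv.Perm (Fin M)
  nxτ : ∀ j, τ j rI = τ (nx j) rO
  ind : ∀ P : Fin M → Prop, (∃ j, P j) → (∀ j, P j → P (nx j)) → ∀ j, P j
  hL : frontier G = ⋃ j, (fun u : ℝ => τ j u) '' Icc 0 1
  int : ∀ i j, ∀ u ∈ UO, ∀ u' ∈ UI, τ i u = τ j u' → i = j ∧ u = u'
  ver : ∀ i j, ∀ u ∈ UI, τ i u = τ j rO → (u = 0 ∧ i = j) ∨ (u = 1 ∧ nx i = j)
  ang : ∀ j, ∃ lv, lam ≤ lv ∧ lv < 2 ∧ HasCornerAngle G (τ j rO) ((2 - lv) * π)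
theorem segV {M : ℕ} {U : Fin M → Set ℂ} (hU : ∀ j, IsOpen (U j)) (hs : ∀ j, ∀ u ∈ UI, (u : ℂ) ∈ U j) :
    ∃ V : Set ℂ, IsOpen V ∧ Convex ℝ V ∧ (∀ x ∈ V, conj x ∈ V) ∧ (∀ u ∈ UI, (u : ℂ) ∈ V) ∧ ∀ j, V ⊆ U j := by
  have hc : IsCompact (ofReal '' UI) := isCompact_Icc.image continuous_ofReal
  obtain ⟨δ, hδ, h⟩ := hc.exists_thickening_subset_open (isOpen_iInter_of_finite hU)
    (by rintro _ ⟨u, hu, rfl⟩; exact mem_iInter.2 fun j => hs j u hu)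
  refine ⟨_, isOpen_thickening, ((convex_Icc rO 1).linear_image ofRealCLM.toLinearMap).thickening δ, fun x hx => ?_,
    fun u hu => self_subset_thickening hδ _ (mem_image_of_mem _ hu), fun j => h.trans (iInter_subset _ j)⟩
  obtain ⟨_, ⟨u, hu, rfl⟩, hd⟩ := mem_thickening_iff.1 hx
  refine mem_thickening_iff.2 ⟨_, ⟨u, hu, rfl⟩, ?_⟩
  convert hd using 1
  rw [dist_eq_norm, dist_eq_norm, ← norm_conj (x - _)]; simp
theorem ES.exist (D : JordanDomain) (B : PiecewiseAnalyticBoundary D) (lam : ℝ) (hmin : ∀ i, lam ≤ B.extAngle i) :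
    ∃ S : ES D.G lam, ∀ g : ℂ → ℂ, Continuous g →
      ∫ s in rO..D.l, g (D.γ s) = ∑ j, ∫ u, (‖deriv (S.τ j) (u : ℝ)‖ : ℂ) * g (S.τ j u) ∂m01 := by
  set γ := D.γ with hγd
  set l := D.l with hld
  have hl : 0 < l := D.l_pos
  have hper := D.γ_periodic
  have hinj : ∀ a : ℝ, ∀ x ∈ Ico a (a + l), ∀ y ∈ Ico a (a + l), γ x = γ y → x = y := fun a x hx y hy h => by
    have hm : ∀ z, γ (toIcoMod hl 0 z) = γ z := fun z => by
      exact hper.sub_zsmul_eq _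
    have h0 := fun z => by simpa using toIcoMod_mem_Ico hl 0 z
    have := D.γ_injOn (h0 x) (h0 y) (by rw [← hγd, hm, hm, h])
    obtain ⟨n, hn⟩ := (toIcoMod_eq_toIcoMod hl).1 this
    have h1 : (n:ℝ) * l < 1 * l := by grind
    have h2 : (-1:ℝ) * l < n * l := by grind
    have h3 := lt_of_mul_lt_mul_right h1 hl.le
    have h4 := lt_of_mul_lt_mul_right h2 hl.le
    have h5 : n < 1 := by exact_mod_cast h3
    have h6 : -1 < n := by exact_mod_cast h4
    obtain rfl : n = 0 := by omega
    grind
  have hsurj : ∀ a : ℝ, ∀ z ∈ frontier D.G, ∃ x ∈ Ico a (a + l), γ x = z := fun a z hz => by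
    rw [← D.γ_boundary] at hz
    obtain ⟨x, -, rfl⟩ := hz
    exact ⟨_, toIcoMod_mem_Ico hl a x, by exact hper.sub_zsmul_eq _⟩
  have hfr : ∀ x, γ x ∈ frontier D.G := fun x => by
    rw [← D.γ_boundary]
    exact ⟨_, by simpa using toIcoMod_mem_Ico hl 0 x, by exact hper.sub_zsmul_eq _⟩
  have hBfr : ∀ i, ∀ u ∈ UI, B.τ i u ∈ frontier D.G := fun i u hu => by
    rw [← B.cover]; exact mem_iUnion.2 ⟨i, _, ⟨u, hu, rfl⟩, rfl⟩
  set J : Set ℂ := range fun i => B.τ i rI with hJd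
  have hJ : J.Finite := finite_range _
  have h1J : ∀ i, B.τ i rI ∈ J := fun i => ⟨i, rfl⟩
  have h0J : ∀ i, B.τ i rO ∈ J := fun i => by
    have hi := i.2
    have : ∃ k : Fin B.m, (k.val + 1) % B.m = i.val := by
      rcases Nat.eq_zero_or_pos i.val with h | h
      · exact ⟨⟨B.m - 1, by omega⟩, by rw [h]; simp [Nat.sub_add_cancel B.m_pos]⟩
      · exact ⟨⟨i.val - 1, by omega⟩, by simp only [Nat.sub_add_cancel h]; exact Nat.mod_eq_of_lt hi⟩
    obtain ⟨k, hk⟩ := this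
    refine ⟨k, ?_⟩
    have := B.junction k
    simp only [hk] at this
    simpa using this
  let i0 : Fin B.m := ⟨0, B.m_pos⟩
  have hne : B.τ i0 rO ≠ B.τ i0 rI := fun h => by
    have := B.inj i0 (B.seg_sub i0 ⟨0, by simp, rfl⟩) (B.seg_sub i0 ⟨1, by simp, rfl⟩) h
    simp at this
  obtain ⟨s0, -, hs0⟩ := hsurj 0 _ (hBfr i0 0 (by simp))
  obtain ⟨s1, hs1, hs1'⟩ := hsurj s0 _ (hBfr i0 1 (by simp))
  have hTf : {x | x ∈ Ico s0 (s0 + l) ∧ γ x ∈ J}.Finite :=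
    Finite.of_finite_image (f := γ) (hJ.subset (by rintro _ ⟨x, hx, rfl⟩; exact hx.2)) fun x hx y hy h => hinj s0 x hx.1 y hy.1 h
  set T := hTf.toFinset with hTd
  have hT : ∀ x, x ∈ T ↔ x ∈ Ico s0 (s0 + l) ∧ γ x ∈ J := fun x => by simp [hTd]
  have hs0T := (hT _).2 ⟨by simp [hl], hs0 ▸ h0J i0⟩
  obtain ⟨N, hN⟩ : ∃ N, T.card = N + 1 := Nat.exists_eq_succ_of_ne_zero (Finset.card_pos.2 ⟨_, hs0T⟩).ne'
  set f := T.orderEmbOfFin hN with hf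
  have hfT := fun k => T.orderEmbOfFin_mem hN k
  have hfs := fun x hx => by
    have : x ∈ range f := by rw [hf, Finset.range_orderEmbOfFin]; exact hx
    exact this
  set t : ℕ → ℝ := fun n => if h : n < N + 1 then f ⟨n, h⟩ else s0 + l with ht
  have htf : ∀ k : Fin (N+1), t k = f k := fun k => by simp only [ht]; rw [dif_pos k.2]
  have htl : t (N + 1) = s0 + l := by simp [ht]
  have hlt : ∀ m n, m < n → n ≤ N + 1 → t m < t n := fun m n h hn => by
    rw [show t m = f ⟨m, by omega⟩ from htf ⟨m, by omega⟩]
    rcases hn.lt_or_eq with h' | rfl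
    · rw [show t n = f ⟨n, h'⟩ from htf ⟨n, h'⟩]; exact f.strictMono h
    · rw [htl]; exact ((hT _).1 (hfT _)).1.2
  have hle : ∀ m n, m ≤ n → n ≤ N + 1 → t m ≤ t n := fun m n h hn => by
    rcases h.lt_or_eq with h | rfl
    · exact (hlt m n h hn).le
    · exact le_rfl
  have ht0 : t 0 = s0 := by
    obtain ⟨k, hk⟩ := hfs s0 hs0T
    refine le_antisymm ?_ ?_
    · rw [← hk, ← htf]; exact hle _ _ (Nat.zero_le _) (by omega)
    · exact ((hT _).1 (hfT _)).1.1
  have hp : γ (s0 + l) = γ s0 := hper s0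
  have htJ : ∀ n ≤ N + 1, γ (t n) ∈ J := fun n hn => by
    rcases hn.lt_or_eq with h' | rfl
    · rw [show t n = f ⟨n, h'⟩ from htf ⟨n, h'⟩]; exact ((hT _).1 (hfT _)).2
    · rw [htl, hp, hs0]; exact h0J i0
  have hN1 : 1 ≤ N := by
    obtain ⟨k, hk⟩ := hfs s1 ((hT _).2 ⟨hs1, hs1' ▸ h1J i0⟩)
    by_contra h
    have : k.val = 0 := by omega
    rw [← htf, this, ht0] at hk
    exact hne (by rw [← hs0, ← hs1', hk])
  have htI : ∀ n ≤ N, t n ∈ Ico s0 (s0 + l) := fun n hn => ⟨ht0 ▸ hle 0 n (by omega) (by omega), htl ▸ hlt n _ (by omega) le_rfl⟩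
  have hbt : ∀ n ≤ N, ∀ x ∈ Ioo (t n) (t (n + 1)), γ x ∉ J := fun n hn x hx hxJ => by
    obtain ⟨k, hk⟩ := hfs x ((hT x).2 ⟨⟨(htI n hn).1.trans hx.1.le, hx.2.trans_le (htl ▸ hle _ _ (by omega) le_rfl)⟩, hxJ⟩)
    rw [← htf] at hk
    rcases le_or_gt k.val n with h | h
    · exact (hle k n h (by omega)).not_gt (hk ▸ hx.1)
    · exact (hle (n+1) k h (by omega)).not_gt (hk ▸ hx.2)
  have hlo : ∀ x, s0 ≤ x → ∀ n, x < t n → ∃ m < n, t m ≤ x ∧ x < t (m + 1) := fun x hx n => by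
    induction n with
    | zero => intro h; rw [ht0] at h; exact absurd h hx.not_gt
    | succ n ih =>
      intro h
      rcases lt_or_ge x (t n) with h' | h'
      · obtain ⟨m, hm, h2⟩ := ih h'; exact ⟨m, by omega, h2⟩
      · exact ⟨n, by omega, h', h⟩
  have harc : ∀ j : Fin (N + 1), ∃ τ' U' σ, ArcD γ (t j) (t (j + 1)) τ' U' σ := fun j => by
    have hj : j.val ≤ N := by omega
    have hlt1 := hlt j (j + 1) (by omega) (by omega)
    have hc : (t j + t (j + 1)) / 2 ∈ Ioo (t j) (t (j + 1)) := ⟨by linarith, by linarith⟩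
    have hcf := hfr ((t j + t (j + 1)) / 2)
    rw [← B.cover] at hcf
    obtain ⟨i, _, ⟨us, hus, rfl⟩, hi⟩ := mem_iUnion.1 hcf
    refine arc_exists (l := l) (J := J) (τ := B.τ i) (U := B.U i) D.γ_cont hJ ?_ ?_ (htJ _ (by omega)) (htJ _ (by omega)) (hbt j hj)
      (B.U_open i) (fun u hu => B.seg_sub i ⟨u, hu, rfl⟩) (B.analytic i) (B.inj i) (h0J i) (h1J i) ?_ hus hc hi.symm
    · intro x hx y hy h
      have hp' : γ (t j + l) = γ (t j) := hper _
      rcases hx.2.lt_or_eq with h1 | h1 <;> rcases hy.2.lt_or_eq with h2 | h2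
      · exact Or.inl (hinj _ x ⟨hx.1, h1⟩ y ⟨hy.1, h2⟩ h)
      · exact Or.inr (Or.inl ⟨hinj _ x ⟨hx.1, h1⟩ _ ⟨le_rfl, by linarith⟩ (by rw [h, h2, hp']), h2⟩)
      · exact Or.inr (Or.inr ⟨h1, hinj _ y ⟨hy.1, h2⟩ _ ⟨le_rfl, by linarith⟩ (by rw [← h, h1, hp'])⟩)
      · exact Or.inl (h1.trans h2.symm)
    · rcases hj.lt_or_eq with h | h
      · linarith [(htI (j + 1) (by omega)).2, (htI j hj).1]
      · rw [h, htl]; linarith [hlt 0 N (by omega) (by omega)]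
    · intro u hu
      obtain ⟨x, hx, h⟩ := hsurj (t j) _ (hBfr i u hu)
      exact ⟨x, ⟨hx.1, hx.2.le⟩, h⟩
  choose τ U σ A using harc
  obtain ⟨V, V1, V2, V3, V4, V5⟩ := segV (fun j => (A j).op) (fun j => (A j).seg)
  have hσI : ∀ j, ∀ u ∈ UI, σ j u ∈ Icc s0 (s0 + l) := fun j u hu => by
    have := (A j).mem hu
    exact ⟨(htI j (by omega)).1.trans this.1, this.2.trans (htl ▸ hle _ _ (by omega) le_rfl)⟩
  have e0 : rO ∈ UI := by simp
  have e1 : rI ∈ UI := by simp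
  have hnx : ∀ j : Fin (N + 1), (j.val = N ∧ finRotate (N + 1) j = 0) ∨ (j.val < N ∧ (finRotate (N + 1) j).val = j.val + 1) := fun j => by
    by_cases h : j = Fin.last N
    · left; subst h; exact ⟨rfl, finRotate_last⟩
    · right
      have : j.val ≠ N := fun h' => h (Fin.ext h')
      exact ⟨by omega, coe_finRotate_of_ne_last h⟩
  refine ⟨⟨N + 1, by omega, τ, V, V1, V2, V3, V4, fun j => (A j).diff.mono (V5 j), fun j => (A j).inj.mono (V5 j),
    finRotate (N + 1), ?_, ?_, ?_, ?_, ?_, ?_⟩, ?_⟩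
  · intro j
    rw [← (A j).eq 1 e1, ← (A _).eq 0 e0, (A j).s1, (A _).s0]
    rcases hnx j with ⟨h, h'⟩ | ⟨h, h'⟩
    · rw [h', h, htl, hp]; simp [ht0]
    · rw [h']
  · rintro P ⟨j, hj⟩ h k
    have hd : ∀ d, ∀ i : Fin (N + 1), i.val + d = N → P i → P 0 := fun d => by
      induction d with
      | zero =>
        intro i hi hP
        rcases hnx i with ⟨-, h4⟩ | ⟨h4, -⟩
        · exact h4 ▸ h i hP
        · omega
      | succ d ih =>
        intro i hi hP
        rcases hnx i with ⟨h4, -⟩ | ⟨-, h4⟩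
        · omega
        · exact ih _ (by omega) (h i hP)
    have hu : ∀ n (hn : n < N + 1), P ⟨n, hn⟩ := fun n => by
      induction n with
      | zero => exact fun _ => hd (N - j.val) j (by omega) hj
      | succ n ih =>
        intro hn
        have h5 := h _ (ih (by omega))
        rcases hnx ⟨n, by omega⟩ with ⟨h4, -⟩ | ⟨-, h4⟩
        · simp only at h4; omega
        · convert h5 using 1; exact Fin.ext h4.symm
    exact hu k.val k.2
  · ext z
    simp only [mem_iUnion, mem_image]
    constructor
    · intro hz
      obtain ⟨x, hx, rfl⟩ := hsurj s0 z hz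
      obtain ⟨m, hm, h1, h2⟩ := hlo x hx.1 (N + 1) (htl ▸ hx.2)
      obtain ⟨u, hu, h3⟩ := (A ⟨m, hm⟩).surj ⟨h1, h2.le⟩
      exact ⟨_, u, hu, by rw [← (A _).eq u hu, h3]⟩
    · rintro ⟨j, u, hu, rfl⟩
      rw [← (A j).eq u hu]; exact hfr _
  · intro i j u hu u' hu' h
    have huI := Ioo_subset_Icc_self hu
    rw [← (A i).eq u huI, ← (A j).eq u' hu'] at h
    have a1 := (A i).s0 ▸ (A i).mono e0 huI hu.1
    have a2 := (A i).s1 ▸ (A i).mono huI e1 hu.2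
    have a3 : σ i u < s0 + l := a2.trans_le (htl ▸ hle _ _ (by omega) le_rfl)
    have a4 := (htI i (by omega)).1.trans_lt a1
    have b := (A j).mem hu'
    have hx : σ i u = σ j u' := by
      rcases (hσI j u' hu').2.lt_or_eq with h' | h'
      · exact hinj s0 _ ⟨a4.le, a3⟩ _ ⟨(hσI j u' hu').1, h'⟩ h
      · rw [h', hp] at h
        exact absurd (hinj s0 _ ⟨a4.le, a3⟩ s0 ⟨le_rfl, by linarith⟩ h) a4.ne'
    have hij : i = j := by
      rcases lt_trichotomy i j with h' | h' | h'
      · have := hle (i + 1) j h' (by omega); linarith [b.1]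
      · exact h'
      · have := hle (j + 1) i h' (by omega); linarith [b.2]
    subst hij
    exact ⟨rfl, (A i).mono.injOn huI hu' hx⟩
  · intro i j u hu h
    rw [← (A i).eq u hu, ← (A j).eq 0 e0, (A j).s0] at h
    have b := (A i).mem hu
    have hv : ∀ v ∈ UI, σ i u = σ i v → u = v := fun v hv h => (A i).mono.injOn hu hv h
    rcases (hσI i u hu).2.lt_or_eq with h' | h'
    · have hx := hinj s0 _ ⟨(hσI i u hu).1, h'⟩ _ (htI j (by omega)) h
      rcases lt_trichotomy i j with h' | h' | h'
      · right
        have h2 : ¬ (i.val + 1 < j.val) := fun h3 => by linarith [hlt _ _ h3 (by omega), b.2]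
        have h3 : j.val = i.val + 1 := by omega
        refine ⟨hv 1 e1 (by rw [(A i).s1, hx, h3]), Fin.ext ?_⟩
        rcases hnx i with ⟨h4, -⟩ | ⟨-, h4⟩
        · omega
        · omega
      · left; subst h'; exact ⟨hv 0 e0 (by rw [(A i).s0, hx]), rfl⟩
      · linarith [hlt j i h' (by omega), b.1]
    · right
      rw [h', hp] at h
      have hj := hinj s0 s0 ⟨le_rfl, by linarith⟩ _ (htI j (by omega)) h
      have hj0 : j.val = 0 := by
        by_contra h3; linarith [hlt 0 j (by omega) (by omega)]
      have hi : i.val = N := by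
        by_contra h3; linarith [hlt (i + 1) (N + 1) (by omega) le_rfl, b.2]
      refine ⟨hv 1 e1 (by rw [(A i).s1, h', hi, htl]), Fin.ext ?_⟩
      rcases hnx i with ⟨-, h4⟩ | ⟨h4, -⟩
      · rw [h4, hj0]; rfl
      · omega
  · intro j
    obtain ⟨i, hi⟩ := htJ j (by omega)
    rw [← (A j).eq 0 e0, (A j).s0, ← hi]
    refine ⟨B.extAngle i, hmin i, (B.extAngle_mem i).2, ?_⟩
    simpa using B.extAngle_spec i
  · intro g hg
    have hgp : Function.Periodic (fun s => g (γ s)) l := fun s => congrArg g (hper s)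
    have h1 := hgp.intervalIntegral_add_eq 0 s0
    have hgc : Continuous fun s => g (γ s) := hg.comp D.γ_cont
    have h2 := intervalIntegral.sum_integral_adjacent_intervals (μ := volume) (f := fun s => g (γ s)) (a := t) (n := N + 1)
      fun k _ => hgc.intervalIntegrable _ _
    rw [ht0, htl, Finset.sum_range] at h2
    rw [zero_add] at h1
    rw [h1, ← h2]
    refine sum_congr rfl fun j _ => (A j).integ (l := l) ?_ D.γ_unitSpeed D.γ_cont hg
    linarith [(htI j (by omega)).1, htl ▸ hle (j + 1) (N + 1) (by omega) le_rfl]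
theorem taylor2 {f : ℂ → ℂ} {V : Set ℂ} (hV : IsOpen V) (hf : DifferentiableOn ℂ f V) {x : ℂ} (hx : x ∈ V) :
    ∃ K > 0, ∃ r > 0, ∀ y, ‖y - x‖ ≤ r → ‖f y - f x - deriv f x * (y - x)‖ ≤ K * ‖y - x‖ ^ 2 := by
  have hn := hV.mem_nhds hx
  obtain ⟨r, hr, h⟩ := Metric.eventually_nhds_iff.1 (((((differentiableOn_dslope hn).2 ((differentiableOn_dslope hn).2 hf)).continuousOn.continuousAt hn).norm).eventually (gt_mem_nhds (lt_add_one _)))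
  refine ⟨‖dslope (dslope f x) x x‖ + 1, by positivity, r / 2, by positivity, fun y hy => ?_⟩
  have h2 := sub_smul_dslope f x y
  have h3 := sub_smul_dslope (dslope f x) x y
  rw [dslope_same, smul_eq_mul] at h3
  rw [smul_eq_mul] at h2
  have : f y - f x - deriv f x * (y - x) = (y - x) ^ 2 * dslope (dslope f x) x y := by grind
  rw [this, norm_mul, norm_pow, mul_comm]
  gcongr
  exact (h (by rw [dist_eq_norm]; linarith)).le
namespace ES
variable {G : Set ℂ} {lam : ℝ} (S : ES G lam)
def ww (j : Fin S.M) (e : Bool) : ℂ := (if e then -1 else 1) * deriv (S.τ j) (ep e 0 : ℝ)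
def ed (j : Fin S.M) (k : Bool) : Fin S.M := if k then j else S.nx j
def hh (j : Fin S.M) (k : Bool) (s : ℝ) : ℂ := S.τ (S.ed j k) (ep k s : ℝ)
def wv (j : Fin S.M) (k : Bool) : ℂ := S.ww (S.ed j k) k
theorem ep0 (e : Bool) : ep e 0 ∈ UI := by cases e <;> simp [ep]
theorem epI (e : Bool) {s : ℝ} (hs : s ∈ UI) : ep e s ∈ UI := by
  obtain ⟨h1, h2⟩ := hs
  cases e <;> simp [ep] <;> constructor <;> linarith
theorem hh0 (j : Fin S.M) (k : Bool) : S.τ (S.ed j k) (ep k 0 : ℝ) = S.τ j rI := by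
  cases k
  · simpa [ep, ed] using (S.nxτ j).symm
  · simp [ep, ed]
theorem cts (j : Fin S.M) : ContinuousOn (fun u : ℝ => S.τ j u) (Icc 0 1) :=
  (S.diff j).continuousOn.comp continuous_ofReal.continuousOn S.seg
theorem fr (j : Fin S.M) {u : ℝ} (hu : u ∈ UI) : S.τ j u ∈ frontier G := by
  rw [S.hL]; exact mem_iUnion.2 ⟨j, u, hu, rfl⟩
theorem he (hG : IsOpen G) (j : Fin S.M) : HE G (S.τ j rI) (S.hh j) (S.wv j) := by
  refine ⟨hG, fun k => ?_, ?_, fun k s hs => S.fr _ (epI k hs), fun ε hε => ?_⟩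
  · exact mul_ne_zero (by grind) (deriv_ne_zero_of_inj S.V_open (S.diff _) (S.inj _) (S.seg _ (ep0 k)))
  · have h : ∀ k, ∃ K > 0, ∃ r > 0, ∀ s ∈ Icc rO r, ‖S.hh j k s - S.τ j rI - S.wv j k * s‖ ≤ K * s ^ 2 := fun k => by
      obtain ⟨K, hK, r, hr, h⟩ := taylor2 S.V_open (S.diff (S.ed j k)) (S.seg _ (ep0 k))
      refine ⟨K, hK, r, hr, fun s hs => ?_⟩
      have e1 : (ep k s : ℂ) - (ep k 0 : ℝ) = (if k then -1 else 1) * s := by cases k <;> simp [ep]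
      have e2 : ‖(ep k s : ℂ) - (ep k 0 : ℝ)‖ = s := by
        rw [e1, norm_mul, Complex.norm_real, Real.norm_of_nonneg hs.1]; cases k <;> simp
      have := h (ep k s : ℝ) (e2.trans_le hs.2)
      rw [e2, e1, S.hh0] at this
      convert this using 2
      rw [hh, wv, ww]; ring
    obtain ⟨K, hK, r, hr, h1⟩ := h false
    obtain ⟨K', hK', r', hr', h2⟩ := h true
    refine ⟨max K K', by positivity, min r r', lt_min hr hr', fun k s hs => ?_⟩
    cases k
    · exact (h1 s ⟨hs.1, hs.2.trans (min_le_left _ _)⟩).trans (by gcongr; exact le_max_left _ _)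
    · exact (h2 s ⟨hs.1, hs.2.trans (min_le_right _ _)⟩).trans (by gcongr; exact le_max_right _ _)
  · have h : ∀ i, ∃ r > 0, ∀ u ∈ UI, ‖S.τ i u - S.τ j rI‖ < r → (i = S.nx j ∧ u < ε) ∨ (i = j ∧ 1 - u < ε) := fun i => by
      have hc : IsCompact {u ∈ UI | (i = S.nx j → ε ≤ u) ∧ (i = j → ε ≤ 1 - u)} := by
        have hcl : ∀ (P : Prop) (g : ℝ → ℝ), Continuous g → IsClosed {u : ℝ | P → ε ≤ g u} := fun P g hg => by
          by_cases h : P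
          · simpa [h] using isClosed_le continuous_const hg
          · grind
        exact isCompact_Icc.of_isClosed_subset (isClosed_Icc.inter ((hcl _ _ continuous_id).inter
          (hcl _ (fun u => 1 - u) (by fun_prop)))) (sep_subset _ _)
      obtain ⟨r, hr, h⟩ := hc.exists_forall_le' (f := fun u : ℝ => ‖S.τ i u - S.τ j rI‖)
        (((S.cts i).mono (sep_subset _ _)).sub continuousOn_const).norm (fun u hu => by
          rw [norm_pos_iff, sub_ne_zero, S.nxτ]
          intro h
          rcases S.ver i _ u hu.1 h with ⟨h0, h1⟩ | ⟨h0, h1⟩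
          · grind
          · linarith [hu.2.2 (S.nx.injective h1)])
      grind
    choose r hr h using h
    have : Nonempty (Fin S.M) := ⟨⟨0, S.Mp⟩⟩
    refine ⟨Finset.univ.inf' univ_nonempty r, (Finset.lt_inf'_iff _).2 fun i _ => hr i, fun z hz hl => ?_⟩
    rw [S.hL] at hz
    obtain ⟨i, u, hu, rfl⟩ := mem_iUnion.1 hz
    rcases h i u hu (hl.trans_le (Finset.inf'_le _ (mem_univ i))) with ⟨rfl, h1⟩ | ⟨rfl, h1⟩
    · exact ⟨false, u, ⟨hu.1, h1⟩, by simp [hh, ed, ep]⟩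
    · exact ⟨true, 1 - u, ⟨by linarith [hu.2], h1⟩, by simp [hh, ed, ep]⟩
theorem corn (hG : IsOpen G) (hl : 0 < lam) (j : Fin S.M) : ∃ lv e, lam ≤ lv ∧ 0 < lv ∧ lv < 2 ∧
    CornerE G (S.τ j rI) (S.wv j) e (lv * π / 2) ∧ ∀ c : ℝ, 0 ≤ c → S.wv j false ≠ c * S.wv j true := by
  obtain ⟨lv, h1, h2, h3⟩ := S.ang (S.nx j)
  rw [← S.nxτ] at h3
  obtain ⟨⟨e, he⟩, hn⟩ := (S.he hG j).corner (hl.trans_le h1) h2 h3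
  grind
theorem tr (hG : IsOpen G) (hl : 0 < lam) (j : Fin S.M) : ∃ c > 0, ∃ r > 0, ∀ s ∈ Icc rO r, ∀ ρ ∈ Icc rO r,
    c * (s + ρ) ≤ ‖S.τ j (1 - s : ℝ) - S.τ (S.nx j) ρ‖ := by
  obtain ⟨_, _, -, -, -, -, hn⟩ := S.corn hG hl j
  have H := S.he hG j
  obtain ⟨c, hc, h⟩ := transv (H.w0 true) hn
  obtain ⟨K, hK, r, hr, hq⟩ := H.quad
  refine ⟨c / 2, by positivity, min r (c / (2 * K)), by positivity, fun s hs ρ hρ => ?_⟩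
  have h1 := hq true s ⟨hs.1, hs.2.trans (min_le_left _ _)⟩
  have h2 := hq false ρ ⟨hρ.1, hρ.2.trans (min_le_left _ _)⟩
  have h3 := h s ρ hs.1 hρ.1
  have h4 := (le_div_iff₀ (by positivity)).1 (hs.2.trans (min_le_right _ _))
  have h5 := (le_div_iff₀ (by positivity)).1 (hρ.2.trans (min_le_right _ _))
  simp only [hh, ed, ep] at h1 h2
  simp only [if_true, Bool.false_eq_true, if_false] at h1 h2
  set A := S.τ j (1 - s : ℝ)
  set B := S.τ (S.nx j) ρ
  have h6 : ‖S.wv j true * s - S.wv j false * ρ‖ ≤ ‖A - B‖ + ‖A - S.τ j rI - S.wv j true * s‖ + ‖B - S.τ j rI - S.wv j false * ρ‖ := by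
    calc _ = ‖(A - B) - (A - S.τ j rI - S.wv j true * s) + (B - S.τ j rI - S.wv j false * ρ)‖ := by ring
      _ ≤ _ := (norm_add_le _ _).trans (by gcongr; exact norm_sub_le _ _)
  nlinarith [hs.1, hρ.1]
theorem rr (hG : IsOpen G) (hl : 0 < lam) {i j : Fin S.M} (hij : i ≠ j) : ∃ c > 0, ∀ u ∈ UI, ∀ u' ∈ UI,
    c * (u' * (1 - u')) ≤ ‖S.τ i u - S.τ j u'‖ := by
  have hc : IsCompact (UI ×ˢ UI) := isCompact_Icc.prod isCompact_Icc
  set Q := UI ×ˢ UI with hQ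
  have hφ : ContinuousOn (fun q : ℝ × ℝ => ‖S.τ i q.1 - S.τ j q.2‖) Q :=
    (((S.cts i).comp continuousOn_fst fun q hq => hq.1).sub ((S.cts j).comp continuousOn_snd fun q hq => hq.2)).norm
  suffices h : ∃ c > 0, ∀ q ∈ Q, q ∈ Q → c * (q.2 * (1 - q.2)) ≤ ‖S.τ i q.1 - S.τ j q.2‖ by
    obtain ⟨c, hc, h⟩ := h
    exact ⟨c, hc, fun u hu u' hu' => h (u, u') ⟨hu, hu'⟩ ⟨hu, hu'⟩⟩
  have hn : ∀ q ∈ Q, 0 ≤ q.2 * (1 - q.2) := fun q hq => mul_nonneg hq.2.1 (by grind)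
  refine hc.induction_on (p := fun s => ∃ c > 0, ∀ q ∈ s, q ∈ Q → c * (q.2 * (1 - q.2)) ≤ ‖S.τ i q.1 - S.τ j q.2‖)
    ⟨1, one_pos, by simp⟩ (fun s t hst ⟨c, hc, h⟩ => ⟨c, hc, fun q hq => h q (hst hq)⟩) ?_ ?_
  · rintro s t ⟨c, hc, h⟩ ⟨c', hc', h'⟩
    refine ⟨min c c', lt_min hc hc', fun q hq hqQ => ?_⟩
    have := hn q hqQ
    rcases hq with hq | hq
    · exact le_trans (by gcongr; exact min_le_left _ _) (h q hq hqQ)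
    · exact le_trans (by gcongr; exact min_le_right _ _) (h' q hq hqQ)
  · rintro ⟨p, q⟩ hpq
    by_cases h0 : S.τ i p = S.τ j q
    · have hq : q = 0 ∨ q = 1 := by
        by_contra hcon
        push Not at hcon
        exact hij (S.int j i q ⟨lt_of_le_of_ne hpq.2.1 hcon.1.symm, lt_of_le_of_ne hpq.2.2 hcon.2⟩ p hpq.1 h0.symm).1.symm
      rcases hq with rfl | rfl
      · obtain ⟨rfl, rfl⟩ : p = 1 ∧ S.nx i = j := by
          rcases S.ver i j p hpq.1 h0 with h | h
          · grind
          · grind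
        obtain ⟨c, hc, r, hr, h⟩ := S.tr hG hl i
        refine ⟨{q | 1 - r < q.1 ∧ q.2 < r}, mem_nhdsWithin_of_mem_nhds (IsOpen.mem_nhds ((isOpen_lt continuous_const continuous_fst).inter
          (isOpen_lt continuous_snd continuous_const)) ⟨by simp [hr], hr⟩), c, hc, fun q hq hqQ => ?_⟩
        have h1 := hqQ.1; have h2 := hqQ.2
        have := h (1 - q.1) ⟨by linarith [h1.2], by linarith [hq.1]⟩ q.2 ⟨h2.1, hq.2.le⟩
        rw [sub_sub_cancel] at this
        refine le_trans ?_ this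
        nlinarith [h1.2, h2.1, mul_nonneg h2.1 h2.1]
      · obtain ⟨rfl, rfl⟩ : p = 0 ∧ S.nx j = i := by
          rw [S.nxτ] at h0
          rcases S.ver i _ p hpq.1 h0 with h | h
          · grind
          · exact absurd (S.nx.injective h.2) hij
        obtain ⟨c, hc, r, hr, h⟩ := S.tr hG hl j
        refine ⟨{q | 1 - r < q.2 ∧ q.1 < r}, mem_nhdsWithin_of_mem_nhds (IsOpen.mem_nhds ((isOpen_lt continuous_const continuous_snd).inter
          (isOpen_lt continuous_fst continuous_const)) ⟨by simp [hr], hr⟩), c, hc, fun q hq hqQ => ?_⟩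
        have h1 := hqQ.1; have h2 := hqQ.2
        have := h (1 - q.2) ⟨by linarith [h2.2], by linarith [hq.1]⟩ q.1 ⟨h1.1, hq.2.le⟩
        rw [sub_sub_cancel, norm_sub_rev] at this
        refine le_trans ?_ this
        gcongr
        nlinarith [h1.1, h2.2, h2.1]
    · have h1 : 0 < ‖S.τ i p - S.τ j q‖ := norm_pos_iff.2 (sub_ne_zero.2 h0)
      refine ⟨_, (hφ (p, q) hpq) (lt_mem_nhds (half_lt_self h1)), _, half_pos h1, fun x hx hxQ => ?_⟩
      have h2 := hxQ.2
      have : ‖S.τ i p - S.τ j q‖ / 2 < ‖S.τ i x.1 - S.τ j x.2‖ := hx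
      have : x.2 * (1 - x.2) ≤ 1 := by nlinarith [h2.1, h2.2]
      nlinarith
end ES
theorem fin_min {ι : Type} [Finite ι] {P : ι → ℝ → Prop} (hm : ∀ i c c', 0 < c' → c' ≤ c → P i c → P i c')
    (h : ∀ i, ∃ c > 0, P i c) : ∃ c > 0, ∀ i, P i c := by
  have := Fintype.ofFinite ι
  choose c hc h using h
  rcases isEmpty_or_nonempty ι with h0 | h0
  · exact ⟨1, one_pos, fun i => h0.elim i⟩
  · have h1 : 0 < Finset.univ.inf' univ_nonempty c := (Finset.lt_inf'_iff _).2 fun i _ => hc i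
    exact ⟨_, h1, fun i => hm i _ _ h1 (Finset.inf'_le _ (mem_univ i)) (h i)⟩
namespace ES
variable {G : Set ℂ} {lam : ℝ} (S : ES G lam)
theorem kap (hG : IsOpen G) (hl : 0 < lam) {F : Set ℂ} (hF : IsCompact F) (hFG : F ⊆ G) :
    ∃ κ0 > 0, ∀ κ ∈ Ioo rO κ0, Th κ ⊆ S.V ∧ (∀ j, ∀ x ∈ Th κ, S.τ j x ∉ F) ∧
      (∃ cd > 0, ∀ i j, ∀ u ∈ UI, ∀ v ∈ UO, ∀ b : ℝ, (b = κ ∨ b = -κ) →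
        cd * (v * (1 - v)) ≤ ‖S.τ i u - S.τ j (pth b v)‖) ∧
      (∀ i j, ∀ u ∈ UI, ∀ x ∈ Th κ, S.τ i u = S.τ j x → x.im = 0) := by
  obtain ⟨δ, hδ, hδW⟩ := (isCompact_Icc.image continuous_ofReal : IsCompact (Complex.ofReal '' UI)).exists_thickening_subset_open (isOpen_iInter_of_finite fun j => (S.diff j).continuousOn.isOpen_inter_preimage S.V_open hF.isClosed.isOpen_compl)
    (by
      rintro _ ⟨u, hu, rfl⟩
      refine mem_iInter.2 fun j => ⟨S.seg u hu, fun h => ?_⟩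
      have := S.fr j hu
      rw [hG.frontier_eq] at this
      exact this.2 (hFG h))
  have hTW : ∀ x ∈ Th δ, ∀ j, x ∈ S.V ∧ S.τ j x ∉ F := fun x hx j => by
    refine mem_iInter.1 (hδW (mem_thickening_iff.2 ⟨_, ⟨x.re, ⟨hx.1, hx.2.1⟩, rfl⟩, ?_⟩)) j
    have e : x - x.re = x.im * I := by apply Complex.ext <;> simp
    rw [dist_eq_norm, e, norm_mul, norm_I, mul_one, norm_real, Real.norm_eq_abs]
    refine hx.2.2.trans_lt ?_
    rw [abs_of_pos hδ]
    nlinarith [sq_nonneg (x.re - 1 / 2)]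
  have hTV : Th δ ⊆ S.V := fun x hx => (hTW x hx ⟨0, S.Mp⟩).1
  obtain ⟨c, hc, hR⟩ : ∃ c > 0, ∀ q : {q : Fin S.M × Fin S.M // q.1 ≠ q.2}, ∀ u ∈ UI, ∀ u' ∈ UI,
      c * (u' * (1 - u')) ≤ ‖S.τ q.1.1 u - S.τ q.1.2 u'‖ :=
    fin_min (fun q c c' h0 h1 h u hu u' hu' => le_trans (by
      have : 0 ≤ u' * (1 - u') := mul_nonneg hu'.1 (by grind)
      gcongr) (h u hu u' hu')) fun q => S.rr hG hl q.2
  obtain ⟨c2, hc2, hB⟩ : ∃ c > 0, ∀ j, ∀ x ∈ Th δ, ∀ y ∈ Th δ, c * ‖x - y‖ ≤ ‖S.τ j x - S.τ j y‖ :=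
    fin_min (fun j c c' h0 h1 h x hx y hy => le_trans (by gcongr) (h x hx y hy))
      fun j => bilip S.V_open (S.diff j) (S.inj j) (Th_compact δ) hTV
  obtain ⟨B', hB', hD⟩ : ∃ c > 0, ∀ j, ∀ x ∈ Th δ, ‖deriv (S.τ j) x‖ ≤ 1 / c :=
    fin_min (fun j c c' h0 h1 h x hx => (h x hx).trans (by gcongr)) fun j => by
      obtain ⟨C, hC⟩ := (Th_compact δ).exists_bound_of_continuousOn (((S.diff j).deriv S.V_open).continuousOn.mono hTV)
      exact ⟨1 / (|C| + 1), by positivity, fun x hx => by linarith [hC x hx, le_abs_self C]⟩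
  refine ⟨min δ (c * B' / 2), by positivity, fun κ hκ => ?_⟩
  have hκ0 := hκ.1
  have hκ1 := hκ.2.trans_le (min_le_left _ _)
  have hκ2 := hκ.2.trans_le (min_le_right _ _)
  have hsub : Th κ ⊆ Th δ := fun x hx => ⟨hx.1, hx.2.1, hx.2.2.trans (by
    have : 0 ≤ x.re * (1 - x.re) := mul_nonneg hx.1 (by linarith [hx.2.1])
    gcongr)⟩
  have key : ∀ i j, i ≠ j → ∀ u ∈ UI, ∀ x ∈ Th κ, c / 2 * (x.re * (1 - x.re)) ≤ ‖S.τ i u - S.τ j x‖ := fun i j hij u hu x hx => by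
    have hr : x.re ∈ UI := ⟨hx.1, hx.2.1⟩
    have h1 := hR ⟨(i, j), hij⟩ u hu x.re hr
    have h2 := (Th_convex δ).norm_image_sub_le_of_norm_deriv_le (C := 1 / B')
      (fun y hy => (S.diff j).differentiableAt (S.V_open.mem_nhds (hTV hy))) (hD j) (hsub hx) (real_mem_Th δ hr)
    have e : (x.re : ℂ) - x = -(x.im * I) := by apply Complex.ext <;> simp
    rw [e, norm_neg, norm_mul, norm_I, mul_one, Complex.norm_real, Real.norm_eq_abs] at h2
    have h3 := hx.2.2
    rw [abs_of_pos hκ0] at h3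
    have h4 : ‖S.τ i u - S.τ j x.re‖ ≤ ‖S.τ i u - S.τ j x‖ + ‖S.τ j x.re - S.τ j x‖ := by
      rw [norm_sub_rev (S.τ j x.re)]; exact norm_sub_le_norm_sub_add_norm_sub _ _ _
    have hn : 0 ≤ x.re * (1 - x.re) := mul_nonneg hx.1 (by grind)
    have h5 : 1 / B' * |x.im| ≤ c / 2 * (x.re * (1 - x.re)) := by
      calc _ ≤ 1 / B' * (c * B' / 2 * (x.re * (1 - x.re))) := by gcongr; exact h3.trans (by gcongr)
        _ = _ := by field_simp
    linarith
  refine ⟨hsub.trans hTV, fun j x hx => (hTW x (hsub hx) j).2, ⟨min (c / 2) (c2 * κ), by positivity, ?_⟩, ?_⟩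
  · intro i j u hu v hv b hb
    have hm : pth b v ∈ Th κ := by
      have := pth_mem b (Ioo_subset_Icc_self hv)
      rcases hb with rfl | rfl
      · grind
      · rwa [Th_neg] at this
    have hn : 0 ≤ v * (1 - v) := mul_nonneg hv.1.le (by grind)
    by_cases hij : i = j
    · subst hij
      refine le_trans ?_ (hB i u (real_mem_Th δ hu) _ (hsub hm))
      have : κ * (v * (1 - v)) ≤ ‖(u:ℂ) - pth b v‖ := by
        refine le_trans (le_of_eq ?_) (Complex.abs_im_le_norm _)
        rw [Complex.sub_im, pth_im, Complex.ofReal_im, zero_sub, abs_neg, abs_mul, abs_of_nonneg hn]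
        grind
      calc _ ≤ c2 * κ * (v * (1 - v)) := by gcongr; exact min_le_right _ _
        _ ≤ _ := by rw [mul_assoc]; gcongr
    · refine le_trans ?_ (key i j hij u hu _ hm)
      rw [pth_re]; gcongr; exact min_le_left _ _
  · intro i j u hu x hx h
    by_cases hij : i = j
    · subst hij
      rw [← S.inj i (S.seg u hu) (hTV (hsub hx)) h]; simp
    · have h1 := key i j hij u hu x hx
      rw [h, sub_self, norm_zero] at h1
      have hn : 0 ≤ x.re * (1 - x.re) := mul_nonneg hx.1 (by linarith [hx.2.1])
      have h2 := hx.2.2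
      rw [show x.re * (1 - x.re) = 0 by nlinarith, mul_zero] at h2
      grind
end ES
theorem endlim {v e d : ℂ} {t θ : ℝ} {g : ℝ → ℂ} (hg : Tendsto (fun s : ℝ => (g s - v) / s) N0 (nhds d))
    (hd : d ≠ 0) (he : e ≠ 0) (ht : 0 < t) (hθ : θ < π) (ha : |arg (d / e)| < θ) :
    ∀ᶠ s in N0, |arg (-Corner.X v (v + t * e) (g s))| ≤ θ - (θ - |arg (d / e)|) / 2 ∧
      ∃ ξ : ℂ, ξ ≠ 0 ∧ |arg ξ| ≤ θ ∧ v + t * e * (ξ / (1 + ξ)) = g s := by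
  have hte : t * e ≠ 0 := mul_ne_zero (by exact_mod_cast ht.ne') he
  have hs0 : Tendsto (fun s : ℝ => (s : ℂ)) N0 (nhds 0) := by
    exact (continuous_ofReal.tendsto 0).mono_left nhdsWithin_le_nhds
  have hgv : Tendsto (fun s => v + t * e - g s) N0 (nhds (t * e)) := by
    have := (hg.mul hs0).const_sub (t * e)
    rw [mul_zero, sub_zero] at this
    refine this.congr' ?_
    filter_upwards [self_mem_nhdsWithin] with s hs
    have : (s : ℂ) ≠ 0 := by exact_mod_cast (hs).ne'
    grind
  have harg : arg (d / (t * e)) = arg (d / e) := by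
    rw [show d / (t * e) = ((t⁻¹ : ℝ) : ℂ) * (d / e) by push_cast; field_simp, arg_real_mul _ (by positivity)]
  have hsl : d / (t * e) ∈ slitPlane := by
    rw [mem_slitPlane_iff_arg, harg]
    grind
  have hlim := ((continuousAt_arg hsl).tendsto.comp (hg.div hgv hte)).abs
  rw [harg] at hlim
  filter_upwards [hlim (gt_mem_nhds (show |arg (d / e)| < θ - (θ - |arg (d / e)|) / 2 by linarith)), hg.eventually_ne hd,
    hgv.eventually_ne hte, self_mem_nhdsWithin] with s h1 h2 h3 hs
  have hs0 : (s : ℂ) ≠ 0 := by grind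
  have hX : -Corner.X v (v + t * e) (g s) = s * ((g s - v) / s / (v + t * e - g s)) := by
    rw [Corner.X, ← neg_sub (v + t * e) (g s)]; field_simp
  have hXa : |arg (-Corner.X v (v + t * e) (g s))| < θ - (θ - |arg (d / e)|) / 2 := by
    rw [hX, arg_real_mul _ hs]; exact h1
  refine ⟨hXa.le, _, ?_, hXa.le.trans (by linarith), ?_⟩
  · grind
  · grind
namespace ES
variable {G : Set ℂ} {lam : ℝ} (S : ES G lam)
theorem path_tend (j : Fin S.M) (e : Bool) (b : ℝ) : Tendsto (fun s : ℝ => (S.τ j (pth b (ep e s)) - S.τ j (ep e 0 : ℝ)) / s)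
    N0 (nhds (S.ww j e * (1 + ((if e then -b else b : ℝ) : ℂ) * I))) := by
  have hp : HasDerivAt (fun s => pth b (ep e s)) (if e then -pthd b 1 else pthd b 0) 0 := by
    cases e
    · simpa [ep] using pth_hasDerivAt b 0
    · have h1 : HasDerivAt (pth b) (pthd b 1) (rI - 0) := by rw [sub_zero]; exact pth_hasDerivAt b 1
      simpa [ep, Function.comp_def] using h1.scomp rO ((hasDerivAt_id' rO).const_sub 1)
  have e0 : pth b (ep e 0) = (ep e 0 : ℝ) := by cases e <;> simp [ep]
  have hd : HasDerivAt (S.τ j) (deriv (S.τ j) (ep e 0 : ℝ)) (pth b (ep e 0)) := by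
    rw [e0]; exact ((S.diff j).differentiableAt (S.V_open.mem_nhds (S.seg _ (ep0 e)))).hasDerivAt
  have := ((hd.comp rO hp).hasDerivWithinAt (s := Ioi 0))
  rw [hasDerivWithinAt_iff_tendsto_slope' (by simp)] at this
  convert this using 1
  · ext s; simp only [slope, Function.comp, vsub_eq_sub, e0]
    rw [real_smul]; push_cast; ring
  · rw [ww]; cases e <;> simp [pthd]; ring
theorem mid (hG : IsOpen G) {κ : ℝ} (hκ : 0 < κ) {Y : Set ℂ} {j : Fin S.M} {u : ℝ} (hu : u ∈ UO)
    (h : S.τ j u ∈ closure Y) : ∃ x ∈ Th κ, S.τ j x ∈ Y := by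
  have hV := S.seg u (Ioo_subset_Icc_self hu)
  have hT : Th κ ∈ nhds (u : ℂ) := by
    have ho : IsOpen {x : ℂ | 0 < x.re ∧ x.re < 1 ∧ |x.im| < |κ| * (x.re * (1 - x.re))} :=
      (isOpen_lt continuous_const continuous_re).inter ((isOpen_lt continuous_re continuous_const).inter
        (isOpen_lt continuous_im.abs (by fun_prop)))
    refine mem_of_superset (ho.mem_nhds ?_) fun x hx => ⟨hx.1.le, hx.2.1.le, hx.2.2.le⟩
    refine ⟨by simpa using hu.1, by simpa using hu.2, ?_⟩
    have := mul_pos hu.1 (sub_pos.2 hu.2)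
    simp; positivity
  obtain ⟨y, ⟨x, hx, rfl⟩, hy⟩ := mem_closure_iff_nhds.1 h _ (((((S.diff j).analyticAt (S.V_open.mem_nhds hV)).hasStrictDerivAt).map_nhds_eq (deriv_ne_zero_of_inj S.V_open (S.diff j) (S.inj j) hV)) ▸ image_mem_map hT)
  grind
end ES
namespace ES
variable {G : Set ℂ} {lam : ℝ} (S : ES G lam)
theorem half {κ : ℝ} (hV : Th κ ⊆ S.V) (hoff : ∀ i j, ∀ u ∈ UI, ∀ x ∈ Th κ, S.τ i u = S.τ j x → x.im = 0)
    (j : Fin S.M) (σ : ℝ) : IsPreconnected (S.τ j '' {x | x ∈ Th κ ∧ 0 < σ * x.im}) ∧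
      ∀ z ∈ S.τ j '' {x | x ∈ Th κ ∧ 0 < σ * x.im}, z ∉ frontier G := by
  constructor
  · refine IsPreconnected.image ?_ _ ((S.diff j).continuousOn.mono fun x hx => hV hx.1)
    refine Convex.isPreconnected ((Th_convex κ).inter fun x hx y hy a b ha hb hab => ?_)
    have hy' : 0 < σ * y.im := hy
    change 0 < σ * (a • x + b • y).im
    have e : σ * (a • x + b • y).im = a * (σ * x.im) + b * (σ * y.im) := by simp; ring
    rcases ha.eq_or_lt with rfl | ha
    · rw [zero_add] at hab; subst hab; simpa using hy'
    · have := mul_pos ha hx; have := mul_nonneg hb hy'.le; linarith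
  · rintro _ ⟨x, hx, rfl⟩ h
    rw [S.hL] at h
    obtain ⟨i, u, hu, h⟩ := mem_iUnion.1 h
    have := hoff i j u hu x hx.1 h
    have h2 := hx.2
    rw [this, mul_zero] at h2
    grind
theorem toGeo (hG : IsOpen G) (hne : G.Nonempty) (hb : Bornology.IsBounded G) (hcon : IsPreconnected G) (hl : 0 < lam)
    {F : Set ℂ} (hF : IsCompact F) (hFG : F ⊆ G) : ∃ E : Geo G F, (∀ j e, E.EndD lam j e) ∧ ∀ g : ℂ → ℂ,
      ∑ j, ∫ u, (E.Wt j u : ℂ) * g (E.τ j u) ∂m01 = ∑ j, ∫ u, (‖deriv (S.τ j) (u : ℝ)‖ : ℂ) * g (S.τ j u) ∂m01 := by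
  choose lv ee hlv l0 l2 hC hnp using fun m => S.corn hG hl m
  choose t ht L hL1 hL2 hL3 hL4 using fun m => (S.he hG m).lens (hC m)
  obtain ⟨κ0, hκ0, hk⟩ := S.kap hG hl hF hFG
  obtain ⟨κ1, hκ1, hsg⟩ := fin_min (P := fun (q : Fin S.M × Bool) c => ∀ κ ∈ Ioo rO c, ∃ a : ℝ, (a = κ ∨ a = -κ) ∧
      CD G (S.τ q.1 rI) (S.wv q.1 q.2 * (1 + a * I)) ∧ CD (closure G)ᶜ (S.τ q.1 rI) (S.wv q.1 q.2 * (1 - a * I)) ∧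
      |arg (S.wv q.1 q.2 * (1 - a * I) / ee q.1)| < lv q.1 * π / 2)
    (fun q c c' h0 h1 h κ hκ => h κ ⟨hκ.1, hκ.2.trans_le h1⟩) fun q => (hC q.1).sign q.2
  set κ := min κ0 κ1 / 2 with hκd
  have hmin : 0 < min κ0 κ1 := lt_min hκ0 hκ1
  have hκ : 0 < κ := by positivity
  obtain ⟨hV, hav, ⟨cd, hcd, hdist⟩, hoff⟩ := hk κ ⟨hκ, (half_lt_self hmin).trans_le (min_le_left _ _)⟩
  choose a' ha' hGd hEd harg using fun m k => hsg (m, k) κ ⟨hκ, (half_lt_self hmin).trans_le (min_le_right _ _)⟩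
  simp only at hGd hEd harg
  set a : Fin S.M → ℝ := fun j => a' (S.nx.symm j) false with had
  have ha : ∀ j, a j = κ ∨ a j = -κ := fun j => ha' _ _
  have ha0 : ∀ j, a j ≠ 0 := fun j => by rcases ha j with h | h <;> rw [h] <;> [exact hκ.ne'; exact neg_ne_zero.2 hκ.ne']
  have hTh : ∀ j, Th (a j) = Th κ := fun j => by rcases ha j with h | h <;> rw [h] ; exact Th_neg κ
  have hcl : ∀ z, z ∉ G → z ∉ frontier G → z ∉ closure G := fun z h1 h2 h => by
    rw [closure_eq_self_union_frontier] at h; exact h.elim h1 h2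
  have hpth : ∀ j, ∀ σ : ℝ, (σ = 1 ∨ σ = -1) → ∀ k, ∀ᶠ s in N0,
      pth (σ * a j) (ep k s) ∈ {x | x ∈ Th κ ∧ 0 < (σ * a j) * x.im} := fun j σ hσ k => by
    filter_upwards [Ioc_mem_nhdsGT (show rO < 1 / 2 by norm_num)] with s hs
    have h1 := ep_mem k hs
    have hσ0 : σ * a j ≠ 0 := mul_ne_zero (by rcases hσ with h | h <;> rw [h] <;> norm_num) (ha0 j)
    refine ⟨?_, ?_⟩
    · have := pth_mem (σ * a j) (Ioo_subset_Icc_self h1)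
      rcases hσ with rfl | rfl
      · grind
      · rwa [neg_one_mul, Th_neg, hTh, ← neg_one_mul] at this
    · rw [pth_im]
      have := mul_pos h1.1 (sub_pos.2 h1.2)
      have := mul_self_pos.2 hσ0
      nlinarith
  have hhG : ∀ j, ∀ x ∈ Th κ, 0 < a j * x.im → S.τ j x ∈ G := fun j x hx hxi => by
    obtain ⟨m, rfl⟩ := S.nx.surjective j
    have h1 := S.path_tend (S.nx m) false (a (S.nx m))
    have e1 : a (S.nx m) = a' m false := by simp [had]
    have e2 : S.τ (S.nx m) (ep false 0 : ℝ) = S.τ m rI := by simpa [ep] using (S.nxτ m).symm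
    rw [e2] at h1
    have h2 := (hGd m false).ev (g := fun s => S.τ (S.nx m) (pth (a (S.nx m)) (ep false s))) (by
      convert h1 using 2; simp [e1, wv, ed])
    obtain ⟨s, h3, h4⟩ := (h2.and (hpth (S.nx m) 1 (Or.inl rfl) false)).exists
    rw [one_mul] at h4
    obtain ⟨p1, p2⟩ := S.half hV hoff (S.nx m) (a (S.nx m))
    by_contra hcon
    obtain ⟨z, hz, hzf⟩ := meets_frontier hG p1 (mem_image_of_mem _ h4) h3 (mem_image_of_mem _ ⟨hx, hxi⟩) hcon
    grind
  have hat : ∀ m, a' m true = -a m := fun m => by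
    by_contra hcon
    have e1 : a' m true = a m := by grind
    have h1 := S.path_tend m true (a m)
    have h2 := (hEd m true).ev (g := fun s => S.τ m (pth (a m) (ep true s))) (by
      convert h1 using 2
      · simp [ep]
      · simp [e1, wv, ed, sub_eq_add_neg])
    obtain ⟨s, h3, h4⟩ := (h2.and (hpth m 1 (Or.inl rfl) true)).exists
    rw [one_mul] at h4
    exact h3 (subset_closure (hhG m _ h4.1 h4.2))
  have htend : ∀ m k, Tendsto (fun s => (S.τ (S.ed m k) (pth (-a (S.ed m k)) (ep k s)) - S.τ m rI) / s)
      N0 (nhds (S.wv m k * (1 - a' m k * I))) := fun m k => by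
    have h1 := S.path_tend (S.ed m k) k (-a (S.ed m k))
    rw [S.hh0] at h1
    convert h1 using 2
    rw [wv]; congr 1
    cases k
    · simp [had, ed, sub_eq_add_neg]
    · simp [hat, ed]
  have hee : ∀ m, ee m ≠ 0 := fun m => norm_ne_zero_iff.1 (by rw [(hC m).e1]; norm_num)
  have hd0 : ∀ m k, S.wv m k * (1 - a' m k * I) ≠ 0 := fun m k =>
    mul_ne_zero ((S.he hG m).w0 k) fun h => by have := congrArg re h; simp at this
  have hend := fun m k => endlim (htend m k) (hd0 m k) (hee m) (ht m) (hC m).tp (harg m k)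
  have hK : IsCompact (closure G) := hb.isCompact_closure
  have hhE : ∀ j, ∀ z ∈ S.τ j '' {x | x ∈ Th κ ∧ 0 < (-1 * a j) * x.im}, z ∉ closure G := fun j => by
    obtain ⟨p1, p2⟩ := S.half hV hoff j (-1 * a j)
    obtain ⟨m, rfl⟩ := S.nx.surjective j
    obtain ⟨s, h3, h4⟩ := (((hEd m false).ev (htend m false)).and (hpth (S.nx m) (-1) (Or.inr rfl) false)).exists
    rw [neg_one_mul] at h4
    intro z hz
    refine hcl z (fun h => ?_) (p2 z hz)
    rw [neg_one_mul] at p1 p2 hz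
    obtain ⟨z', hz', hzf⟩ := meets_frontier hG p1 hz h (mem_image_of_mem _ h4) (fun h => h3 (subset_closure h))
    exact p2 z' hz' hzf
  have hsp : ∀ j x, S.τ j x ∈ Yset G → x ∈ Th κ → 0 < (-1 * a j) * x.im →
      ∀ y ∈ Th κ, 0 < (-1 * a j) * y.im → S.τ j y ∈ Yset G := fun j x h1 h2 h3 y hy hy' =>
    Ysub hK (S.half hV hoff j (-1 * a j)).1 (hhE j) (mem_image_of_mem _ ⟨h2, h3⟩) h1 (mem_image_of_mem _ ⟨hy, hy'⟩)
  have hnear : ∀ m k, ∃ x ∈ Th κ, 0 < (-1 * a (S.ed m k)) * x.im ∧ S.τ (S.ed m k) x ∈ L m := fun m k => by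
    obtain ⟨s, ⟨-, ξ, h1, h2, h3⟩, h4⟩ := ((hend m k).and (hpth (S.ed m k) (-1) (Or.inr rfl) k)).exists
    rw [neg_one_mul] at h4
    exact ⟨_, h4.1, by rw [neg_one_mul]; exact h4.2, h3 ▸ hL4 m ξ h1 h2⟩
  have hLY : ∀ m, (∀ x ∈ Th κ, 0 < (-1 * a m) * x.im → S.τ m x ∈ Yset G) → L m ⊆ Yset G := fun m h => by
    obtain ⟨x, h1, h2, h3⟩ := hnear m true
    exact Ysub hK (hL1 m) (hL2 m) h3 (h x h1 h2)
  have hY : ∀ j, ∀ x ∈ Th κ, 0 < (-1 * a j) * x.im → S.τ j x ∈ Yset G := by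
    refine S.ind _ ?_ fun j hj => ?_
    · obtain ⟨z, hz, hzJ, hzY⟩ := Yfrontier hG hne hb (finite_range fun j => S.τ j rI)
      rw [S.hL] at hz
      obtain ⟨j, u, hu, rfl⟩ := mem_iUnion.1 hz
      simp only at hzJ hzY
      have hu' : u ∈ UO := by
        refine ⟨lt_of_le_of_ne hu.1 ?_, lt_of_le_of_ne hu.2 ?_⟩
        · rintro rfl
          obtain ⟨m, rfl⟩ := S.nx.surjective j
          exact hzJ ⟨m, S.nxτ m⟩
        · rintro rfl
          exact hzJ ⟨j, rfl⟩
      obtain ⟨x, hx, hxY⟩ := S.mid hG hκ hu' hzY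
      refine ⟨j, hsp j x hxY hx ?_⟩
      by_contra hcon
      push Not at hcon
      have : 0 ≤ a j * x.im := by linarith
      rcases this.eq_or_lt with h | h
      · have him := (mul_eq_zero.1 h.symm).resolve_left (ha0 j)
        have : x = x.re := by apply Complex.ext <;> simp [him]
        rw [this] at hxY
        exact hxY.1 (frontier_subset_closure (S.fr j ⟨hx.1, hx.2.1⟩))
      · exact hxY.1 (subset_closure (hhG j x hx h))
    · obtain ⟨x, h1, h2, h3⟩ := hnear j false
      exact hsp (S.nx j) x (hLY j hj h3) h1 h2
  refine ⟨{ M := S.M, τ := S.τ, V := S.V, V_open := S.V_open, V_convex := S.V_convex, V_conj := S.V_conj, a := a, a_ne := ha0,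
            Th_sub := fun j => (hTh j).symm ▸ hV, diff := S.diff, inj := S.inj, cd := cd, cd_pos := hcd, dist := ?_, sep := ?_,
            M_pos := S.Mp, G_open := hG, G_bdd := hb, G_conn := hcon, F_comp := hF, F_sub := hFG, hL := S.hL, tele := ?_,
            avoid := fun j x hx => hav j x (hTh j ▸ hx), halfG := fun j x hx => hhG j x (hTh j ▸ hx),
            halfY := fun j x hx h => hY j x (hTh j ▸ hx) (by linarith) }, ?_, fun g => rfl⟩
  · intro i j u hu v hv b hb
    refine hdist i j u hu v hv b ?_
    rcases hb with rfl | rfl <;> rcases ha j with h | h <;> simp [h]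
  · intro i j u hu x hx h
    rw [hTh] at hx
    have : x = x.re := by apply Complex.ext <;> simp [hoff i j u (Ioo_subset_Icc_self hu) x hx h]
    rw [this] at h
    obtain ⟨h1, h2⟩ := S.int i j u hu x.re ⟨hx.1, hx.2.1⟩ h
    exact ⟨h1, by rw [this, ← h2]⟩
  · intro f
    have h1 : ∀ j, f (S.τ j 1) = f (S.τ (S.nx j) 0) := fun j => by
      have := S.nxτ j
      rw [ofReal_one, ofReal_zero] at this; rw [this]
    rw [sum_sub_distrib, sum_congr rfl fun j _ => h1 j, Equiv.sum_comp S.nx fun j => f (S.τ j 0), sub_self]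
  · intro j k
    obtain ⟨m, rfl⟩ : ∃ m, S.ed m k = j := by
      cases k
      · exact S.nx.surjective j
      · exact ⟨j, rfl⟩
    obtain ⟨u0, hu0, h⟩ := mem_nhdsGT_iff_exists_Ioc_subset.1 (hend m k)
    have hY' := hLY m (hY m)
    refine ⟨S.τ m rI + t m * ee m, lv m, hlv m, ?_, u0, hu0, _, half_pos (sub_pos.2 (harg m k)), ?_, fun s hs => ?_⟩
    · dsimp only; rw [S.hh0]
      refine ⟨l0 m, l2 m, S.fr m (by simp), hY' (hL3 m), fun ξ h1 h2 => ?_⟩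
      rw [add_sub_cancel_left]
      exact hY' (hL4 m ξ h1 h2)
    · linarith [abs_nonneg (arg (S.wv m k * (1 - a' m k * I) / ee m)), harg m k]
    · dsimp only; rw [S.hh0]
      exact (h hs).1
end ES
end

/-- inequality (2.1). Let `∂G` be piecewise analytic with smallest
exterior angle `λπ`, `0 < λ < 2`, and let `F ⊆ G` be compact. Then there is
`C₁(G,F) > 0` such that for all `ζ ∈ F` and all `n ≥ 1`,
`(Σ_{k=n+1}^∞ |p_k(ζ)|²)^{1/2} ≤ C₁(G,F)·n^{-λ/(4-2λ)}`. -/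
theorem orthonormalPolys_tail_rate
    (D : JordanDomain) (B : PiecewiseAnalyticBoundary D)
    (lam : ℝ) (hlam0 : 0 < lam) (hlam2 : lam < 2)
    (hmin : ∀ i, lam ≤ B.extAngle i) (hattained : ∃ i, B.extAngle i = lam)
    (p : ℕ → Polynomial ℂ) (hp : D.IsONPolys p)
    (F : Set ℂ) (hF : IsCompact F) (hFG : F ⊆ D.G) :
    ∃ C : ℝ, 0 < C ∧ ∀ ζ ∈ F, ∀ n : ℕ, 0 < n →
      Real.sqrt (∑' k : ℕ, ‖(p (n + 1 + k)).eval ζ‖ ^ 2) ≤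
        C * (n : ℝ) ^ (-(lam / (4 - 2 * lam))) := by
  obtain ⟨S, hS⟩ := ES.exist D B lam hmin
  obtain ⟨E, hE, hg⟩ := S.toGeo D.isOpen D.nonempty D.bounded D.connected.isPreconnected hlam0 hF hFG
  exact final_of_geom D lam hlam0 p hp F E hE (fun g hgc => (hS g hgc).trans (hg g).symm)
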